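/- arXiv:2502.16904 — 4 statements merged into one kernel-verified Lean document; each statement's English description precedes it below -/
import Mathlib

section
/- Let m be a nonnegative integer, N a positive integer, Ω an open set in ℝ^N, K a compact subset of Ω, and F : Ω → ℝ a function of class C^m. Then there exists a constant C = C(m, N, K) > 0 such that for every sufficiently smooth u : (0,1] → ℝ^N taking all its values in K and with finite X^m norm, one has ‖F ∘ u‖_{X^m} ≤ C ‖F‖_{C^m(K)} (1 + ‖u‖_{X^m}), where ‖F‖_{C^m(K)} = max_{|α| ≤ m} sup_{x ∈ K} |∂^α F(x)|. -/
open MeasureTheory ENNReal RealInnerProductSpace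

noncomputable section

/-- The weighted L² norm `‖s^α v‖_{L²(0,1)} = (∫₀¹ s^{2α} ‖v s‖² ds)^{1/2}`, valued in `[0,∞]`. -/
def wL2 {E : Type*} [NormedAddCommGroup E] (α : ℝ) (v : ℝ → E) : ℝ≥0∞ :=
  (∫⁻ s in Set.Ioo (0:ℝ) 1, ENNReal.ofReal (s ^ (2 * α) * ‖v s‖ ^ 2)) ^ ((1:ℝ) / 2)

/-- The weighted L^∞ norm `‖s^α v‖_{L^∞(0,1)} = sup_{0<s<1} s^α ‖v s‖`, valued in `[0,∞]`. -/
def wLinf {E : Type*} [NormedAddCommGroup E] (α : ℝ) (v : ℝ → E) : ℝ≥0∞ :=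
  ⨆ s : Set.Ioo (0:ℝ) 1, ENNReal.ofReal ((s : ℝ) ^ α * ‖v (s : ℝ)‖)

/-- The square of the weighted Sobolev norm `X^m` on `(0,1)`:
for `m = 2k`, `‖u‖_{X^m}² = Σ_{i=0}^{k} ‖∂^i u‖² + Σ_{j=1}^{k} ‖s^j ∂^{k+j} u‖²`;
for `m = 2k+1`, `‖u‖_{X^m}² = Σ_{i=0}^{k} ‖∂^i u‖² + Σ_{j=1}^{k+1} ‖s^{j-1/2} ∂^{k+j} u‖²`. -/
def XnormSq {E : Type*} [NormedAddCommGroup E] [NormedSpace ℝ E] (m : ℕ) (u : ℝ → E) : ℝ≥0∞ :=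
  if m % 2 = 0 then
    (∑ i ∈ Finset.range (m / 2 + 1), wL2 0 (iteratedDeriv i u) ^ 2) +
      ∑ j ∈ Finset.range (m / 2), wL2 ((j : ℝ) + 1) (iteratedDeriv (m / 2 + j + 1) u) ^ 2
  else
    (∑ i ∈ Finset.range (m / 2 + 1), wL2 0 (iteratedDeriv i u) ^ 2) +
      ∑ j ∈ Finset.range (m / 2 + 1), wL2 ((j : ℝ) + 1 / 2) (iteratedDeriv (m / 2 + j + 1) u) ^ 2

/-- The weighted Sobolev norm `X^m`, valued in `[0,∞]`. -/
def Xnorm {E : Type*} [NormedAddCommGroup E] [NormedSpace ℝ E] (m : ℕ) (u : ℝ → E) : ℝ≥0∞ :=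
  XnormSq m u ^ ((1:ℝ) / 2)

/-- The square of the companion weighted Sobolev norm `Y^m` on `(0,1)`:
for `m = 2k`, `‖u‖_{Y^m}² = Σ_{i=0}^{k-1} ‖∂^i u‖² + Σ_{j=1}^{k+1} ‖s^{j-1/2} ∂^{k+j-1} u‖²`;
for `m = 2k+1`, `‖u‖_{Y^m}² = Σ_{i=0}^{k} ‖∂^i u‖² + Σ_{j=1}^{k+1} ‖s^{j} ∂^{k+j} u‖²`. -/
def YnormSq {E : Type*} [NormedAddCommGroup E] [NormedSpace ℝ E] (m : ℕ) (u : ℝ → E) : ℝ≥0∞ :=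
  if m % 2 = 0 then
    (∑ i ∈ Finset.range (m / 2), wL2 0 (iteratedDeriv i u) ^ 2) +
      ∑ j ∈ Finset.range (m / 2 + 1), wL2 ((j : ℝ) + 1 / 2) (iteratedDeriv (m / 2 + j) u) ^ 2
  else
    (∑ i ∈ Finset.range (m / 2 + 1), wL2 0 (iteratedDeriv i u) ^ 2) +
      ∑ j ∈ Finset.range (m / 2 + 1), wL2 ((j : ℝ) + 1) (iteratedDeriv (m / 2 + j + 1) u) ^ 2

/-- The weighted Sobolev norm `Y^m`, valued in `[0,∞]`. -/
def Ynorm {E : Type*} [NormedAddCommGroup E] [NormedSpace ℝ E] (m : ℕ) (u : ℝ → E) : ℝ≥0∞ :=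
  YnormSq m u ^ ((1:ℝ) / 2)

/-- Iterated coordinate partial derivative `∂^α F` (within `Ω`), where the multi-index is
recorded as the list of coordinate directions in which one differentiates. -/
def multiPDeriv {N : ℕ} (Ω : Set (EuclideanSpace ℝ (Fin N))) :
    List (Fin N) → (EuclideanSpace ℝ (Fin N) → ℝ) → EuclideanSpace ℝ (Fin N) → ℝ
  | [] => fun F => F
  | i :: l => fun F =>
      multiPDeriv Ω l (fun x => fderivWithin ℝ F Ω x (EuclideanSpace.single i 1))

/-- The `C^m(K)` norm `max_{|α| ≤ m} sup_{x ∈ K} |∂^α F(x)|`, the partial derivatives being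
taken within `Ω`, valued in `[0,∞]`. -/
def CmNormOn {N : ℕ} (m : ℕ) (F : EuclideanSpace ℝ (Fin N) → ℝ)
    (Ω K : Set (EuclideanSpace ℝ (Fin N))) : ℝ≥0∞ :=
  ⨆ (l : List (Fin N)) (_ : l.length ≤ m) (x : K),
    ENNReal.ofReal |multiPDeriv Ω l F (x : EuclideanSpace ℝ (Fin N))|

section helpers

open Set


theorem cc_taylor {E : Type*} [NormedAddCommGroup E] [NormedSpace ℝ E] [CompleteSpace E] (n : ℕ) :
    ∀ (D : ℕ → ℝ → E), (∀ b, ∀ x ∈ Ioo (0:ℝ) 2, HasDerivAt (D b) (D (b+1) x) x) →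
    ∀ s t : ℝ, 0 < s → s ≤ t → t ≤ 1 →
    ‖D 0 t - ∑ b ∈ Finset.range (n+1), ((t-s)^b / (b.factorial : ℝ)) • D b s‖
      ≤ (t-s)^n * ∫ x in s..t, ‖D (n+1) x‖ := by
  induction n with
  | zero =>
    intro D hD s t hs hst ht
    have hsub : uIcc s t ⊆ Ioo (0:ℝ) 2 := by
      rw [uIcc_of_le hst]; intro x hx; exact ⟨by linarith [hx.1], by linarith [hx.2]⟩
    have hii : IntervalIntegrable (D 1) volume s t :=
      ContinuousOn.intervalIntegrable fun x hx =>
        (hD 1 x (hsub hx)).continuousAt.continuousWithinAt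
    have := intervalIntegral.integral_eq_sub_of_hasDerivAt (fun x hx => hD 0 x (hsub hx)) hii
    simp only [zero_add, Finset.range_one, Finset.sum_singleton, pow_zero, Nat.factorial_zero,
      Nat.cast_one, div_one, one_smul, one_mul]
    rw [← this]
    exact intervalIntegral.norm_integral_le_integral_norm hst
  | succ n ih =>
    intro D hD s t hs hst ht
    have hii : ∀ x y, s ≤ x → x ≤ y → y ≤ t →
        IntervalIntegrable (fun z => ‖D (n+2) z‖) volume x y := by
      intro x y h1 h2 h3
      refine ContinuousOn.intervalIntegrable fun z hz => ?_
      rw [uIcc_of_le h2] at hz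
      exact ((hD (n+2) z ⟨by linarith [hz.1], by linarith [hz.2]⟩).continuousAt.continuousWithinAt).norm
    set h : ℝ → E := fun y => D 0 y -
      ∑ b ∈ Finset.range (n+1+1), ((y-s)^b / (b.factorial : ℝ)) • D b s with hh
    have hder : ∀ y ∈ Icc s t, HasDerivWithinAt h (D 1 y -
      ∑ b ∈ Finset.range (n+1), ((y-s)^b / (b.factorial : ℝ)) • D (b+1) s) (Icc s t) y := by
      intro y hy
      apply HasDerivAt.hasDerivWithinAt
      apply (hD 0 y ⟨by linarith [hy.1], by linarith [hy.2]⟩).sub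
      have : ∑ b ∈ Finset.range (n+1), ((y-s)^b / (b.factorial : ℝ)) • D (b+1) s =
        ∑ b ∈ Finset.range (n+1+1), ((b * (y-s)^(b-1) * 1) / (b.factorial : ℝ)) • D b s := by
        rw [Finset.sum_range_succ' _ (n+1)]
        simp only [Nat.cast_zero, zero_mul, zero_div, zero_smul, add_zero]
        refine Finset.sum_congr rfl fun b _ => ?_
        congr 1
        rw [Nat.factorial_succ]
        have : (b.factorial : ℝ) ≠ 0 := by positivity
        have : (b + 1 : ℝ) ≠ 0 := by positivity
        push_cast
        field_simp
      rw [this]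
      apply HasDerivAt.fun_sum
      intro b _
      apply HasDerivAt.smul_const
      apply HasDerivAt.div_const
      exact ((hasDerivAt_id y).sub_const s).pow b
    have hbd : ∀ y ∈ Ico s t, ‖D 1 y -
      ∑ b ∈ Finset.range (n+1), ((y-s)^b / (b.factorial : ℝ)) • D (b+1) s‖ ≤
        (t-s)^n * ∫ x in s..t, ‖D (n+2) x‖ := by
      intro y hy
      refine (ih (fun b => D (b+1)) (fun b x hx => hD (b+1) x hx) s y hs hy.1
        (by linarith [hy.2])).trans ?_
      have hm : ∫ x in s..y, ‖D (n+2) x‖ ≤ ∫ x in s..t, ‖D (n+2) x‖ := by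
        rw [← intervalIntegral.integral_add_adjacent_intervals
          (hii s y le_rfl hy.1 hy.2.le) (hii y t hy.1 hy.2.le le_rfl)]
        have : 0 ≤ ∫ x in y..t, ‖D (n+2) x‖ :=
          intervalIntegral.integral_nonneg hy.2.le fun _ _ => norm_nonneg _
        linarith
      have h0 : 0 ≤ ∫ x in s..y, ‖D (n+2) x‖ :=
          intervalIntegral.integral_nonneg hy.1 fun _ _ => norm_nonneg _
      have h1 : 0 ≤ y - s := by linarith [hy.1]
      have h2 : y - s ≤ t - s := by linarith [hy.2]
      gcongr
    have key := norm_image_sub_le_of_norm_deriv_le_segment' hder hbd t ⟨hst, le_rfl⟩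
    have hs0 : h s = 0 := by
      simp only [hh, sub_self]
      rw [Finset.sum_range_succ']
      simp
    rw [hs0, sub_zero] at key
    refine key.trans (le_of_eq ?_)
    ring

theorem cc_vander (n a : ℕ) (ha : a < n + 1) : ∃ c : Fin (n+1) → ℝ, ∀ b < n + 1,
    ∑ j : Fin (n+1), c j * ((j:ℝ) / ((n:ℝ)+1))^b = if b = a then 1 else 0 := by
  set x : Fin (n+1) → ℝ := fun j => (j:ℝ) / ((n:ℝ)+1) with hx
  have hinj : Function.Injective x := by
    intro i j hij
    have h : (n:ℝ)+1 ≠ 0 := by positivity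
    simp only [hx] at hij
    rw [div_left_inj' h] at hij
    exact Fin.ext (by exact_mod_cast hij)
  have hdet : IsUnit (Matrix.vandermonde x).det :=
    isUnit_iff_ne_zero.mpr (Matrix.det_vandermonde_ne_zero_iff.mpr hinj)
  refine ⟨Matrix.vecMul (Pi.single ⟨a, ha⟩ 1) (Matrix.vandermonde x)⁻¹, fun b hb => ?_⟩
  have h : Matrix.vecMul (Matrix.vecMul (Pi.single ⟨a, ha⟩ (1:ℝ)) (Matrix.vandermonde x)⁻¹)
      (Matrix.vandermonde x) = Pi.single ⟨a, ha⟩ 1 := by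
    rw [Matrix.vecMul_vecMul, Matrix.nonsing_inv_mul _ hdet, Matrix.vecMul_one]
  have := congrFun h ⟨b, hb⟩
  rw [Matrix.vecMul] at this
  simp only [dotProduct, Matrix.vandermonde_apply] at this
  rw [this, Pi.single_apply]
  simp [Fin.ext_iff]

theorem cc_ptwise {E : Type*} [NormedAddCommGroup E] [NormedSpace ℝ E] [CompleteSpace E]
    (n a : ℕ) (ha : a < n + 1) : ∃ C : ℝ, 0 ≤ C ∧
    ∀ (D : ℕ → ℝ → E), (∀ b, ∀ x ∈ Ioo (0:ℝ) 2, HasDerivAt (D b) (D (b+1) x) x) →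
    ∀ M : ℝ, (∀ x ∈ Ioc (0:ℝ) 1, ‖D 0 x‖ ≤ M) → ∀ s h : ℝ, 0 < s → 0 < h → s + h ≤ 1 →
    ‖D a s‖ ≤ C * (M + h^n * ∫ x in s..(s+h), ‖D (n+1) x‖) / h^a := by
  obtain ⟨c, hc⟩ := cc_vander n a ha
  refine ⟨(a.factorial : ℝ) * ∑ j, |c j|, by positivity, ?_⟩
  intro D hD M hM s h hs hh hsh
  set B := M + h^n * ∫ x in s..(s+h), ‖D (n+1) x‖ with hB
  set x : Fin (n+1) → ℝ := fun j => (j:ℝ) / ((n:ℝ)+1) with hx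
  have hii : ∀ p q, s ≤ p → p ≤ q → q ≤ s + h →
        IntervalIntegrable (fun z => ‖D (n+1) z‖) volume p q := by
    intro p y h1 h2 h3
    refine ContinuousOn.intervalIntegrable fun z hz => ?_
    rw [uIcc_of_le h2] at hz
    exact ((hD (n+1) z ⟨by linarith [hz.1], by linarith [hz.2]⟩).continuousAt.continuousWithinAt).norm
  have hx0 : ∀ j, 0 ≤ x j := fun j => by simp only [hx]; positivity
  have hx1 : ∀ j, x j ≤ 1 := fun j => by
    simp only [hx]
    rw [div_le_one (by positivity)]
    have : (j:ℕ) ≤ n := by omega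
    have : ((j:ℕ):ℝ) ≤ n := by exact_mod_cast this
    linarith
  have hP : ∀ j, ‖∑ b ∈ Finset.range (n+1), ((h * x j)^b / (b.factorial : ℝ)) • D b s‖ ≤ B := by
    intro j
    have e1 : 0 ≤ h * x j := mul_nonneg hh.le (hx0 j)
    have e2 : h * x j ≤ h := by nlinarith [hx1 j]
    have ht := cc_taylor n D hD s (s + h * x j) hs (by linarith) (by linarith)
    have hm := hM (s + h * x j) ⟨by linarith, by linarith⟩
    rw [add_sub_cancel_left] at ht
    have h3 : (h * x j)^n * ∫ x in s..(s + h * x j), ‖D (n+1) x‖ ≤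
        h^n * ∫ x in s..(s + h), ‖D (n+1) x‖ := by
      have hm : ∫ z in s..(s+h*x j), ‖D (n+1) z‖ ≤ ∫ z in s..(s+h), ‖D (n+1) z‖ := by
        rw [← intervalIntegral.integral_add_adjacent_intervals
          (hii s (s+h * x j) le_rfl (by linarith) (by linarith))
          (hii (s+h*x j) (s+h) (by linarith) (by linarith) le_rfl)]
        have : 0 ≤ ∫ z in (s+h*x j)..(s+h), ‖D (n+1) z‖ :=
          intervalIntegral.integral_nonneg (by linarith) fun _ _ => norm_nonneg _
        linarith
      have h0 : 0 ≤ ∫ z in s..(s+h*x j), ‖D (n+1) z‖ :=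
          intervalIntegral.integral_nonneg (by linarith) fun _ _ => norm_nonneg _
      gcongr
    have := norm_sub_norm_le (∑ b ∈ Finset.range (n+1), ((h * x j)^b / (b.factorial : ℝ)) • D b s)
      (D 0 (s + h * x j))
    rw [norm_sub_rev] at this
    linarith
  have hsum : ∑ j, c j • ∑ b ∈ Finset.range (n+1), ((h * x j)^b / (b.factorial : ℝ)) • D b s
      = (h^a / (a.factorial : ℝ)) • D a s := by
    simp_rw [Finset.smul_sum, smul_smul]
    rw [Finset.sum_comm]
    rw [Finset.sum_eq_single_of_mem a (Finset.mem_range.mpr ha)]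
    · rw [← Finset.sum_smul]
      congr 1
      have := hc a ha
      rw [if_pos rfl] at this
      calc _ = (h^a / (a.factorial : ℝ)) * ∑ j, c j * x j ^ a := by
            rw [Finset.mul_sum]; refine Finset.sum_congr rfl fun j _ => ?_
            rw [mul_pow]; ring
        _ = _ := by rw [this, mul_one]
    · intro b hb hba
      rw [← Finset.sum_smul]
      have := hc b (Finset.mem_range.mp hb)
      rw [if_neg hba] at this
      have h2 : ∑ j, c j * ((h * x j)^b / (b.factorial : ℝ)) = 0 := by
        calc _ = (h^b / (b.factorial : ℝ)) * ∑ j, c j * x j ^ b := by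
              rw [Finset.mul_sum]; refine Finset.sum_congr rfl fun j _ => ?_
              rw [mul_pow]; ring
          _ = _ := by rw [this, mul_zero]
      rw [h2, zero_smul]
  have hn : ‖(h^a / (a.factorial : ℝ)) • D a s‖ ≤ (∑ j, |c j|) * B := by
    rw [← hsum, Finset.sum_mul]
    refine (norm_sum_le _ _).trans (Finset.sum_le_sum fun j _ => ?_)
    rw [norm_smul, Real.norm_eq_abs]
    exact mul_le_mul_of_nonneg_left (hP j) (abs_nonneg _)
  rw [norm_smul, Real.norm_of_nonneg (by positivity)] at hn
  have hf : (0:ℝ) < a.factorial := by positivity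
  rw [le_div_iff₀ (by positivity)]
  rw [div_mul_eq_mul_div, div_le_iff₀ hf] at hn
  linarith

theorem cc_cov (H : ℝ → ℝ≥0∞) (hH : Measurable H) (d : ℝ → ℝ) (hd : Monotone d) (θ : ℝ)
    (h0 : 0 < θ) (h1 : θ < 1) :
    ∫⁻ s, H ((1-θ)*s + θ * d s) ≤ ENNReal.ofReal (1/(1-θ)) * ∫⁻ t, H t := by
  set φ : ℝ → ℝ := fun s => (1-θ)*s + θ * d s with hφ
  have hmeas : Measurable φ := by
    have := hd.measurable
    fun_prop
  have hθ : 0 < 1 - θ := by linarith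
  have hanti : AntilipschitzWith (Real.toNNReal (1/(1-θ))) φ := by
    apply AntilipschitzWith.of_le_mul_dist
    intro x y
    rw [Real.coe_toNNReal _ (by positivity), div_mul_eq_mul_div, le_div_iff₀ hθ, one_mul]
    wlog hxy : x ≤ y generalizing x y
    · rw [dist_comm x y, dist_comm (φ x)]; exact this y x (le_of_not_ge hxy)
    rw [dist_comm, dist_comm (φ x), Real.dist_eq, Real.dist_eq, abs_of_nonneg (by linarith)]
    refine le_trans ?_ (le_abs_self _)
    have := mul_le_mul_of_nonneg_left (hd hxy) h0.le
    simp only [hφ]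
    linarith
  have hle : Measure.map φ volume ≤ ENNReal.ofReal (1/(1-θ)) • volume := by
    rw [Measure.le_iff]
    intro A hA
    rw [Measure.map_apply hmeas hA]
    have := hanti.hausdorffMeasure_preimage_le (d := 1) zero_le_one A
    rw [hausdorffMeasure_real, ENNReal.rpow_one] at this
    rw [Measure.smul_apply, smul_eq_mul]
    exact this
  calc ∫⁻ s, H (φ s) = ∫⁻ t, H t ∂(Measure.map φ volume) := (lintegral_map hH hmeas).symm
    _ ≤ ∫⁻ t, H t ∂(ENNReal.ofReal (1/(1-θ)) • volume) := lintegral_mono' hle le_rfl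
    _ = _ := by rw [lintegral_smul_measure]; rfl

theorem cc_max (H : ℝ → ℝ≥0∞) (hH : Measurable H) (d : ℝ → ℝ) (hd : Monotone d) :
    ∫⁻ s, ∫⁻ θ in Ioo (0:ℝ) 1, ENNReal.ofReal ((1-θ)^2) * H ((1-θ)*s + θ * d s) ≤ ∫⁻ t, H t := by
  have hm := hd.measurable
  rw [lintegral_lintegral_swap]
  · calc _ ≤ ∫⁻ θ in Ioo (0:ℝ) 1, ∫⁻ t, H t := by
          refine setLIntegral_mono measurable_const fun θ hθ => ?_
          rw [lintegral_const_mul _ (by fun_prop)]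
          calc _ ≤ ENNReal.ofReal ((1-θ)^2) * (ENNReal.ofReal (1/(1-θ)) * ∫⁻ t, H t) := by
                gcongr
                exact cc_cov H hH d hd θ hθ.1 hθ.2
            _ = ENNReal.ofReal ((1-θ)^2 * (1/(1-θ))) * ∫⁻ t, H t := by
                rw [← mul_assoc, ENNReal.ofReal_mul (by positivity)]
            _ ≤ 1 * ∫⁻ t, H t := by
                gcongr
                rw [ENNReal.ofReal_le_one]
                have : 0 < 1 - θ := by linarith [hθ.2]
                have h2 : (1-θ)^2 * (1/(1-θ)) = 1 - θ := by field_simp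
                rw [h2]; linarith [hθ.1]
            _ = _ := one_mul _
      _ = _ := by simp
  · apply Measurable.aemeasurable
    simp only [Function.uncurry_def]
    fun_prop

theorem cc_scale (g : ℝ → ℝ) (hg : ContinuousOn g (Ioo 0 2)) (hg0 : ∀ x, 0 ≤ g x) (k : ℕ) (M : ℝ)
    (hM : 0 < M) : ∃ d : ℝ → ℝ, Monotone d ∧ ∀ s ∈ Ioo (0:ℝ) 1, s < d s ∧ d s ≤ 1 ∧
      (d s - s)^k * (∫ x in s..(d s), (d s - x) * g x) ≤ M ∧
      (d s < 1 → (d s - s)^k * (∫ x in s..(d s), (d s - x) * g x) = M) := by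
  set Φ : ℝ → ℝ → ℝ := fun s t => (t - s)^k * (∫ x in s..t, (t - x) * g x) with hΦ
  have hii : ∀ c p q, 0 < p → p ≤ q → q ≤ 1 →
      IntervalIntegrable (fun x => (c - x) * g x) volume p q := by
    intro c p q hp hpq hq
    apply ContinuousOn.intervalIntegrable
    rw [uIcc_of_le hpq]
    refine ContinuousOn.mul (by fun_prop) (hg.mono fun x hx => ⟨by linarith [hx.1], by linarith [hx.2]⟩)
  have hnn : ∀ p q c, p ≤ q → q ≤ c → 0 ≤ ∫ x in p..q, (c - x) * g x := by
    intro p q c hpq hqc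
    exact intervalIntegral.integral_nonneg hpq fun x hx =>
      mul_nonneg (by linarith [hx.2]) (hg0 x)
  have hmono : ∀ s s' t, 0 < s → s ≤ s' → s' ≤ t → t ≤ 1 → Φ s' t ≤ Φ s t := by
    intro s s' t h0 h1 h2 h3
    simp only [hΦ]
    have e : ∫ x in s'..t, (t - x) * g x ≤ ∫ x in s..t, (t - x) * g x := by
      rw [← intervalIntegral.integral_add_adjacent_intervals (hii t s s' h0 h1 (by linarith))
        (hii t s' t (by linarith) h2 h3)]
      linarith [hnn s s' t h1 h2]
    have e0 := hnn s' t t h2 le_rfl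
    have e1 : 0 ≤ t - s' := by linarith
    have e2 : t - s' ≤ t - s := by linarith
    have e3 : 0 ≤ t - s := by linarith
    gcongr
  have hcont : ∀ s, 0 < s → s ≤ 1 → ContinuousOn (Φ s) (Icc s 1) := by
    intro s h0 h1
    have hs : ContinuousOn g (Icc s 1) :=
      hg.mono fun x hx => ⟨by linarith [hx.1], by linarith [hx.2]⟩
    have hi1 : IntegrableOn g (uIcc s 1) volume := by
      rw [uIcc_of_le h1]; exact hs.integrableOn_Icc
    have hi2 : IntegrableOn (fun x => x * g x) (uIcc s 1) volume := by
      rw [uIcc_of_le h1]; exact (continuousOn_id.mul hs).integrableOn_Icc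
    have c1 := intervalIntegral.continuousOn_primitive_interval hi1
    have c2 := intervalIntegral.continuousOn_primitive_interval hi2
    rw [uIcc_of_le h1] at c1 c2
    have : ContinuousOn (fun t => (t-s)^k * (t * (∫ x in s..t, g x) - ∫ x in s..t, x * g x))
        (Icc s 1) := by
      refine ContinuousOn.mul (by fun_prop) (ContinuousOn.sub (continuousOn_id.mul c1) c2)
    refine this.congr fun t ht => ?_
    simp only [hΦ]
    congr 1
    rw [← intervalIntegral.integral_const_mul, ← intervalIntegral.integral_sub]
    · refine intervalIntegral.integral_congr fun x _ => ?_
      ring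
    · apply IntervalIntegrable.const_mul
      apply ContinuousOn.intervalIntegrable
      rw [uIcc_of_le ht.1]
      exact hs.mono (Icc_subset_Icc_right ht.2)
    · apply ContinuousOn.intervalIntegrable
      rw [uIcc_of_le ht.1]
      exact (continuousOn_id.mul hs).mono (Icc_subset_Icc_right ht.2)
  set S : ℝ → Set ℝ := fun s => {t | t ∈ Icc s 1 ∧ Φ s t ≤ M} with hS
  have hss : ∀ s, Φ s s = 0 := fun s => by simp [hΦ]
  have hself : ∀ s ∈ Ioo (0:ℝ) 1, s ∈ S s := fun s hs =>
    ⟨⟨le_rfl, hs.2.le⟩, by rw [hss]; exact hM.le⟩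
  have hbdd : ∀ s, BddAbove (S s) := fun s => ⟨1, fun t ht => ht.1.2⟩
  have hmem : ∀ s ∈ Ioo (0:ℝ) 1, sSup (S s) ∈ S s := by
    intro s hs
    have : IsCompact (S s) := by
      have h1 : IsClosed (Icc s 1 ∩ (Φ s) ⁻¹' (Iic M)) :=
        (hcont s hs.1 hs.2.le).preimage_isClosed_of_isClosed isClosed_Icc isClosed_Iic
      exact isCompact_Icc.of_isClosed_subset h1 inter_subset_left
    exact this.sSup_mem ⟨s, hself s hs⟩
  have hmonoOn : MonotoneOn (fun s => sSup (S s)) (Ioo 0 1) := by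
    intro s hs s' hs' hle
    simp only
    by_cases hc : sSup (S s) ≤ s'
    · exact hc.trans (le_csSup (hbdd s') (hself s' hs'))
    · push Not at hc
      have hm := hmem s hs
      refine le_csSup (hbdd s') ⟨⟨hc.le, hm.1.2⟩, ?_⟩
      exact (hmono s s' _ hs.1 hle hc.le hm.1.2).trans hm.2
  obtain ⟨d, hd, heq⟩ := hmonoOn.exists_monotone_extension
    ⟨0, by rintro _ ⟨s, hs, rfl⟩; exact hs.1.le.trans (hmem s hs).1.1⟩
    ⟨1, by rintro _ ⟨s, hs, rfl⟩; exact (hmem s hs).1.2⟩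
  refine ⟨d, hd, fun s hs => ?_⟩
  have heqs : sSup (S s) = d s := heq hs
  have hm := hmem s hs
  have hub : ∀ t ∈ S s, t ≤ d s := fun t ht => heqs ▸ le_csSup (hbdd s) ht
  rw [heqs] at hm
  have hsc : d s < 1 → Φ s (d s) = M := by
    intro hlt
    by_contra hne
    have hlt' : Φ s (d s) < M := lt_of_le_of_ne hm.2 hne
    by_cases h1 : Φ s 1 ≤ M
    · have := hub 1 ⟨⟨hs.2.le, le_rfl⟩, h1⟩
      linarith
    · push Not at h1
      have := intermediate_value_Icc hlt.le
        ((hcont s hs.1 hs.2.le).mono (Icc_subset_Icc_left hm.1.1))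
      obtain ⟨t, ht, htM⟩ := this ⟨hlt'.le, h1.le⟩
      have h2 := hub t ⟨⟨hm.1.1.trans ht.1, ht.2⟩, htM.le⟩
      have h3 : t = d s := le_antisymm h2 ht.1
      rw [h3] at htM
      linarith
  refine ⟨?_, hm.1.2, hm.2, hsc⟩
  rcases hm.1.1.lt_or_eq with h | h
  · exact h
  · exfalso
    have := hsc (by rw [← h]; exact hs.2)
    rw [← h, hss] at this
    linarith

theorem cc_sq (f : ℝ → ℝ≥0∞) (hf : AEMeasurable f (volume.restrict (Ioo (0:ℝ) 1))) :
    (∫⁻ θ in Ioo (0:ℝ) 1, f θ)^2 ≤ ∫⁻ θ in Ioo (0:ℝ) 1, (f θ)^2 := by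
  have h := ENNReal.lintegral_mul_le_Lp_mul_Lq (volume.restrict (Ioo (0:ℝ) 1))
    Real.HolderConjugate.two_two hf (g := fun _ => 1) aemeasurable_const
  simp only [Pi.mul_apply, mul_one, ENNReal.one_rpow, lintegral_const, Measure.restrict_apply_univ,
    Real.volume_Ioo, sub_zero, ENNReal.ofReal_one] at h
  calc _ ≤ ((∫⁻ θ in Ioo (0:ℝ) 1, (f θ)^(2:ℝ))^(1/2:ℝ))^2 := by gcongr
    _ = ∫⁻ θ in Ioo (0:ℝ) 1, (f θ)^(2:ℝ) := by
      rw [← ENNReal.rpow_natCast, ← ENNReal.rpow_mul]; norm_num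
    _ = _ := by simp

theorem cc_T (g : ℝ → ℝ) (hg : ContinuousOn g (Ioo 0 2)) (hg0 : ∀ x, 0 ≤ g x) (γ : ℝ) (hγ : 0 ≤ γ)
    (s d : ℝ) (hs : 0 < s) (hsd : s < d) (hd : d ≤ 1) :
    ENNReal.ofReal (s^γ * (∫ θ in (0:ℝ)..1, (1-θ) * g ((1-θ)*s + θ*d))^2) ≤
      ∫⁻ θ in Ioo (0:ℝ) 1, ENNReal.ofReal ((1-θ)^2) *
        (Ioo (0:ℝ) 1).indicator (fun t => ENNReal.ofReal (t^γ * g t^2)) ((1-θ)*s + θ*d) := by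
  have hφ : ∀ θ ∈ Icc (0:ℝ) 1, s ≤ (1-θ)*s + θ*d ∧ (1-θ)*s + θ*d ≤ d := fun θ hθ =>
    ⟨by nlinarith [hθ.1, hθ.2], by nlinarith [hθ.1, hθ.2]⟩
  have hφ1 : ∀ θ ∈ Ioo (0:ℝ) 1, (1-θ)*s + θ*d < 1 := fun θ hθ => by nlinarith [hθ.1, hθ.2]
  have hc : ContinuousOn (fun θ => (1-θ) * g ((1-θ)*s + θ*d)) (Icc 0 1) := by
    refine ContinuousOn.mul (by fun_prop) (hg.comp (by fun_prop) fun θ hθ => ?_)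
    exact ⟨by linarith [(hφ θ hθ).1], by linarith [(hφ θ hθ).2]⟩
  have hT : ENNReal.ofReal (∫ θ in (0:ℝ)..1, (1-θ) * g ((1-θ)*s + θ*d)) =
      ∫⁻ θ in Ioo (0:ℝ) 1, ENNReal.ofReal ((1-θ) * g ((1-θ)*s + θ*d)) := by
    rw [intervalIntegral.integral_of_le zero_le_one, integral_Ioc_eq_integral_Ioo,
      ofReal_integral_eq_lintegral_ofReal]
    · exact hc.integrableOn_Icc.mono_set Ioo_subset_Icc_self
    · filter_upwards [ae_restrict_mem measurableSet_Ioo] with θ hθ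
      exact mul_nonneg (by linarith [hθ.2]) (hg0 _)
  have hT0 : 0 ≤ ∫ θ in (0:ℝ)..1, (1-θ) * g ((1-θ)*s + θ*d) :=
    intervalIntegral.integral_nonneg zero_le_one fun θ hθ =>
      mul_nonneg (by linarith [hθ.2]) (hg0 _)
  have hsγ : 0 ≤ s^γ := Real.rpow_nonneg hs.le _
  rw [ENNReal.ofReal_mul hsγ, ENNReal.ofReal_pow hT0, hT]
  calc _ ≤ ENNReal.ofReal (s^γ) *
        ∫⁻ θ in Ioo (0:ℝ) 1, (ENNReal.ofReal ((1-θ) * g ((1-θ)*s + θ*d)))^2 := by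
        gcongr
        apply cc_sq
        apply ENNReal.measurable_ofReal.comp_aemeasurable
        exact (hc.mono Ioo_subset_Icc_self).aemeasurable measurableSet_Ioo
    _ = ∫⁻ θ in Ioo (0:ℝ) 1, ENNReal.ofReal (s^γ) *
          (ENNReal.ofReal ((1-θ) * g ((1-θ)*s + θ*d)))^2 := by
        rw [lintegral_const_mul' _ _ ENNReal.ofReal_ne_top]
    _ ≤ _ := by
        refine setLIntegral_mono' measurableSet_Ioo fun θ hθ => ?_
        have h1 := hφ θ (Ioo_subset_Icc_self hθ)
        have h2 := hφ1 θ hθ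
        rw [indicator_of_mem (show (1-θ)*s + θ*d ∈ Ioo (0:ℝ) 1 from ⟨by linarith [h1.1], h2⟩)]
        have h3 : 0 ≤ (1-θ) * g ((1-θ)*s + θ*d) := mul_nonneg (by linarith [hθ.2]) (hg0 _)
        rw [← ENNReal.ofReal_pow h3, ← ENNReal.ofReal_mul hsγ, ← ENNReal.ofReal_mul (by positivity)]
        apply ENNReal.ofReal_le_ofReal
        have h4 : s^γ ≤ ((1-θ)*s + θ*d)^γ := Real.rpow_le_rpow hs.le h1.1 hγ
        calc _ = s^γ * ((1-θ)^2 * g ((1-θ)*s + θ*d)^2) := by ring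
          _ ≤ ((1-θ)*s + θ*d)^γ * ((1-θ)^2 * g ((1-θ)*s + θ*d)^2) := by gcongr
          _ = _ := by ring

theorem cc_half {E : Type*} [NormedAddCommGroup E] [NormedSpace ℝ E] [CompleteSpace E]
    (k a : ℕ) (ha : a < k + 2) (ha1 : 1 ≤ a) (M : ℝ) (hM1 : 0 < M) : ∃ C : ℝ, 0 ≤ C ∧
    ∀ γ : ℝ, 0 ≤ γ →
    ∀ (D : ℕ → ℝ → E), (∀ b, ∀ x ∈ Ioo (0:ℝ) 2, HasDerivAt (D b) (D (b+1) x) x) →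
    (∀ x ∈ Ioc (0:ℝ) 1, ‖D 0 x‖ ≤ M) →
    ∫⁻ s in Ioo (0:ℝ) (3/4), ENNReal.ofReal (s^γ * ‖D a s‖^(2*((k+2:ℕ):ℝ)/(a:ℝ))) ≤
      ENNReal.ofReal C * (1 + ∫⁻ s in Ioo (0:ℝ) 1, ENNReal.ofReal (s^γ * ‖D (k+2) s‖^2)) := by
  obtain ⟨C0, hC0, hpt⟩ := cc_ptwise (E := E) (k+1) a ha
  set p : ℝ := 2*((k+2:ℕ):ℝ)/(a:ℝ) with hp
  have hapos : (0:ℝ) < a := by exact_mod_cast ha1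
  have hp0 : 0 ≤ p := by positivity
  set C1 : ℝ := C0 * (2*M) * 2^a with hC1
  have hC1' : 0 ≤ C1 := by positivity
  set C2 : ℝ := C1^p * (4^(2*(k+2)) + 1/M^2) with hC2
  have hC2' : 0 ≤ C2 := by positivity
  refine ⟨C2, hC2', ?_⟩
  intro γ hγ D hD hM
  have hcD : ContinuousOn (fun x => ‖D (k+2) x‖) (Ioo 0 2) := fun x hx =>
    (hD (k+2) x hx).continuousAt.continuousWithinAt.norm
  obtain ⟨d, hd, hds⟩ := cc_scale (fun x => ‖D (k+2) x‖) hcD (fun x => norm_nonneg _) k M hM1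
  set H : ℝ → ℝ≥0∞ :=
    (Ioo (0:ℝ) 1).indicator (fun t => ENNReal.ofReal (t^γ * ‖D (k+2) t‖^2)) with hH
  have hHm : Measurable H := by
    classical
    rw [hH, ← Set.piecewise_eq_indicator]
    refine ContinuousOn.measurable_piecewise ?_ continuousOn_const measurableSet_Ioo
    refine ENNReal.continuous_ofReal.comp_continuousOn ?_
    refine ContinuousOn.mul ?_ ((hcD.mono (Ioo_subset_Ioo_right (by norm_num))).pow 2)
    exact ContinuousOn.rpow_const continuousOn_id fun x hx => Or.inr hγ
  have key : ∀ s ∈ Ioo (0:ℝ) (3/4), ENNReal.ofReal (s^γ * ‖D a s‖^p) ≤ ENNReal.ofReal C2 *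
      (1 + ∫⁻ θ in Ioo (0:ℝ) 1, ENNReal.ofReal ((1-θ)^2) * H ((1-θ)*s + θ * d s)) := by
    intro s hs
    obtain ⟨h1, h2, h3, h4⟩ := hds s ⟨hs.1, by linarith [hs.2]⟩
    set h := d s - s with hh
    have hpos : 0 < h := by linarith
    have hds' : d s = s + h := by simp [hh]
    have hsub : ∀ x ∈ Icc s (d s), x ∈ Ioo (0:ℝ) 2 := fun x hx =>
      ⟨by linarith [hx.1, hs.1], by linarith [hx.2]⟩
    have hDa : ‖D a s‖ ≤ C1 / h^a := by
      have e := hpt D hD M hM s (h/2) hs.1 (by positivity) (by linarith)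
      have e2 : (h/2) * ∫ x in s..(s+h/2), ‖D (k+2) x‖ ≤
          ∫ x in s..(d s), (d s - x) * ‖D (k+2) x‖ := by
        have i1 : IntervalIntegrable (fun x => ‖D (k+2) x‖) volume s (s+h/2) := by
          apply ContinuousOn.intervalIntegrable
          rw [uIcc_of_le (by linarith)]
          exact hcD.mono fun x hx => hsub x ⟨hx.1, by linarith [hx.2]⟩
        have i2 : ContinuousOn (fun x => (d s - x) * ‖D (k+2) x‖) (Icc s (d s)) :=
          ContinuousOn.mul (by fun_prop) (hcD.mono hsub)
        have i3 : IntervalIntegrable (fun x => (d s - x) * ‖D (k+2) x‖) volume s (s+h/2) := by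
          apply ContinuousOn.intervalIntegrable
          rw [uIcc_of_le (by linarith)]
          exact i2.mono (Icc_subset_Icc_right (by linarith))
        have i4 : IntervalIntegrable (fun x => (d s - x) * ‖D (k+2) x‖) volume (s+h/2) (d s) := by
          apply ContinuousOn.intervalIntegrable
          rw [uIcc_of_le (by linarith)]
          exact i2.mono (Icc_subset_Icc_left (by linarith))
        rw [← intervalIntegral.integral_add_adjacent_intervals i3 i4,
          ← intervalIntegral.integral_const_mul]
        have j1 : ∫ x in s..(s+h/2), (h/2) * ‖D (k+2) x‖ ≤
            ∫ x in s..(s+h/2), (d s - x) * ‖D (k+2) x‖ := by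
          apply intervalIntegral.integral_mono_on (by linarith) (i1.const_mul _) i3
          intro x hx
          exact mul_le_mul_of_nonneg_right (by linarith [hx.2]) (norm_nonneg _)
        have j2 : 0 ≤ ∫ x in (s+h/2)..(d s), (d s - x) * ‖D (k+2) x‖ :=
          intervalIntegral.integral_nonneg (by linarith) fun x hx =>
            mul_nonneg (by linarith [hx.2]) (norm_nonneg _)
        linarith
      have e3 : (h/2)^(k+1) * ∫ x in s..(s+h/2), ‖D (k+2) x‖ ≤ M := by
        refine le_trans ?_ h3
        rw [pow_succ, mul_assoc]
        have j0 : 0 ≤ ∫ x in s..(s+h/2), ‖D (k+2) x‖ :=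
          intervalIntegral.integral_nonneg (by linarith) fun x hx => norm_nonneg _
        have j3 : h/2 ≤ h := by linarith
        gcongr
      refine e.trans ?_
      rw [show C1 / h^a = C0 * (M + M) / (h/2)^a by rw [hC1, div_pow]; field_simp; ring]
      gcongr
    have hDp : ‖D a s‖^p ≤ C1^p * (h^(2*(k+2)))⁻¹ := by
      calc ‖D a s‖^p ≤ (C1 / h^a)^p := Real.rpow_le_rpow (norm_nonneg _) hDa hp0
        _ = _ := by
          rw [Real.div_rpow hC1' (by positivity), div_eq_mul_inv]
          congr 2
          rw [← Real.rpow_natCast h a, ← Real.rpow_mul hpos.le, ← Real.rpow_natCast]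
          congr 1
          rw [hp]; push_cast; field_simp
    have hsγ : 0 ≤ s^γ := Real.rpow_nonneg hs.1.le _
    have hsγ1 : s^γ ≤ 1 := Real.rpow_le_one hs.1.le (by linarith [hs.2]) hγ
    have hC1p : 0 ≤ C1^p := Real.rpow_nonneg hC1' _
    rcases h2.lt_or_eq with hlt | heq
    · have hMe := h4 hlt
      have hT : ∫ x in s..(d s), (d s - x) * ‖D (k+2) x‖ =
          h^2 * ∫ θ in (0:ℝ)..1, (1-θ) * ‖D (k+2) ((1-θ)*s + θ*d s)‖ := by
        have := intervalIntegral.smul_integral_comp_add_mul (a := 0) (b := 1)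
          (fun x => (d s - x) * ‖D (k+2) x‖) h s
        rw [mul_zero, add_zero, mul_one, ← hds'] at this
        rw [← this, smul_eq_mul, sq, mul_assoc]
        congr 1
        rw [← intervalIntegral.integral_const_mul]
        refine intervalIntegral.integral_congr fun θ _ => ?_
        have e : (1-θ)*s + θ*d s = s + h*θ := by rw [hds']; ring
        simp only [e]
        rw [hds']; ring
      set T := ∫ θ in (0:ℝ)..1, (1-θ) * ‖D (k+2) ((1-θ)*s + θ*d s)‖ with hTd
      have hinv : (h^(2*(k+2)))⁻¹ = 1/M^2 * T^2 := by
        rw [hT] at hMe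
        have hhne : h ≠ 0 := hpos.ne'
        have : M^2 = h^(2*(k+2)) * T^2 := by rw [← hMe]; ring
        have hT0 : T ≠ 0 := by
          intro h0; rw [h0] at hMe; simp at hMe; linarith
        rw [this]; field_simp
      have hcT := cc_T (fun x => ‖D (k+2) x‖) hcD (fun x => norm_nonneg _) γ hγ s (d s) hs.1 h1 h2
      calc _ ≤ ENNReal.ofReal (C2 * (s^γ * T^2)) := by
            apply ENNReal.ofReal_le_ofReal
            calc s^γ * ‖D a s‖^p ≤ s^γ * (C1^p * (1/M^2 * T^2)) := by rw [← hinv]; gcongr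
              _ = (C1^p * (0 + 1/M^2)) * (s^γ * T^2) := by ring
              _ ≤ C2 * (s^γ * T^2) := by rw [hC2]; gcongr; positivity
        _ = ENNReal.ofReal C2 * ENNReal.ofReal (s^γ * T^2) := ENNReal.ofReal_mul hC2'
        _ ≤ _ := by
          gcongr
          exact hcT.trans le_add_self
    · have h4h : 1/4 ≤ h := by rw [hh, heq]; linarith [hs.2]
      calc _ ≤ ENNReal.ofReal (C2 * 1) := by
            apply ENNReal.ofReal_le_ofReal
            calc s^γ * ‖D a s‖^p ≤ 1 * (C1^p * (h^(2*(k+2)))⁻¹) := by gcongr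
              _ ≤ 1 * (C1^p * ((1/4)^(2*(k+2)))⁻¹) := by gcongr
              _ = C1^p * (4^(2*(k+2)) + 0) := by rw [one_mul, ← inv_pow]; norm_num
              _ ≤ C2 * 1 := by rw [hC2, mul_one]; gcongr; positivity
        _ = ENNReal.ofReal C2 * 1 := by simp
        _ ≤ _ := by gcongr; exact le_self_add
  have hmd := hd.measurable
  have hmeas2 : Measurable fun s : ℝ =>
      ∫⁻ θ in Ioo (0:ℝ) 1, ENNReal.ofReal ((1-θ)^2) * H ((1-θ)*s + θ * d s) := by
    apply Measurable.lintegral_prod_right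
    simp only [Function.uncurry_def]
    fun_prop
  calc _ ≤ ∫⁻ s in Ioo (0:ℝ) (3/4), ENNReal.ofReal C2 *
      (1 + ∫⁻ θ in Ioo (0:ℝ) 1, ENNReal.ofReal ((1-θ)^2) * H ((1-θ)*s + θ * d s)) :=
        setLIntegral_mono' measurableSet_Ioo key
    _ = ENNReal.ofReal C2 * ((∫⁻ _ in Ioo (0:ℝ) (3/4), 1) + ∫⁻ s in Ioo (0:ℝ) (3/4),
        ∫⁻ θ in Ioo (0:ℝ) 1, ENNReal.ofReal ((1-θ)^2) * H ((1-θ)*s + θ * d s)) := by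
        rw [lintegral_const_mul' _ _ ENNReal.ofReal_ne_top, lintegral_add_left measurable_const]
    _ ≤ _ := by
        refine mul_le_mul_right (add_le_add ?_ ?_) _
        · simp only [lintegral_const, Measure.restrict_apply_univ, Real.volume_Ioo, one_mul]
          rw [ENNReal.ofReal_le_one]; norm_num
        · refine (setLIntegral_le_lintegral _ _).trans ((cc_max H hHm d hd).trans ?_)
          rw [hH, lintegral_indicator measurableSet_Ioo]

theorem cc_cv (c : ℝ) (f : ℝ → ℝ≥0∞) :
    ∫⁻ τ in Ioo (0:ℝ) c, f (1 - τ/2) = 2 * ∫⁻ s in Ioo (1 - c/2) 1, f s := by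
  have himg : (fun τ : ℝ => 1 - τ/2) '' Ioo (0:ℝ) c = Ioo (1 - c/2) 1 := by
    ext x
    constructor
    · rintro ⟨τ, hτ, rfl⟩
      exact ⟨by linarith [hτ.2], by linarith [hτ.1]⟩
    · intro hx
      exact ⟨2*(1-x), ⟨by linarith [hx.2], by linarith [hx.1]⟩, by ring⟩
  have h := lintegral_image_eq_lintegral_abs_deriv_mul (s := Ioo (0:ℝ) c)
    (f := fun τ => 1 - τ/2) (f' := fun _ => -(1/2)) measurableSet_Ioo
    (fun x _ => (((hasDerivAt_id x).div_const 2).const_sub 1).hasDerivWithinAt)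
    (fun x _ y _ hxy => by simp only at hxy; linarith) f
  rw [himg] at h
  rw [h, lintegral_const_mul' _ _ ENNReal.ofReal_ne_top, ← mul_assoc]
  have : (2:ℝ≥0∞) * ENNReal.ofReal |-(1/2)| = 1 := by
    rw [show (2:ℝ≥0∞) = ENNReal.ofReal 2 by simp, ← ENNReal.ofReal_mul (by norm_num)]
    norm_num [abs_of_pos]
  rw [this, one_mul]

theorem cc_full {E : Type*} [NormedAddCommGroup E] [NormedSpace ℝ E] [CompleteSpace E]
    (i a : ℕ) (ha : a ≤ i) (ha1 : 1 ≤ a) (M : ℝ) (hM1 : 0 < M) (γ : ℝ) (hγ : 0 ≤ γ) :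
    ∃ C : ℝ, 0 ≤ C ∧
    ∀ (D : ℕ → ℝ → E), (∀ b, ∀ x ∈ Ioo (0:ℝ) 2, HasDerivAt (D b) (D (b+1) x) x) →
    (∀ x ∈ Ioc (0:ℝ) 1, ‖D 0 x‖ ≤ M) →
    ∫⁻ s in Ioo (0:ℝ) 1, ENNReal.ofReal (s^γ * ‖D a s‖^(2*(i:ℝ)/(a:ℝ))) ≤
      ENNReal.ofReal C * (1 + ∫⁻ s in Ioo (0:ℝ) 1, ENNReal.ofReal (s^γ * ‖D i s‖^2)) := by
  have hapos : (0:ℝ) < a := by exact_mod_cast ha1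
  rcases ha.lt_or_eq with hlt | rfl
  swap
  · refine ⟨1, zero_le_one, fun D _ _ => ?_⟩
    have : 2*(a:ℝ)/(a:ℝ) = ((2:ℕ):ℝ) := by field_simp; norm_num
    simp only [this, Real.rpow_natCast, ENNReal.ofReal_one, one_mul]
    exact le_add_self
  obtain ⟨k, rfl⟩ : ∃ k, i = k + 2 := ⟨i - 2, by omega⟩
  obtain ⟨C, hC, hmain⟩ := cc_half (E := E) k a hlt ha1 M hM1
  set p : ℝ := 2*((k+2:ℕ):ℝ)/(a:ℝ) with hp
  have hp0 : 0 ≤ p := by positivity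
  set K : ℝ := ((2:ℝ)^a)^p * C * (2 * 2^γ) with hK
  refine ⟨C + K, by positivity, fun D hD hM => ?_⟩
  set I := ∫⁻ s in Ioo (0:ℝ) 1, ENNReal.ofReal (s^γ * ‖D (k+2) s‖^2) with hI
  have h2γ : (1:ℝ) ≤ 2^γ := Real.one_le_rpow (by norm_num) hγ
  have first := hmain γ hγ D hD hM
  have second : ∫⁻ s in Ioo (5/8:ℝ) 1, ENNReal.ofReal (s^γ * ‖D a s‖^p) ≤
      ENNReal.ofReal K * (1 + I) := by
    set D' : ℕ → ℝ → E := fun b τ => (-(1/2):ℝ)^b • D b (1 - τ/2) with hD'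
    have hchain : ∀ b, ∀ x ∈ Ioo (0:ℝ) 2, HasDerivAt (D' b) (D' (b+1) x) x := by
      intro b x hx
      have h1 := hD b (1 - x/2) ⟨by linarith [hx.2], by linarith [hx.1]⟩
      have h2 : HasDerivAt (fun τ : ℝ => 1 - τ/2) (-(1/2)) x :=
        ((hasDerivAt_id x).div_const 2).const_sub 1
      have h3 := (h1.scomp x h2).const_smul ((-(1/2):ℝ)^b)
      simp only [hD']
      rw [pow_succ, mul_smul]
      exact h3
    have hbd : ∀ x ∈ Ioc (0:ℝ) 1, ‖D' 0 x‖ ≤ M := by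
      intro x hx
      simp only [hD', pow_zero, one_smul]
      exact hM _ ⟨by linarith [hx.2], by linarith [hx.1]⟩
    have hnorm : ∀ b τ, ‖D' b τ‖ = (1/2)^b * ‖D b (1-τ/2)‖ := by
      intro b τ
      simp only [hD', norm_smul, norm_pow, norm_neg]
      norm_num
    have hm := hmain 0 le_rfl D' hchain hbd
    simp only [Real.rpow_zero, one_mul] at hm
    have hr : ∫⁻ τ in Ioo (0:ℝ) 1, ENNReal.ofReal (‖D' (k+2) τ‖^2) ≤
        ENNReal.ofReal (2 * 2^γ) * I := by
      calc _ ≤ ∫⁻ τ in Ioo (0:ℝ) 1, (fun s : ℝ => ENNReal.ofReal (2^γ) *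
                ENNReal.ofReal (s^γ * ‖D (k+2) s‖^2)) (1 - τ/2) := by
            refine setLIntegral_mono' measurableSet_Ioo fun τ hτ => ?_
            simp only
            rw [← ENNReal.ofReal_mul (by positivity)]
            apply ENNReal.ofReal_le_ofReal
            rw [hnorm, ← mul_assoc, ← Real.mul_rpow (by norm_num) (by linarith [hτ.2])]
            have e1 : (1:ℝ) ≤ (2 * (1 - τ/2))^γ := Real.one_le_rpow (by linarith [hτ.2]) hγ
            have e2 : ((1/2:ℝ))^(k+2) ≤ 1 := pow_le_one₀ (by norm_num) (by norm_num)
            calc _ ≤ (1 * ‖D (k+2) (1-τ/2)‖)^2 := by gcongr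
              _ = 1 * ‖D (k+2) (1-τ/2)‖^2 := by ring
              _ ≤ _ := by gcongr
        _ = 2 * ∫⁻ s in Ioo (1 - 1/2 : ℝ) 1, ENNReal.ofReal (2^γ) *
                ENNReal.ofReal (s^γ * ‖D (k+2) s‖^2) :=
            cc_cv 1 (fun s : ℝ => ENNReal.ofReal (2^γ) * ENNReal.ofReal (s^γ * ‖D (k+2) s‖^2))
        _ ≤ 2 * ∫⁻ s in Ioo (0 : ℝ) 1, ENNReal.ofReal (2^γ) *
                ENNReal.ofReal (s^γ * ‖D (k+2) s‖^2) := by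
            gcongr; norm_num
        _ = _ := by
            rw [lintegral_const_mul' _ _ ENNReal.ofReal_ne_top, ← mul_assoc,
              ENNReal.ofReal_mul (by norm_num), hI]
            simp
    have hl : ∫⁻ s in Ioo (5/8:ℝ) 1, ENNReal.ofReal (s^γ * ‖D a s‖^p) ≤
        ENNReal.ofReal (((2:ℝ)^a)^p) * ∫⁻ τ in Ioo (0:ℝ) (3/4), ENNReal.ofReal (‖D' a τ‖^p) := by
      calc _ ≤ ∫⁻ s in Ioo (5/8:ℝ) 1, ENNReal.ofReal (‖D a s‖^p) := by
            refine setLIntegral_mono' measurableSet_Ioo fun s hs => ?_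
            apply ENNReal.ofReal_le_ofReal
            have := Real.rpow_le_one (by linarith [hs.1] : 0 ≤ s) hs.2.le hγ
            have h0 : 0 ≤ ‖D a s‖^p := by positivity
            exact mul_le_of_le_one_left h0 this
        _ ≤ 2 * ∫⁻ s in Ioo (5/8:ℝ) 1, ENNReal.ofReal (‖D a s‖^p) :=
            le_mul_of_one_le_left (zero_le) one_le_two
        _ = ∫⁻ τ in Ioo (0:ℝ) (3/4), ENNReal.ofReal (‖D a (1 - τ/2)‖^p) := by
            have := cc_cv (3/4) (fun s => ENNReal.ofReal (‖D a s‖^p))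
            rw [this]; norm_num
        _ = _ := by
            rw [← lintegral_const_mul' _ _ ENNReal.ofReal_ne_top]
            refine lintegral_congr fun τ => ?_
            rw [← ENNReal.ofReal_mul (by positivity), ← Real.mul_rpow (by positivity) (norm_nonneg _),
              hnorm, ← mul_assoc, ← mul_pow]
            norm_num
    calc _ ≤ _ := hl
      _ ≤ ENNReal.ofReal (((2:ℝ)^a)^p) * (ENNReal.ofReal C * (1 + ENNReal.ofReal (2*2^γ) * I)) := by
          gcongr
          refine hm.trans ?_
          gcongr
      _ ≤ ENNReal.ofReal (((2:ℝ)^a)^p) * (ENNReal.ofReal C *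
            (ENNReal.ofReal (2*2^γ) * 1 + ENNReal.ofReal (2*2^γ) * I)) := by
          gcongr
          rw [mul_one, ENNReal.one_le_ofReal]; linarith
      _ = _ := by
          rw [hK, ENNReal.ofReal_mul (p := ((2:ℝ)^a)^p * C) (by positivity),
            ENNReal.ofReal_mul (p := ((2:ℝ)^a)^p) (by positivity)]
          ring
  calc _ ≤ ∫⁻ s in Ioo (0:ℝ) (3/4) ∪ Ioo (5/8:ℝ) 1, ENNReal.ofReal (s^γ * ‖D a s‖^p) := by
        apply lintegral_mono_set
        intro x hx
        by_cases h : x < 3/4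
        · exact Or.inl ⟨hx.1, h⟩
        · exact Or.inr ⟨by linarith, hx.2⟩
    _ ≤ _ := lintegral_union_le _ _ _
    _ ≤ _ := add_le_add first second
    _ = _ := by rw [ENNReal.ofReal_add hC (by positivity), add_mul]

theorem cc_chain {E : Type*} [NormedAddCommGroup E] [NormedSpace ℝ E] (u : ℝ → E)
    (hu : ContDiffOn ℝ (⊤ : ℕ∞) u (Ioi 0)) (b : ℕ) (x : ℝ) (hx : 0 < x) :
    HasDerivAt (iteratedDeriv b u) (iteratedDeriv (b+1) u x) x := by
  have hd : DifferentiableOn ℝ (iteratedDerivWithin b u (Ioi 0)) (Ioi 0) := by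
    apply ContDiffOn.differentiableOn_iteratedDerivWithin hu
    · exact_mod_cast ENat.natCast_lt_top b
    · exact isOpen_Ioi.uniqueDiffOn
  have hd2 : DifferentiableOn ℝ (iteratedDeriv b u) (Ioi 0) :=
    hd.congr (fun y hy => (iteratedDerivWithin_of_isOpen isOpen_Ioi hy).symm)
  rw [iteratedDeriv_succ]
  exact (hd2.differentiableAt (isOpen_Ioi.mem_nhds hx)).hasDerivAt

theorem cc_norm_multi {N n : ℕ}
    (T : ContinuousMultilinearMap ℝ (fun _ : Fin n => EuclideanSpace ℝ (Fin N)) ℝ) (B : ℝ)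
    (hB : 0 ≤ B)
    (h : ∀ r : Fin n → Fin N, |T (fun k => EuclideanSpace.single (r k) 1)| ≤ B) :
    ‖T‖ ≤ (N:ℝ)^n * B := by
  apply ContinuousMultilinearMap.opNorm_le_bound (by positivity)
  intro v
  have hv : v = fun k => ∑ i, (v k i) • EuclideanSpace.single i (1:ℝ) := by
    funext k
    ext j
    simp [Pi.single_apply]
  have h1 : T v = ∑ r : Fin n → Fin N, (∏ k, v k (r k)) • T (fun k => EuclideanSpace.single (r k) 1) := by
    conv_lhs => rw [hv]
    rw [ContinuousMultilinearMap.map_sum]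
    refine Finset.sum_congr rfl fun r _ => ?_
    rw [ContinuousMultilinearMap.map_smul_univ]
  rw [h1]
  calc _ ≤ ∑ r : Fin n → Fin N, ‖(∏ k, v k (r k)) • T (fun k => EuclideanSpace.single (r k) 1)‖ :=
        norm_sum_le _ _
    _ ≤ ∑ r : Fin n → Fin N, (∏ k, ‖v k‖) * B := by
        refine Finset.sum_le_sum fun r _ => ?_
        rw [norm_smul, norm_prod]
        have := h r
        rw [← Real.norm_eq_abs] at this
        refine mul_le_mul ?_ this (norm_nonneg _) (by positivity)
        exact Finset.prod_le_prod (fun _ _ => norm_nonneg _)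
          (fun k _ => PiLp.norm_apply_le (v k) (r k))
    _ = _ := by
        simp
        ring

theorem cc_mp {N : ℕ} (Ω : Set (EuclideanSpace ℝ (Fin N))) (hΩ : IsOpen Ω) (n : ℕ) :
    ∀ (F : EuclideanSpace ℝ (Fin N) → ℝ), ContDiffOn ℝ n F Ω → ∀ r : Fin n → Fin N,
    ∃ l : List (Fin N), l.length = n ∧ ∀ x ∈ Ω,
      iteratedFDerivWithin ℝ n F Ω x (fun k => EuclideanSpace.single (r k) 1)
        = multiPDeriv Ω l F x := by
  induction n with
  | zero =>
    intro F hF r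
    exact ⟨[], rfl, fun x hx => by simp [multiPDeriv]⟩
  | succ n ih =>
    intro F hF r
    have hfd : ContDiffOn ℝ n (fderivWithin ℝ F Ω) Ω :=
      hF.fderivWithin hΩ.uniqueDiffOn (by norm_cast)
    let L := ContinuousLinearMap.apply ℝ ℝ (EuclideanSpace.single (r (Fin.last n)) (1:ℝ) : EuclideanSpace ℝ (Fin N))
    have hG : ContDiffOn ℝ n (fun x => fderivWithin ℝ F Ω x (EuclideanSpace.single (r (Fin.last n)) 1)) Ω :=
      L.contDiff.comp_contDiffOn hfd
    obtain ⟨l, hl, hlx⟩ := ih _ hG (fun k => r k.castSucc)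
    refine ⟨r (Fin.last n) :: l, by simp [hl], fun x hx => ?_⟩
    rw [iteratedFDerivWithin_succ_apply_right hΩ.uniqueDiffOn hx]
    show _ = multiPDeriv Ω l _ x
    rw [← hlx x hx]
    have := L.iteratedFDerivWithin_comp_left (hfd x hx) hΩ.uniqueDiffOn hx (i := n) le_rfl
    have h2 : (fun x => fderivWithin ℝ F Ω x (EuclideanSpace.single (r (Fin.last n)) 1)) = L ∘ fderivWithin ℝ F Ω := rfl
    rw [h2, this]
    rfl

theorem cc_bound {N : ℕ} (m : ℕ) (Ω K : Set (EuclideanSpace ℝ (Fin N))) (hΩ : IsOpen Ω)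
    (hKΩ : K ⊆ Ω) (F : EuclideanSpace ℝ (Fin N) → ℝ) (hF : ContDiffOn ℝ (m : ℕ∞) F Ω)
    (hC : CmNormOn m F Ω K ≠ ⊤) (j : ℕ) (hj : j ≤ m) (x) (hx : x ∈ K) :
    ‖iteratedFDerivWithin ℝ j F Ω x‖ ≤ ((N:ℝ)+1)^m * (CmNormOn m F Ω K).toReal := by
  have h1 : ‖iteratedFDerivWithin ℝ j F Ω x‖ ≤ (N:ℝ)^j * (CmNormOn m F Ω K).toReal := by
    apply cc_norm_multi _ _ ENNReal.toReal_nonneg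
    intro r
    obtain ⟨l, hl, hlx⟩ := cc_mp Ω hΩ j F (hF.of_le (by exact_mod_cast hj)) r
    rw [hlx x (hKΩ hx)]
    have : ENNReal.ofReal |multiPDeriv Ω l F x| ≤ CmNormOn m F Ω K := by
      unfold CmNormOn
      exact le_iSup_of_le l (le_iSup_of_le (by omega)
        (le_iSup (fun y : K => ENNReal.ofReal |multiPDeriv Ω l F (y : EuclideanSpace ℝ (Fin N))|) ⟨x, hx⟩))
    exact (ENNReal.ofReal_le_iff_le_toReal hC).1 this
  refine h1.trans ?_
  gcongr
  calc (N:ℝ)^j ≤ ((N:ℝ)+1)^j := by gcongr; linarith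
    _ ≤ _ := by gcongr; linarith [Nat.cast_nonneg (α := ℝ) N]

theorem cc_pt {N : ℕ} (n : ℕ) (hn : 1 ≤ n) (Ω K : Set (EuclideanSpace ℝ (Fin N))) (hΩ : IsOpen Ω)
    (hKΩ : K ⊆ Ω) (F : EuclideanSpace ℝ (Fin N) → ℝ) (hF : ContDiffOn ℝ n F Ω) (A : ℝ) (hA : 0 ≤ A)
    (hb : ∀ j ≤ n, ∀ x ∈ K, ‖iteratedFDerivWithin ℝ j F Ω x‖ ≤ A)
    (u : ℝ → EuclideanSpace ℝ (Fin N)) (hu : ContDiffOn ℝ (⊤ : ℕ∞) u (Ioi 0))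
    (huK : ∀ s ∈ Ioc (0:ℝ) 1, u s ∈ K) (s : ℝ) (hs : s ∈ Ioo (0:ℝ) 1) :
    ‖iteratedDeriv n (fun s => F (u s)) s‖^2 ≤
      ((n.factorial:ℝ)^2 * (n:ℝ)^(2*n-1)) * A^2 *
        ∑ a ∈ Finset.Icc 1 n, ‖iteratedDeriv a u s‖^(2*(n:ℝ)/(a:ℝ)) := by
  set D : ℝ := ∑ a ∈ Finset.Icc 1 n, ‖iteratedDeriv a u s‖^(1/(a:ℝ)) with hD
  have hD0 : 0 ≤ D := Finset.sum_nonneg fun a _ => by positivity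
  have hk : ∀ (a : ℕ), 1 ≤ a → ∀ y : ℝ, 0 ≤ y → (y^(1/(a:ℝ)))^a = y := by
    intro a ha y hy
    rw [← Real.rpow_natCast, ← Real.rpow_mul hy, one_div, inv_mul_cancel₀ (by positivity),
      Real.rpow_one]
  have hu' : ContDiffOn ℝ n u (Ioo (0:ℝ) 1) :=
    (hu.of_le (by exact_mod_cast le_top)).mono (fun y hy => hy.1)
  have hmaps : MapsTo u (Ioo (0:ℝ) 1) Ω := fun y hy => hKΩ (huK y ⟨hy.1, hy.2.le⟩)
  have h1 := norm_iteratedFDerivWithin_comp_le (n := n) (N := n) hF hu' (mod_cast le_rfl)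
    hΩ.uniqueDiffOn isOpen_Ioo.uniqueDiffOn hmaps hs (C := A) (D := D)
    (fun i hi => hb i hi _ (huK s ⟨hs.1, hs.2.le⟩))
    (by
      intro i hi1 hi
      rw [norm_iteratedFDerivWithin_eq_norm_iteratedDerivWithin,
        iteratedDerivWithin_of_isOpen isOpen_Ioo hs]
      rw [← hk i hi1 ‖iteratedDeriv i u s‖ (norm_nonneg _)]
      gcongr
      exact Finset.single_le_sum (f := fun a : ℕ => ‖iteratedDeriv a u s‖^(1/(a:ℝ)))
        (fun a _ => by positivity) (Finset.mem_Icc.2 ⟨hi1, hi⟩))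
  rw [norm_iteratedFDerivWithin_eq_norm_iteratedDerivWithin,
        iteratedDerivWithin_of_isOpen isOpen_Ioo hs] at h1
  have h2 : D^(2*n) ≤ (n:ℝ)^(2*n-1) *
      ∑ a ∈ Finset.Icc 1 n, ‖iteratedDeriv a u s‖^(2*(n:ℝ)/(a:ℝ)) := by
    obtain ⟨p, hp⟩ : ∃ p, 2*n = p+1 := ⟨2*n-1, by omega⟩
    have h3 := pow_sum_le_card_mul_sum_pow (s := Finset.Icc 1 n)
      (f := fun a : ℕ => ‖iteratedDeriv a u s‖^(1/(a:ℝ))) (fun a _ => by positivity) p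
    have h4 : 2*n-1 = p := by omega
    rw [h4, hp]
    refine h3.trans (le_of_eq ?_)
    congr 1
    · simp
    · refine Finset.sum_congr rfl fun a ha => ?_
      rw [← Real.rpow_natCast, ← Real.rpow_mul (norm_nonneg _), ← hp]
      congr 1
      push_cast
      ring
  calc ‖iteratedDeriv n (fun s => F (u s)) s‖^2 ≤ (n.factorial * A * D^n)^2 := by
        gcongr; exact h1
    _ = (n.factorial:ℝ)^2 * A^2 * D^(2*n) := by ring
    _ ≤ (n.factorial:ℝ)^2 * A^2 * ((n:ℝ)^(2*n-1) *
      ∑ a ∈ Finset.Icc 1 n, ‖iteratedDeriv a u s‖^(2*(n:ℝ)/(a:ℝ))) := by gcongr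
    _ = _ := by ring

theorem cc_wL2_sq {E : Type*} [NormedAddCommGroup E] (α : ℝ) (v : ℝ → E) :
    wL2 α v ^ 2 = ∫⁻ s in Ioo (0:ℝ) 1, ENNReal.ofReal (s ^ (2 * α) * ‖v s‖ ^ 2) := by
  unfold wL2
  rw [← ENNReal.rpow_natCast, ← ENNReal.rpow_mul]
  norm_num

theorem cc_term {N : ℕ} (n : ℕ) (α : ℝ) (M : ℝ) (hM : 0 < M) :
    ∃ C : ℝ, 0 ≤ C ∧ (0 ≤ α → ∀ (Ω K : Set (EuclideanSpace ℝ (Fin N))), IsOpen Ω → K ⊆ Ω →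
    (∀ x ∈ K, ‖x‖ ≤ M) →
    ∀ (F : EuclideanSpace ℝ (Fin N) → ℝ), ContDiffOn ℝ n F Ω → ∀ A : ℝ, 0 ≤ A →
    (∀ j ≤ n, ∀ x ∈ K, ‖iteratedFDerivWithin ℝ j F Ω x‖ ≤ A) →
    ∀ (u : ℝ → EuclideanSpace ℝ (Fin N)), ContDiffOn ℝ (⊤ : ℕ∞) u (Ioi 0) →
    (∀ s ∈ Ioc (0:ℝ) 1, u s ∈ K) →
    wL2 α (iteratedDeriv n (fun s => F (u s))) ^ 2 ≤
      ENNReal.ofReal C * ENNReal.ofReal (A^2) * (1 + wL2 α (iteratedDeriv n u) ^ 2)) := by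
  by_cases hα : 0 ≤ α
  swap
  · exact ⟨0, le_rfl, fun h => absurd h hα⟩
  rcases Nat.eq_zero_or_pos n with hn | hn
  · subst hn
    refine ⟨1, zero_le_one, ?_⟩
    intro _ Ω K hΩ hKΩ hKM F hF A hA hb u hu huK
    rw [cc_wL2_sq]
    calc _ ≤ ∫⁻ s in Ioo (0:ℝ) 1, ENNReal.ofReal (A^2) := by
          refine setLIntegral_mono measurable_const fun s hs => ?_
          apply ENNReal.ofReal_le_ofReal
          have h1 := hb 0 le_rfl (u s) (huK s ⟨hs.1, hs.2.le⟩)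
          rw [norm_iteratedFDerivWithin_zero] at h1
          have h2 : s^(2*α) ≤ 1 := Real.rpow_le_one hs.1.le hs.2.le (by positivity)
          simp only [iteratedDeriv_zero]
          calc s^(2*α) * ‖F (u s)‖^2 ≤ 1 * A^2 := by
                gcongr
            _ = A^2 := one_mul _
      _ = ENNReal.ofReal (A^2) := by simp
      _ ≤ _ := by
          rw [ENNReal.ofReal_one, one_mul]
          exact le_mul_of_one_le_right' le_self_add
  · have key : ∀ a : ℕ, ∃ C : ℝ, 0 ≤ C ∧ (a ∈ Finset.Icc 1 n →
        ∀ (D : ℕ → ℝ → EuclideanSpace ℝ (Fin N)),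
        (∀ b, ∀ x ∈ Ioo (0:ℝ) 2, HasDerivAt (D b) (D (b+1) x) x) →
        (∀ x ∈ Ioc (0:ℝ) 1, ‖D 0 x‖ ≤ M) →
        ∫⁻ s in Ioo (0:ℝ) 1, ENNReal.ofReal (s^(2*α) * ‖D a s‖^(2*(n:ℝ)/(a:ℝ))) ≤
        ENNReal.ofReal C *
          (1 + ∫⁻ s in Ioo (0:ℝ) 1, ENNReal.ofReal (s^(2*α) * ‖D n s‖^2))) := by
      intro a
      by_cases ha : a ∈ Finset.Icc 1 n
      · obtain ⟨C, hC, h⟩ := cc_full (E := EuclideanSpace ℝ (Fin N)) n a (Finset.mem_Icc.1 ha).2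
          (Finset.mem_Icc.1 ha).1 M hM (2*α) (by positivity)
        exact ⟨C, hC, fun _ => h⟩
      · exact ⟨0, le_rfl, fun h => absurd h ha⟩
    choose c hc0 hc using key
    set P : ℝ := (n.factorial:ℝ)^2 * (n:ℝ)^(2*n-1) with hP
    have hP0 : 0 ≤ P := by positivity
    refine ⟨P * ∑ a ∈ Finset.Icc 1 n, c a,
      mul_nonneg hP0 (Finset.sum_nonneg fun a _ => hc0 a), ?_⟩
    intro _ Ω K hΩ hKΩ hKM F hF A hA hb u hu huK
    rw [cc_wL2_sq, cc_wL2_sq]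
    set I := ∫⁻ s in Ioo (0:ℝ) 1, ENNReal.ofReal (s ^ (2 * α) * ‖iteratedDeriv n u s‖ ^ 2) with hI
    have hcont : ∀ a, ContinuousOn (iteratedDeriv a u) (Ioo (0:ℝ) 1) := fun a s hs =>
      (cc_chain u hu a s hs.1).continuousAt.continuousWithinAt
    have hmeas : ∀ a ∈ Finset.Icc 1 n, AEMeasurable (fun s : ℝ =>
        ENNReal.ofReal (s^(2*α) * ‖iteratedDeriv a u s‖^(2*(n:ℝ)/(a:ℝ))))
        (volume.restrict (Ioo (0:ℝ) 1)) := by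
      intro a _
      refine (ContinuousOn.aemeasurable ?_ measurableSet_Ioo).ennreal_ofReal
      refine ContinuousOn.mul ?_ ?_
      · exact continuousOn_id.rpow_const (fun s hs => Or.inl hs.1.ne')
      · exact (hcont a).norm.rpow_const (fun s hs => Or.inr (by positivity))
    calc _ ≤ ∫⁻ s in Ioo (0:ℝ) 1, ENNReal.ofReal (P * A^2) * ∑ a ∈ Finset.Icc 1 n,
            ENNReal.ofReal (s^(2*α) * ‖iteratedDeriv a u s‖^(2*(n:ℝ)/(a:ℝ))) := by
          refine lintegral_mono_ae ?_
          filter_upwards [ae_restrict_mem measurableSet_Ioo] with s hs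
          have hp := cc_pt n hn Ω K hΩ hKΩ F hF A hA hb u hu huK s hs
          have hs0 : 0 ≤ s^(2*α) := Real.rpow_nonneg hs.1.le _
          rw [← ENNReal.ofReal_sum_of_nonneg (fun a _ => by positivity),
            ← ENNReal.ofReal_mul (by positivity)]
          apply ENNReal.ofReal_le_ofReal
          calc _ ≤ s^(2*α) * _ := mul_le_mul_of_nonneg_left hp hs0
            _ = _ := by rw [← Finset.mul_sum]; ring
      _ = ENNReal.ofReal (P * A^2) * ∑ a ∈ Finset.Icc 1 n, ∫⁻ s in Ioo (0:ℝ) 1,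
            ENNReal.ofReal (s^(2*α) * ‖iteratedDeriv a u s‖^(2*(n:ℝ)/(a:ℝ))) := by
          rw [lintegral_const_mul' _ _ ENNReal.ofReal_ne_top, lintegral_finsetSum' _ hmeas]
      _ ≤ ENNReal.ofReal (P * A^2) * ∑ a ∈ Finset.Icc 1 n, ENNReal.ofReal (c a) * (1 + I) := by
          gcongr with a ha
          exact hc a ha (fun b => iteratedDeriv b u) (fun b x hx => cc_chain u hu b x hx.1)
            (fun x hx => by simpa using hKM _ (huK x hx))
      _ = _ := by
          rw [← Finset.sum_mul, ← ENNReal.ofReal_sum_of_nonneg (fun a _ => hc0 a),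
            ENNReal.ofReal_mul hP0, ENNReal.ofReal_mul hP0]
          ring

theorem cc_sumle {ι : Type*} (S : Finset ι) (f g : ι → ℝ≥0∞) (c : ι → ℝ) (hc : ∀ i, 0 ≤ c i)
    (B : ℝ≥0∞) (h : ∀ i ∈ S, f i ≤ ENNReal.ofReal (c i) * B * (1 + g i)) :
    ∑ i ∈ S, f i ≤ ENNReal.ofReal (∑ i ∈ S, c i) * B * (1 + ∑ i ∈ S, g i) := by
  calc _ ≤ ∑ i ∈ S, ENNReal.ofReal (c i) * B * (1 + ∑ i ∈ S, g i) := by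
        refine Finset.sum_le_sum fun i hi => (h i hi).trans ?_
        gcongr
        exact Finset.single_le_sum (f := g) (fun _ _ => zero_le) hi
    _ = _ := by
        rw [← Finset.sum_mul, ← Finset.sum_mul, ENNReal.ofReal_sum_of_nonneg (fun a _ => hc a)]

theorem cc_addle (x y X Y B : ℝ≥0∞) (c d : ℝ) (hc : 0 ≤ c) (hd : 0 ≤ d)
    (hx : x ≤ ENNReal.ofReal c * B * (1 + X)) (hy : y ≤ ENNReal.ofReal d * B * (1 + Y)) :
    x + y ≤ ENNReal.ofReal (c + d) * B * (1 + (X + Y)) := by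
  calc _ ≤ ENNReal.ofReal c * B * (1 + (X + Y)) + ENNReal.ofReal d * B * (1 + (X + Y)) := by
        refine add_le_add (hx.trans ?_) (hy.trans ?_)
        · gcongr; exact le_self_add
        · gcongr; exact le_add_self
    _ = _ := by rw [ENNReal.ofReal_add hc hd]; ring

theorem cc_Xsq {N : ℕ} (m : ℕ) (M : ℝ) (hM : 0 < M) :
    ∃ C : ℝ, 0 ≤ C ∧ (∀ (Ω K : Set (EuclideanSpace ℝ (Fin N))), IsOpen Ω → K ⊆ Ω →
    (∀ x ∈ K, ‖x‖ ≤ M) →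
    ∀ (F : EuclideanSpace ℝ (Fin N) → ℝ), ContDiffOn ℝ (m : ℕ∞) F Ω → ∀ A : ℝ, 0 ≤ A →
    (∀ j ≤ m, ∀ x ∈ K, ‖iteratedFDerivWithin ℝ j F Ω x‖ ≤ A) →
    ∀ (u : ℝ → EuclideanSpace ℝ (Fin N)), ContDiffOn ℝ (⊤ : ℕ∞) u (Ioi 0) →
    (∀ s ∈ Ioc (0:ℝ) 1, u s ∈ K) →
    XnormSq m (fun s => F (u s)) ≤
      ENNReal.ofReal C * ENNReal.ofReal (A^2) * (1 + XnormSq m u)) := by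
  have key := fun (n : ℕ) (α : ℝ) => cc_term (N := N) n α M hM
  choose c hc0 hc using key
  have hc' : ∀ n ≤ m, ∀ α : ℝ, 0 ≤ α → ∀ (Ω K : Set (EuclideanSpace ℝ (Fin N))), IsOpen Ω → K ⊆ Ω →
    (∀ x ∈ K, ‖x‖ ≤ M) →
    ∀ (F : EuclideanSpace ℝ (Fin N) → ℝ), ContDiffOn ℝ (m : ℕ∞) F Ω → ∀ A : ℝ, 0 ≤ A →
    (∀ j ≤ m, ∀ x ∈ K, ‖iteratedFDerivWithin ℝ j F Ω x‖ ≤ A) →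
    ∀ (u : ℝ → EuclideanSpace ℝ (Fin N)), ContDiffOn ℝ (⊤ : ℕ∞) u (Ioi 0) →
    (∀ s ∈ Ioc (0:ℝ) 1, u s ∈ K) →
    wL2 α (iteratedDeriv n (fun s => F (u s))) ^ 2 ≤
      ENNReal.ofReal (c n α) * ENNReal.ofReal (A^2) * (1 + wL2 α (iteratedDeriv n u) ^ 2) := by
    intro n hn α hα Ω K hΩ hKΩ hKM F hF A hA hb u hu huK
    exact hc n α hα Ω K hΩ hKΩ hKM F (hF.of_le (by exact_mod_cast hn)) A hA
      (fun j hj => hb j (hj.trans hn)) u hu huK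
  by_cases hm : m % 2 = 0
  · refine ⟨(∑ i ∈ Finset.range (m / 2 + 1), c i 0) +
      ∑ j ∈ Finset.range (m / 2), c (m / 2 + j + 1) ((j:ℝ)+1),
      add_nonneg (Finset.sum_nonneg fun _ _ => hc0 _ _) (Finset.sum_nonneg fun _ _ => hc0 _ _), ?_⟩
    intro Ω K hΩ hKΩ hKM F hF A hA hb u hu huK
    simp only [XnormSq, if_pos hm]
    refine cc_addle _ _ _ _ _ _ _ (Finset.sum_nonneg fun _ _ => hc0 _ _)
      (Finset.sum_nonneg fun _ _ => hc0 _ _) ?_ ?_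
    · refine cc_sumle _ _ _ _ (fun _ => hc0 _ _) _ fun i hi => ?_
      have := Finset.mem_range.1 hi
      exact hc' i (by omega) 0 le_rfl Ω K hΩ hKΩ hKM F hF A hA hb u hu huK
    · refine cc_sumle _ _ _ _ (fun _ => hc0 _ _) _ fun i hi => ?_
      have := Finset.mem_range.1 hi
      exact hc' _ (by omega) _ (by positivity) Ω K hΩ hKΩ hKM F hF A hA hb u hu huK
  · refine ⟨(∑ i ∈ Finset.range (m / 2 + 1), c i 0) +
      ∑ j ∈ Finset.range (m / 2 + 1), c (m / 2 + j + 1) ((j:ℝ)+1/2),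
      add_nonneg (Finset.sum_nonneg fun _ _ => hc0 _ _) (Finset.sum_nonneg fun _ _ => hc0 _ _), ?_⟩
    intro Ω K hΩ hKΩ hKM F hF A hA hb u hu huK
    simp only [XnormSq, if_neg hm]
    refine cc_addle _ _ _ _ _ _ _ (Finset.sum_nonneg fun _ _ => hc0 _ _)
      (Finset.sum_nonneg fun _ _ => hc0 _ _) ?_ ?_
    · refine cc_sumle _ _ _ _ (fun _ => hc0 _ _) _ fun i hi => ?_
      have := Finset.mem_range.1 hi
      exact hc' i (by omega) 0 le_rfl Ω K hΩ hKΩ hKM F hF A hA hb u hu huK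
    · refine cc_sumle _ _ _ _ (fun _ => hc0 _ _) _ fun i hi => ?_
      have := Finset.mem_range.1 hi
      exact hc' _ (by omega) _ (by positivity) Ω K hΩ hKΩ hKM F hF A hA hb u hu huK

end helpers

/-- composition estimate `‖F ∘ u‖_{X^m} ≤ C ‖F‖_{C^m(K)} (1 + ‖u‖_{X^m})`
with `C = C(m, N, K)`. -/
theorem stmt6 (m N : ℕ) (hN : 0 < N) (Ω K : Set (EuclideanSpace ℝ (Fin N)))
    (hΩ : IsOpen Ω) (hK : IsCompact K) (hKΩ : K ⊆ Ω) :
    ∃ C : ℝ, 0 < C ∧ ∀ F : EuclideanSpace ℝ (Fin N) → ℝ, ContDiffOn ℝ (m : ℕ∞) F Ω →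
      ∀ u : ℝ → EuclideanSpace ℝ (Fin N), ContDiffOn ℝ (⊤ : ℕ∞) u (Set.Ioi 0) →
        (∀ s ∈ Set.Ioc (0:ℝ) 1, u s ∈ K) → Xnorm m u ≠ ⊤ →
        Xnorm m (fun s => F (u s)) ≤
          ENNReal.ofReal C * (CmNormOn m F Ω K * (1 + Xnorm m u)) := by
  obtain ⟨M0, hM0⟩ := hK.isBounded.exists_norm_le
  obtain ⟨C, hC0, hC⟩ := cc_Xsq (N := N) m (max M0 1) (by positivity)
  refine ⟨Real.sqrt C * ((N:ℝ)+1)^m + 1, by positivity, ?_⟩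
  intro F hF u hu huK _
  by_cases htop : CmNormOn m F Ω K = ⊤
  · rw [htop, ENNReal.top_mul (by simp), ENNReal.mul_top]
    · exact le_top
    · rw [Ne, ENNReal.ofReal_eq_zero, not_le]
      positivity
  have h1 := hC Ω K hΩ hKΩ (fun x hx => (hM0 x hx).trans (le_max_left _ _)) F hF
    (((N:ℝ)+1)^m * (CmNormOn m F Ω K).toReal) (by positivity)
    (fun j hj x hx => cc_bound m Ω K hΩ hKΩ F hF htop j hj x hx) u hu huK
  set A : ℝ := ((N:ℝ)+1)^m * (CmNormOn m F Ω K).toReal with hA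
  have hA0 : 0 ≤ A := by positivity
  have hA2 : ENNReal.ofReal A = ENNReal.ofReal (((N:ℝ)+1)^m) * CmNormOn m F Ω K := by
    rw [hA, ENNReal.ofReal_mul (by positivity), ENNReal.ofReal_toReal htop]
  unfold Xnorm
  calc XnormSq m (fun s => F (u s)) ^ ((1:ℝ)/2)
      ≤ (ENNReal.ofReal C * ENNReal.ofReal (A^2) * (1 + XnormSq m u)) ^ ((1:ℝ)/2) :=
        ENNReal.rpow_le_rpow h1 (by norm_num)
    _ = ENNReal.ofReal (Real.sqrt C) * ENNReal.ofReal A * (1 + XnormSq m u) ^ ((1:ℝ)/2) := by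
        rw [ENNReal.mul_rpow_of_nonneg _ _ (by norm_num), ENNReal.mul_rpow_of_nonneg _ _ (by norm_num),
          ENNReal.ofReal_rpow_of_nonneg hC0 (by norm_num),
          ENNReal.ofReal_rpow_of_nonneg (by positivity) (by norm_num),
          ← Real.sqrt_eq_rpow, ← Real.sqrt_eq_rpow, Real.sqrt_sq hA0]
    _ ≤ ENNReal.ofReal (Real.sqrt C) * ENNReal.ofReal A * (1 + XnormSq m u ^ ((1:ℝ)/2)) := by
        gcongr
        have := ENNReal.rpow_add_le_add_rpow 1 (XnormSq m u) (p := (1:ℝ)/2) (by norm_num) (by norm_num)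
        simpa using this
    _ = ENNReal.ofReal (Real.sqrt C * ((N:ℝ)+1)^m) *
          (CmNormOn m F Ω K * (1 + XnormSq m u ^ ((1:ℝ)/2))) := by
        rw [hA2, ENNReal.ofReal_mul (Real.sqrt_nonneg _)]
        ring
    _ ≤ _ := by
        gcongr
        linarith
end
end

section
/- Let u be a sufficiently smooth function on (0,1] and define x(s) = -∫_s^1 u(σ) dσ. Then ‖x‖_{L²(0,1)} ≤ 2 ‖s u‖_{L²(0,1)}, where (s u)(s) = s·u(s). Moreover, for every nonnegative integer m there exists a constant C ≥ 1 (independent of u) such that C^{-1} ‖u‖_{Y^m} ≤ ‖x‖_{X^{m+1}} ≤ C ‖u‖_{Y^m}. -/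
open MeasureTheory ENNReal RealInnerProductSpace

noncomputable section

lemma wL2_sq (α : ℝ) (v : ℝ → ℝ) : wL2 α v ^ 2 =
    ∫⁻ s in Set.Ioo (0:ℝ) 1, ENNReal.ofReal (s ^ (2 * α) * ‖v s‖ ^ 2) := by
  unfold wL2
  rw [← ENNReal.rpow_natCast, ← ENNReal.rpow_mul]
  norm_num

lemma wL2_congr {α : ℝ} {v w : ℝ → ℝ} (h : Set.EqOn v w (Set.Ioi 0)) : wL2 α v = wL2 α w := by
  unfold wL2
  congr 1
  apply setLIntegral_congr_fun measurableSet_Ioo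
  intro s hs
  simp only [h hs.1]

lemma wL2_anti {α β : ℝ} (hab : α ≤ β) (v : ℝ → ℝ) : wL2 β v ≤ wL2 α v := by
  unfold wL2
  apply ENNReal.rpow_le_rpow _ (by norm_num)
  apply setLIntegral_mono' measurableSet_Ioo
  intro s hs
  apply ENNReal.ofReal_le_ofReal
  apply mul_le_mul_of_nonneg_right _ (by positivity)
  exact Real.rpow_le_rpow_of_exponent_ge hs.1 hs.2.le (by linarith)

lemma deriv_x {u x : ℝ → ℝ} (hu : ContinuousOn u (Set.Ioi 0))
    (hx : ∀ s : ℝ, x s = -∫ σ in s..(1:ℝ), u σ) {s : ℝ} (hs : 0 < s) : HasDerivAt x (u s) s := by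
  have hx' : x = fun s => ∫ σ in (1:ℝ)..s, u σ := by
    funext s
    rw [hx, intervalIntegral.integral_symm, neg_neg]
  rw [hx']
  apply intervalIntegral.integral_hasDerivAt_right
  · apply ContinuousOn.intervalIntegrable
    apply hu.mono
    intro t ht
    exact lt_of_lt_of_le (lt_min one_pos hs) ht.1
  · exact hu.stronglyMeasurableAtFilter isOpen_Ioi s hs
  · exact hu.continuousAt (Ioi_mem_nhds hs)

lemma iter_x {u x : ℝ → ℝ} (hu : ContinuousOn u (Set.Ioi 0))
    (hx : ∀ s : ℝ, x s = -∫ σ in s..(1:ℝ), u σ) (n : ℕ) :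
    Set.EqOn (iteratedDeriv (n + 1) x) (iteratedDeriv n u) (Set.Ioi 0) := by
  rw [iteratedDeriv_succ']
  apply Set.EqOn.iteratedDeriv_of_isOpen _ isOpen_Ioi
  intro s hs
  exact (deriv_x hu hx hs).deriv

lemma hardy_eps {u x : ℝ → ℝ} (hu : ContinuousOn u (Set.Ioi 0))
    (hx : ∀ s : ℝ, x s = -∫ σ in s..(1:ℝ), u σ) {ε : ℝ} (h0 : 0 < ε) (h1 : ε ≤ 1) :
    ∫ s in ε..1, x s ^ 2 ≤ ∫ s in ε..1, 4 * (s ^ 2 * u s ^ 2) := by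
  have hsub : Set.uIcc ε 1 ⊆ Set.Ioi 0 := by
    intro t ht
    rw [Set.uIcc_of_le h1] at ht
    exact lt_of_lt_of_le h0 ht.1
  have cu : ContinuousOn u (Set.uIcc ε 1) := hu.mono hsub
  have cx : ContinuousOn x (Set.uIcc ε 1) := fun t ht =>
    (deriv_x hu hx (hsub ht)).continuousAt.continuousWithinAt
  have hF : ∀ s ∈ Set.uIcc ε 1,
      HasDerivAt (fun s => s * x s ^ 2) (x s ^ 2 + 2 * s * x s * u s) s := by
    intro s hs
    have h := (hasDerivAt_id s).mul ((deriv_x hu hx (hsub hs)).pow 2)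
    refine HasDerivAt.congr_deriv (f := fun s => s * x s ^ 2) h ?_
    simp only [id, Pi.pow_apply, Nat.cast_ofNat]
    ring
  have hc : ContinuousOn (fun s => x s ^ 2 + 2 * s * x s * u s) (Set.uIcc ε 1) := by fun_prop
  have hFTC := intervalIntegral.integral_eq_sub_of_hasDerivAt hF hc.intervalIntegrable
  have hx1 : x 1 = 0 := by rw [hx]; simp
  have hneg : ∫ s in ε..1, (x s ^ 2 + 2 * s * x s * u s) ≤ 0 := by
    rw [hFTC, hx1]
    have : 0 ≤ ε * x ε ^ 2 := by positivity
    linarith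
  have i1 : IntervalIntegrable (fun s => x s ^ 2) volume ε 1 :=
    ContinuousOn.intervalIntegrable (by fun_prop)
  have i2 : IntervalIntegrable (fun s => 4 * (s ^ 2 * u s ^ 2)) volume ε 1 :=
    ContinuousOn.intervalIntegrable (by fun_prop)
  have hle : ∫ s in ε..1, (x s ^ 2 - 4 * (s ^ 2 * u s ^ 2))
      ≤ ∫ s in ε..1, 2 * (x s ^ 2 + 2 * s * x s * u s) := by
    apply intervalIntegral.integral_mono_on h1 (i1.sub i2) (hc.intervalIntegrable.const_mul 2)
    intro s _
    nlinarith [sq_nonneg (x s + 2 * s * u s)]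
  rw [intervalIntegral.integral_sub i1 i2,
    intervalIntegral.integral_const_mul (2:ℝ) (fun s => x s ^ 2 + 2 * s * x s * u s)] at hle
  linarith

lemma hardy {u x : ℝ → ℝ} (hu : ContinuousOn u (Set.Ioi 0))
    (hx : ∀ s : ℝ, x s = -∫ σ in s..(1:ℝ), u σ) : wL2 0 x ^ 2 ≤ 4 * wL2 1 u ^ 2 := by
  have hU : Set.Ioo (0:ℝ) 1 = ⋃ n : ℕ, Set.Ioo (1 / ((n:ℝ) + 1)) 1 := by
    ext t
    simp only [Set.mem_Ioo, Set.mem_iUnion]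
    constructor
    · rintro ⟨a, b⟩
      obtain ⟨n, hn⟩ := exists_nat_one_div_lt a
      exact ⟨n, hn, b⟩
    · rintro ⟨n, a, b⟩
      exact ⟨lt_trans (by positivity) a, b⟩
  rw [wL2_sq, wL2_sq, ← lintegral_const_mul' _ _ (by norm_num)]
  conv_lhs => rw [hU]
  rw [setLIntegral_iUnion_of_directed]
  · apply iSup_le
    intro n
    set ε : ℝ := 1 / ((n:ℝ) + 1) with hε
    have h0 : 0 < ε := by positivity
    have h1 : ε ≤ 1 := by
      rw [hε, div_le_one (by positivity)]
      have : (0:ℝ) ≤ n := by positivity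
      linarith
    refine le_trans ?_ (lintegral_mono_set (Set.Ioo_subset_Ioo_left h0.le))
    have hsub : Set.uIcc ε 1 ⊆ Set.Ioi 0 := by
      intro t ht
      rw [Set.uIcc_of_le h1] at ht
      exact lt_of_lt_of_le h0 ht.1
    have cu : ContinuousOn u (Set.uIcc ε 1) := hu.mono hsub
    have cx : ContinuousOn x (Set.uIcc ε 1) := fun t ht =>
      (deriv_x hu hx (hsub ht)).continuousAt.continuousWithinAt
    have i1 : IntervalIntegrable (fun s => x s ^ 2) volume ε 1 :=
      ContinuousOn.intervalIntegrable (by fun_prop)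
    have i2 : IntervalIntegrable (fun s => 4 * (s ^ 2 * u s ^ 2)) volume ε 1 :=
      ContinuousOn.intervalIntegrable (by fun_prop)
    have key := ENNReal.ofReal_le_ofReal (hardy_eps hu hx h0 h1)
    rw [intervalIntegral.integral_of_le h1, intervalIntegral.integral_of_le h1,
      ofReal_integral_eq_lintegral_ofReal i1.1 (ae_of_all _ fun s => by positivity),
      ofReal_integral_eq_lintegral_ofReal i2.1 (ae_of_all _ fun s => by positivity),
      ← restrict_Ioo_eq_restrict_Ioc] at key
    refine (le_of_eq ?_).trans (key.trans (le_of_eq ?_))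
    · apply setLIntegral_congr_fun measurableSet_Ioo
      intro s hs
      simp
    · apply setLIntegral_congr_fun measurableSet_Ioo
      intro s hs
      simp only [mul_one, Real.norm_eq_abs, sq_abs]
      rw [ENNReal.ofReal_mul (p := 4) (by norm_num), Real.rpow_two]
      norm_num
  · apply Monotone.directed_le
    intro a b hab
    apply Set.Ioo_subset_Ioo_left
    apply one_div_le_one_div_of_le (by positivity)
    have : (a:ℝ) ≤ b := by exact_mod_cast hab
    linarith

lemma Xsq_eq {u x : ℝ → ℝ} (hu : ContinuousOn u (Set.Ioi 0))
    (hx : ∀ s : ℝ, x s = -∫ σ in s..(1:ℝ), u σ) (m : ℕ) :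
    XnormSq (m + 1) x = wL2 0 x ^ 2 + YnormSq m u := by
  have key : ∀ α n, wL2 α (iteratedDeriv (n + 1) x) = wL2 α (iteratedDeriv n u) :=
    fun α n => wL2_congr (iter_x hu hx n)
  unfold XnormSq YnormSq
  rcases Nat.mod_two_eq_zero_or_one m with h | h
  · have e1 : (m + 1) % 2 = 1 := by omega
    have e2 : (m + 1) / 2 = m / 2 := by omega
    rw [e1, e2, h, if_neg (by norm_num), if_pos rfl, Finset.sum_range_succ']
    simp only [key, iteratedDeriv_zero]
    ring
  · have e1 : (m + 1) % 2 = 0 := by omega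
    have e2 : (m + 1) / 2 = m / 2 + 1 := by omega
    rw [e1, e2, h, if_pos rfl, if_neg (by norm_num), Finset.sum_range_succ' _ (m / 2 + 1)]
    simp only [key, iteratedDeriv_zero]
    have e3 : ∀ j, m / 2 + 1 + j = m / 2 + j + 1 := fun j => by omega
    simp only [e3]
    ring

lemma wL2_le_Y (m : ℕ) (u : ℝ → ℝ) : wL2 1 u ^ 2 ≤ YnormSq m u := by
  have h01 : wL2 1 u ^ 2 ≤ wL2 0 u ^ 2 := pow_le_pow_left' (wL2_anti (by norm_num) u) 2
  have hgen : ∀ k : ℕ, wL2 1 u ^ 2 ≤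
      ∑ i ∈ Finset.range (k + 1), wL2 0 (iteratedDeriv i u) ^ 2 := by
    intro k
    rw [Finset.sum_range_succ']
    simp only [iteratedDeriv_zero]
    exact h01.trans le_add_self
  unfold YnormSq
  split_ifs with h
  · rcases hk : m / 2 with _ | k
    · have : wL2 1 u ^ 2 ≤ wL2 (1 / 2) u ^ 2 :=
        pow_le_pow_left' (wL2_anti (by norm_num) u) 2
      simpa using this
    · exact (hgen k).trans le_self_add
  · exact (hgen _).trans le_self_add

/-- for `x(s) = -∫_s^1 u(σ) dσ` one has `‖x‖_{L²} ≤ 2 ‖s u‖_{L²}` and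
`‖x‖_{X^{m+1}} ≃ ‖u‖_{Y^m}`. -/
theorem stmt7 (m : ℕ) :
    ∃ C : ℝ, 1 ≤ C ∧ ∀ u x : ℝ → ℝ,
      ContDiffOn ℝ (⊤ : ℕ∞) u (Set.Ioi 0) →
      (∀ s : ℝ, x s = -∫ σ in s..(1:ℝ), u σ) →
      wL2 0 x ≤ 2 * wL2 1 u ∧
      (ENNReal.ofReal C)⁻¹ * Ynorm m u ≤ Xnorm (m + 1) x ∧
      Xnorm (m + 1) x ≤ ENNReal.ofReal C * Ynorm m u := by
  refine ⟨3, by norm_num, fun u x hu hx => ?_⟩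
  have hc := hu.continuousOn
  have hh := hardy hc hx
  have hX := Xsq_eq hc hx m
  have h3 : ENNReal.ofReal 3 = 3 := by norm_num
  refine ⟨?_, ?_, ?_⟩
  · have e : (4 : ℝ≥0∞) * wL2 1 u ^ 2 = (2 * wL2 1 u) ^ 2 := by ring
    rw [e] at hh
    exact (ENNReal.pow_le_pow_left_iff two_ne_zero).1 hh
  · have h : Ynorm m u ≤ Xnorm (m + 1) x := by
      unfold Ynorm Xnorm
      apply ENNReal.rpow_le_rpow _ (by norm_num)
      rw [hX]
      exact le_add_self
    refine le_trans ?_ h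
    rw [h3]
    exact mul_le_of_le_one_left' (by simp)
  · have h9 : ((9 : ℝ≥0∞)) ^ ((1:ℝ) / 2) = 3 := by
      have : (9 : ℝ≥0∞) = 3 ^ (2:ℝ) := by norm_num
      rw [this, ← ENNReal.rpow_mul]
      norm_num
    unfold Ynorm Xnorm
    rw [h3, ← h9, ← ENNReal.mul_rpow_of_nonneg _ _ (by norm_num)]
    apply ENNReal.rpow_le_rpow _ (by norm_num)
    rw [hX]
    calc wL2 0 x ^ 2 + YnormSq m u ≤ 4 * YnormSq m u + YnormSq m u := by
          gcongr
          exact hh.trans (by gcongr; exact wL2_le_Y m u)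
      _ = 5 * YnormSq m u := by ring
      _ ≤ 9 * YnormSq m u := by gcongr; norm_num
end
end

section
/- For every nonnegative integer m there exists a constant C = C(m) > 0 such that for all sufficiently smooth functions u, v on (0,1] the pointwise product uv satisfies: ‖uv‖_{Y^m} ≤ C ‖u‖_{Y^{m+1}} ‖v‖_{Y^{m+1}} when m ∈ {0,1}, and ‖uv‖_{Y^m} ≤ C ‖u‖_{Y^{max(m,3)}} ‖v‖_{Y^m} for every nonnegative integer m. -/
open MeasureTheory ENNReal RealInnerProductSpace

noncomputable section

namespace YProd

/-- Squared weighted norm. -/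
def q (α : ℝ) (v : ℝ → ℝ) : ℝ≥0∞ :=
  ∫⁻ s in Set.Ioo (0:ℝ) 1, ENNReal.ofReal (s ^ (2 * α) * ‖v s‖ ^ 2)

lemma half_sq (x : ℝ≥0∞) : (x ^ ((1:ℝ) / 2)) ^ 2 = x := by
  rw [← ENNReal.rpow_natCast, ← ENNReal.rpow_mul]; norm_num

lemma wL2_sq (α : ℝ) (v : ℝ → ℝ) : wL2 α v ^ 2 = q α v := by
  unfold wL2 q
  exact half_sq _

/-- The weight exponent. -/
def w (m i : ℕ) : ℝ := if 2 * i + 1 ≤ m then 0 else (i : ℝ) - ((m : ℝ) - 1) / 2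

/-- The pointwise exponent. -/
def pE (m i : ℕ) : ℝ :=
  if 2 * i + 3 ≤ m then 0 else if 2 * i + 2 = m then 1 / 8 else (i : ℝ) + 1 - (m : ℝ) / 2

lemma YnormSq_eq (m : ℕ) (u : ℝ → ℝ) :
    YnormSq m u = ∑ i ∈ Finset.range (m + 1), q (w m i) (iteratedDeriv i u) := by
  unfold YnormSq
  simp only [wL2_sq]
  split_ifs with h
  · obtain ⟨k, rfl⟩ : ∃ k, m = 2 * k := ⟨m / 2, by omega⟩
    have e : 2 * k / 2 = k := by omega
    rw [e, show 2 * k + 1 = k + (k + 1) by ring,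
      Finset.sum_range_add (fun i => q (w (2 * k) i) (iteratedDeriv i u)) k (k + 1)]
    congr 1
    · refine Finset.sum_congr rfl fun i hi => ?_
      rw [Finset.mem_range] at hi
      rw [w, if_pos (by omega)]
    · refine Finset.sum_congr rfl fun i hi => ?_
      rw [w, if_neg (by omega)]
      congr 1
      push_cast; ring
  · obtain ⟨k, rfl⟩ : ∃ k, m = 2 * k + 1 := ⟨m / 2, by omega⟩
    have e : (2 * k + 1) / 2 = k := by omega
    rw [e, show 2 * k + 1 + 1 = (k + 1) + (k + 1) by ring,
      Finset.sum_range_add (fun i => q (w (2 * k + 1) i) (iteratedDeriv i u)) (k + 1) (k + 1)]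
    congr 1
    · refine Finset.sum_congr rfl fun i hi => ?_
      rw [Finset.mem_range] at hi
      rw [w, if_pos (by omega)]
    · refine Finset.sum_congr rfl fun i hi => ?_
      rw [w, if_neg (by omega), show k + 1 + i = k + i + 1 by ring]
      congr 1
      push_cast; ring

lemma q_le_Y {m i : ℕ} (h : i ≤ m) (u : ℝ → ℝ) :
    q (w m i) (iteratedDeriv i u) ≤ YnormSq m u := by
  rw [YnormSq_eq]
  exact Finset.single_le_sum (f := fun i => q (w m i) (iteratedDeriv i u))
    (fun _ _ => zero_le) (Finset.mem_range.2 (by omega))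

lemma smooth_iter {u : ℝ → ℝ} (hu : ContDiffOn ℝ (⊤ : ℕ∞) u (Set.Ioi 0)) (i : ℕ) :
    ContDiffOn ℝ (⊤ : ℕ∞) (iteratedDeriv i u) (Set.Ioi 0) := by
  induction i with
  | zero => simpa using hu
  | succ n ih =>
    rw [iteratedDeriv_succ]
    exact ih.deriv_of_isOpen isOpen_Ioi (by exact le_rfl)

lemma hasDeriv_iter {u : ℝ → ℝ} (hu : ContDiffOn ℝ (⊤ : ℕ∞) u (Set.Ioi 0)) (i : ℕ) (s : ℝ)
    (hs : 0 < s) : HasDerivAt (iteratedDeriv i u) (iteratedDeriv (i + 1) u s) s := by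
  rw [iteratedDeriv_succ]
  have h1 : ContDiffAt ℝ (⊤ : ℕ∞) (iteratedDeriv i u) s :=
    (smooth_iter hu i).contDiffAt (isOpen_Ioi.mem_nhds hs)
  exact (h1.differentiableAt (by simp)).hasDerivAt

lemma cont_iter {u : ℝ → ℝ} (hu : ContDiffOn ℝ (⊤ : ℕ∞) u (Set.Ioi 0)) (i : ℕ) :
    ContinuousOn (iteratedDeriv i u) (Set.Ioi 0) := (smooth_iter hu i).continuousOn

lemma contw {f : ℝ → ℝ} (hf : ContinuousOn f (Set.Ioi 0)) (α : ℝ) :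
    ContinuousOn (fun s => s ^ (2 * α) * ‖f s‖ ^ 2) (Set.Ioi 0) := by
  refine ContinuousOn.mul ?_ (hf.norm.pow 2)
  exact continuousOn_id.rpow_const fun x hx => Or.inl (ne_of_gt hx)

lemma aem {f : ℝ → ℝ} (hf : ContinuousOn f (Set.Ioi 0)) (α : ℝ) :
    AEMeasurable (fun s => ENNReal.ofReal (s ^ (2 * α) * ‖f s‖ ^ 2))
      (volume.restrict (Set.Ioo (0:ℝ) 1)) :=
  (((contw hf α).mono Set.Ioo_subset_Ioi_self).aemeasurable measurableSet_Ioo).ennreal_ofReal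

lemma q_mono {a b : ℝ} (h : a ≤ b) (f : ℝ → ℝ) : q b f ≤ q a f := by
  refine setLIntegral_mono' measurableSet_Ioo fun s hs => ENNReal.ofReal_le_ofReal ?_
  refine mul_le_mul_of_nonneg_right ?_ (by positivity)
  exact Real.rpow_le_rpow_of_exponent_ge hs.1 hs.2.le (by linarith)

lemma q_mul_le {α β γ : ℝ} (h : β + γ ≤ α) {f g : ℝ → ℝ} (hg : ContinuousOn g (Set.Ioi 0))
    {K : ℝ≥0∞} (hK : ∀ s ∈ Set.Ioo (0:ℝ) 1, ENNReal.ofReal (s ^ (2 * β) * ‖f s‖ ^ 2) ≤ K) :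
    q α (fun s => f s * g s) ≤ K * q γ g := by
  unfold q
  rw [← lintegral_const_mul'' _ (aem hg γ)]
  refine setLIntegral_mono' measurableSet_Ioo fun s hs => ?_
  refine le_trans ?_ (mul_le_mul_left (hK s hs) _)
  have h0 := hs.1
  rw [← ENNReal.ofReal_mul (by positivity)]
  apply ENNReal.ofReal_le_ofReal
  rw [norm_mul]
  have : s ^ (2 * α) ≤ s ^ (2 * β) * s ^ (2 * γ) := by
    rw [← Real.rpow_add hs.1]
    exact Real.rpow_le_rpow_of_exponent_ge hs.1 hs.2.le (by linarith)
  calc s ^ (2 * α) * (‖f s‖ * ‖g s‖) ^ 2 ≤ (s ^ (2 * β) * s ^ (2 * γ)) * (‖f s‖ * ‖g s‖) ^ 2 := by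
        gcongr
    _ = _ := by ring

lemma q_sum_le (α : ℝ) (n : ℕ) {F : ℕ → ℝ → ℝ} {G : ℝ → ℝ}
    (hF : ∀ i, ContinuousOn (F i) (Set.Ioi 0))
    (hG : ∀ s ∈ Set.Ioo (0:ℝ) 1, G s = ∑ i ∈ Finset.range n, F i s) :
    q α G ≤ n * ∑ i ∈ Finset.range n, q α (F i) := by
  unfold q
  rw [← lintegral_finsetSum' _ (fun i _ => aem (hF i) α), ← lintegral_const_mul' _ _ (by simp)]
  refine setLIntegral_mono' measurableSet_Ioo fun s hs => ?_
  have h0 := hs.1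
  rw [← ENNReal.ofReal_sum_of_nonneg (fun i _ => by positivity), ← ENNReal.ofReal_natCast,
    ← ENNReal.ofReal_mul (by positivity)]
  apply ENNReal.ofReal_le_ofReal
  rw [hG s hs, ← Finset.mul_sum, mul_left_comm]
  gcongr
  have := sq_sum_le_card_mul_sum_sq (s := Finset.range n) (f := fun i => F i s)
  simpa using this

lemma q_const_mul (α c : ℝ) (f : ℝ → ℝ) :
    q α (fun s => c * f s) = ENNReal.ofReal (c ^ 2) * q α f := by
  unfold q
  rw [← lintegral_const_mul' _ _ (by simp)]
  congr 1; ext s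
  rw [← ENNReal.ofReal_mul (by positivity)]
  congr 1
  simp only [norm_mul, Real.norm_eq_abs, mul_pow, sq_abs]; ring

/-- Cauchy-Schwarz for lower integrals. -/
lemma cs {μ : Measure ℝ} {f g : ℝ → ℝ≥0∞} (hf : AEMeasurable f μ) (hg : AEMeasurable g μ) :
    (∫⁻ x, f x * g x ∂μ) ^ 2 ≤ (∫⁻ x, f x ^ 2 ∂μ) * ∫⁻ x, g x ^ 2 ∂μ := by
  have h := ENNReal.lintegral_mul_le_Lp_mul_Lq μ Real.HolderConjugate.two_two hf hg
  have h2 := pow_le_pow_left' h 2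
  rw [mul_pow, half_sq, half_sq] at h2
  simpa using h2

lemma incr {f f' : ℝ → ℝ} (hd : ∀ s, 0 < s → HasDerivAt f (f' s) s)
    (hc : ContinuousOn f' (Set.Ioi 0)) (b : ℝ) {s t : ℝ} (hs : s ∈ Set.Ioo (0:ℝ) 1)
    (ht : t ∈ Set.Ioo (1/2:ℝ) 1) :
    ENNReal.ofReal (‖f t - f s‖ ^ 2) ≤
      (∫⁻ x in Set.Ioo (s / 2) 1, ENNReal.ofReal (x ^ (-(2 * b)))) * q b f' := by
  obtain ⟨hs0, hs1⟩ := hs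
  obtain ⟨ht0, ht1⟩ := ht
  have hsub : Set.uIoc s t ⊆ Set.Ioo (s / 2) 1 := by
    intro x hx
    rcases Set.mem_uIoc.1 hx with h | h
    · exact ⟨by linarith [h.1], by linarith [h.2]⟩
    · exact ⟨by linarith [h.1], by linarith [h.2]⟩
  have hsub2 : Set.uIcc s t ⊆ Set.Ioi 0 := by
    intro x hx
    rcases Set.mem_uIcc.1 hx with h | h
    · exact lt_of_lt_of_le hs0 h.1
    · exact lt_of_lt_of_le (by linarith) h.1
  have hii : IntervalIntegrable f' volume s t := (hc.mono hsub2).intervalIntegrable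
  have e := intervalIntegral.integral_eq_sub_of_hasDerivAt
    (fun x hx => hd x (hsub2 hx)) hii
  have hm1 : AEMeasurable (fun x : ℝ => ENNReal.ofReal (x ^ (-b)))
      (volume.restrict (Set.Ioo (s/2) 1)) := by
    refine (ContinuousOn.aemeasurable ?_ measurableSet_Ioo).ennreal_ofReal
    exact continuousOn_id.rpow_const fun x hx => Or.inl (ne_of_gt (lt_trans (by linarith) hx.1))
  have hsub3 : Set.Ioo (s/2) 1 ⊆ Set.Ioi 0 := fun x hx => lt_trans (by linarith) hx.1
  have hm2 : AEMeasurable (fun x : ℝ => ENNReal.ofReal (x ^ b * ‖f' x‖))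
      (volume.restrict (Set.Ioo (s/2) 1)) := by
    refine (ContinuousOn.aemeasurable ?_ measurableSet_Ioo).ennreal_ofReal
    refine ContinuousOn.mul ?_ (hc.mono hsub3).norm
    exact continuousOn_id.rpow_const fun x hx => Or.inl (ne_of_gt (hsub3 hx))
  have h1 : ENNReal.ofReal ‖f t - f s‖ ≤
      ∫⁻ x in Set.Ioo (s/2) 1, ENNReal.ofReal (x ^ (-b)) * ENNReal.ofReal (x ^ b * ‖f' x‖) := by
    rw [← e, intervalIntegral.norm_intervalIntegral_eq, ofReal_norm]
    refine (enorm_integral_le_lintegral_enorm _).trans ?_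
    refine (lintegral_mono_set hsub).trans ?_
    refine setLIntegral_mono' measurableSet_Ioo fun x hx => ?_
    have hx0 : 0 < x := hsub3 hx
    rw [← ENNReal.ofReal_mul (by positivity), ← mul_assoc, ← Real.rpow_add hx0, neg_add_cancel,
      Real.rpow_zero, one_mul, ofReal_norm]
  rw [ENNReal.ofReal_pow (norm_nonneg _)]
  refine (pow_le_pow_left' h1 2).trans ((cs hm1 hm2).trans ?_)
  refine mul_le_mul' ?_ ?_
  · refine (setLIntegral_mono' measurableSet_Ioo fun x hx => ?_)
    have hx0 : 0 < x := hsub3 hx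
    rw [← ENNReal.ofReal_pow (by positivity), ← Real.rpow_natCast, ← Real.rpow_mul hx0.le]
    apply le_of_eq; congr 2; push_cast; ring
  · unfold q
    refine le_trans (setLIntegral_mono' measurableSet_Ioo fun x hx => ?_)
      (lintegral_mono_set (Set.Ioo_subset_Ioo_left (by linarith)))
    have hx0 : 0 < x := hsub3 hx
    rw [← ENNReal.ofReal_pow (by positivity), mul_pow, ← Real.rpow_natCast, ← Real.rpow_mul hx0.le]
    apply le_of_eq; congr 3; push_cast; ring

lemma wint {b p : ℝ} (h : (b = 0 ∧ p = 0) ∨ (1 / 2 < b ∧ p = b - 1 / 2)) :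
    ∃ C : NNReal, ∀ s ∈ Set.Ioo (0:ℝ) 1,
      ENNReal.ofReal (s ^ (2 * p)) *
        (∫⁻ x in Set.Ioo (s / 2) 1, ENNReal.ofReal (x ^ (-(2 * b)))) ≤ C := by
  rcases h with ⟨rfl, rfl⟩ | ⟨hb, rfl⟩
  · refine ⟨1, fun s hs => ?_⟩
    simp
    linarith [hs.1]
  · refine ⟨((1/2:ℝ) ^ (1 - 2 * b) / (2 * b - 1)).toNNReal, fun s hs => ?_⟩
    have hs0 := hs.1
    have hs1 := hs.2
    have h0 : (0:ℝ) ∉ Set.uIcc (s/2) 1 := by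
      rw [Set.uIcc_of_le (by linarith)]
      intro h; linarith [h.1]
    have hI := integral_rpow (a := s/2) (b := 1) (r := -(2*b)) (Or.inr ⟨by linarith, h0⟩)
    have hintg : IntervalIntegrable (fun x : ℝ => x ^ (-(2*b))) volume (s/2) 1 :=
      intervalIntegral.intervalIntegrable_rpow (Or.inr h0)
    rw [intervalIntegrable_iff_integrableOn_Ioo_of_le (by linarith)] at hintg
    rw [intervalIntegral.integral_of_le (by linarith), integral_Ioc_eq_integral_Ioo] at hI
    rw [← ofReal_integral_eq_lintegral_ofReal hintg, hI, ← ENNReal.ofReal_mul (by positivity)]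
    · apply ENNReal.ofReal_le_ofReal
      have e1 : (s/2) ^ (-(2*b)+1) = s ^ (1 - 2*b) * (1/2:ℝ) ^ (1 - 2*b) := by
        rw [← Real.mul_rpow hs0.le (by norm_num)]; congr 1 <;> ring
      have e2 : s ^ (2 * (b - 1/2)) * s ^ (1 - 2*b) = 1 := by
        rw [← Real.rpow_add hs0]; ring_nf; exact Real.rpow_zero s
      rw [e1, Real.one_rpow]
      have hp : 0 < 2*b - 1 := by linarith
      rw [show -(2*b)+1 = -(2*b-1) by ring, div_neg, ← neg_div, ← mul_div_assoc]
      gcongr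
      have : 0 < s ^ (2 * (b - 1/2)) := by positivity
      calc _ = (s ^ (2 * (b - 1/2)) * s ^ (1 - 2*b)) * (1/2:ℝ) ^ (1 - 2*b)
            - s ^ (2 * (b - 1/2)) := by ring
        _ ≤ _ := by rw [e2]; linarith
    · refine (ae_restrict_iff' measurableSet_Ioo).2 (Filter.Eventually.of_forall fun x hx => ?_)
      exact Real.rpow_nonneg (by linarith [hx.1]) _

lemma pw {a b p : ℝ} (ha : 0 ≤ a) (h : (b = 0 ∧ p = 0) ∨ (1 / 2 < b ∧ p = b - 1 / 2)) :
    ∃ C : NNReal, ∀ f f' : ℝ → ℝ, (∀ s, 0 < s → HasDerivAt f (f' s) s) →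
      ContinuousOn f' (Set.Ioi 0) → ∀ s ∈ Set.Ioo (0:ℝ) 1,
      ENNReal.ofReal (s ^ (2 * p) * ‖f s‖ ^ 2) ≤ C * (q a f + q b f') := by
  obtain ⟨C, hC⟩ := wint h
  have hp : 0 ≤ p := by rcases h with h | h <;> linarith
  refine ⟨4 * ((2:ℝ) ^ (2*a)).toNNReal + 2 * C, fun f f' hd hc s hs => ?_⟩
  have hs0 := hs.1
  have hsp : s ^ (2*p) ≤ 1 := Real.rpow_le_one hs0.le hs.2.le (by linarith)
  have hfc : ContinuousOn f (Set.Ioi 0) := fun x hx => (hd x hx).continuousAt.continuousWithinAt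
  have key : ∀ t ∈ Set.Ioo (1/2:ℝ) 1, ENNReal.ofReal (s ^ (2 * p) * ‖f s‖ ^ 2) ≤
      (2 * ENNReal.ofReal ((2:ℝ) ^ (2*a))) * ENNReal.ofReal (t ^ (2*a) * ‖f t‖ ^ 2)
        + 2 * (C * q b f') := by
    intro t ht
    have ht0 : 0 < t := by linarith [ht.1]
    have h1 : s ^ (2 * p) * ‖f s‖ ^ 2 ≤
        2 * ‖f t‖ ^ 2 + 2 * (s ^ (2*p) * ‖f t - f s‖ ^ 2) := by
      have h3 : ‖f s‖ ^ 2 ≤ 2 * ‖f t‖ ^ 2 + 2 * ‖f t - f s‖ ^ 2 := by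
        simp only [Real.norm_eq_abs, sq_abs]
        nlinarith [sq_nonneg (2 * f t - f s)]
      have h4 : 0 ≤ s ^ (2*p) := by positivity
      have h5 : s ^ (2*p) * ‖f t‖ ^ 2 ≤ ‖f t‖ ^ 2 :=
        mul_le_of_le_one_left (by positivity) hsp
      nlinarith [mul_le_mul_of_nonneg_left h3 h4]
    have h2 : ‖f t‖ ^ 2 ≤ (2:ℝ) ^ (2*a) * (t ^ (2*a) * ‖f t‖ ^ 2) := by
      rw [← mul_assoc, ← Real.mul_rpow (by norm_num) ht0.le]
      refine le_mul_of_one_le_left (by positivity) ?_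
      exact Real.one_le_rpow (by linarith [ht.1]) (by linarith)
    refine (ENNReal.ofReal_le_ofReal h1).trans ?_
    rw [ENNReal.ofReal_add (by positivity) (by positivity), ENNReal.ofReal_mul (by norm_num),
      ENNReal.ofReal_mul (by norm_num), ENNReal.ofReal_ofNat]
    gcongr ?_ + 2 * ?_
    · rw [mul_assoc, ← ENNReal.ofReal_mul (by positivity)]
      gcongr
    · rw [ENNReal.ofReal_mul (by positivity)]
      calc _ ≤ _ := mul_le_mul_right (incr hd hc b hs ht) _
        _ ≤ _ := by rw [← mul_assoc]; exact mul_le_mul_left (hC s hs) _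
  have hintg := setLIntegral_mono' (μ := volume) (measurableSet_Ioo (a := (1/2:ℝ)) (b := 1)) key
  have hm : AEMeasurable (fun s => ENNReal.ofReal (s ^ (2 * a) * ‖f s‖ ^ 2))
      (volume.restrict (Set.Ioo (1/2:ℝ) 1)) :=
    (aem hfc a).mono_measure (Measure.restrict_mono (Set.Ioo_subset_Ioo_left (by norm_num)) le_rfl)
  rw [lintegral_add_right _ measurable_const, lintegral_const_mul'' _ hm, setLIntegral_const,
    setLIntegral_const, Real.volume_Ioo] at hintg
  have hq : ∫⁻ t in Set.Ioo (1/2:ℝ) 1, ENNReal.ofReal (t ^ (2*a) * ‖f t‖ ^ 2) ≤ q a f :=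
    lintegral_mono_set (Set.Ioo_subset_Ioo_left (by norm_num))
  set L := ENNReal.ofReal (s ^ (2 * p) * ‖f s‖ ^ 2) with hL
  have h12 : 2 * ENNReal.ofReal (1 - 1/2) = 1 := by
    rw [← ENNReal.ofReal_ofNat, ← ENNReal.ofReal_mul (by norm_num)]; norm_num
  calc L = 2 * (L * ENNReal.ofReal (1 - 1/2)) := by
        rw [mul_left_comm, h12, mul_one]
    _ ≤ 2 * ((2 * ENNReal.ofReal ((2:ℝ) ^ (2*a))) * q a f
        + 2 * (C * q b f') * ENNReal.ofReal (1 - 1/2)) := by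
        refine mul_le_mul_right (hintg.trans ?_) _
        gcongr
    _ = (4 * ENNReal.ofReal ((2:ℝ) ^ (2*a))) * q a f + (2 * C) * q b f' := by
        calc _ = (4 * ENNReal.ofReal ((2:ℝ) ^ (2*a))) * q a f
                + (2 * C) * q b f' * (2 * ENNReal.ofReal (1 - 1/2)) := by ring
          _ = _ := by rw [h12, mul_one]
    _ ≤ _ := by
        push_cast
        rw [mul_add]
        gcongr
        · exact le_self_add
        · exact le_add_self

lemma w_nonneg (m i : ℕ) : 0 ≤ w m i := by
  unfold w
  split_ifs with h
  · exact le_rfl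
  · have : (m : ℝ) ≤ 2 * i := by exact_mod_cast (by omega : m ≤ 2 * i)
    linarith

lemma pY {m i : ℕ} (hi : i + 1 ≤ m) :
    ∃ C : NNReal, ∀ u : ℝ → ℝ, ContDiffOn ℝ (⊤ : ℕ∞) u (Set.Ioi 0) → ∀ s ∈ Set.Ioo (0:ℝ) 1,
      ENNReal.ofReal (s ^ (2 * pE m i) * ‖iteratedDeriv i u s‖ ^ 2) ≤ C * YnormSq m u := by
  obtain ⟨b, hb, hw⟩ : ∃ b, ((b = 0 ∧ pE m i = 0) ∨ (1 / 2 < b ∧ pE m i = b - 1 / 2)) ∧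
      w m (i + 1) ≤ b := by
    unfold pE w
    split_ifs with h1 h2 h3 h4 h5 h6
    · exact ⟨0, Or.inl ⟨rfl, rfl⟩, le_rfl⟩
    · omega
    · omega
    · refine ⟨5/8, Or.inr ⟨by norm_num, by norm_num⟩, ?_⟩
      rw [← h3]; push_cast; linarith
    · omega
    · have : (m : ℝ) ≤ 2 * i + 1 := by exact_mod_cast (by omega : m ≤ 2 * i + 1)
      refine ⟨_, Or.inr ⟨?_, ?_⟩, le_rfl⟩ <;> push_cast <;> linarith
  obtain ⟨C, hC⟩ := pw (w_nonneg m i) hb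
  refine ⟨C * 2, fun u hu s hs => ?_⟩
  refine (hC _ _ (hasDeriv_iter hu i) (cont_iter hu (i + 1)) s hs).trans ?_
  push_cast
  rw [mul_assoc, two_mul]
  gcongr
  · exact q_le_Y (by omega) u
  · exact (q_mono hw _).trans (q_le_Y (by omega) u)

/-- A single Leibniz term is controlled. -/
def T (m1 m2 i j : ℕ) (α : ℝ) : Prop :=
  ∃ C : NNReal, ∀ u v : ℝ → ℝ, ContDiffOn ℝ (⊤ : ℕ∞) u (Set.Ioi 0) →
    ContDiffOn ℝ (⊤ : ℕ∞) v (Set.Ioi 0) →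
    q α (fun s => iteratedDeriv i u s * iteratedDeriv j v s) ≤ C * (YnormSq m1 u * YnormSq m2 v)

lemma T_left {m1 m2 i j : ℕ} {α : ℝ} (hi : i + 1 ≤ m1) (hj : j ≤ m2)
    (h : pE m1 i + w m2 j ≤ α) : T m1 m2 i j α := by
  obtain ⟨C, hC⟩ := pY hi
  refine ⟨C, fun u v hu hv => ?_⟩
  refine (q_mul_le h (cont_iter hv j) (hC u hu)).trans ?_
  rw [mul_assoc]
  gcongr
  exact q_le_Y hj v

lemma T_symm {m1 m2 i j : ℕ} {α : ℝ} (h : T m2 m1 j i α) : T m1 m2 i j α := by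
  obtain ⟨C, hC⟩ := h
  refine ⟨C, fun u v hu hv => ?_⟩
  have := hC v u hv hu
  rw [mul_comm (YnormSq m2 v)] at this
  refine le_trans (le_of_eq ?_) this
  congr 1; ext s; ring

lemma T_main {m i j : ℕ} (h : i + j ≤ m) : T (max m 3) m i j (w m (i + j)) := by
  rcases Nat.lt_or_ge m 3 with hm | hm
  · rw [max_eq_right hm.le]
    apply T_left (by omega) (by omega)
    have hi : i ≤ 2 := by omega
    have hj : j ≤ 2 := by omega
    interval_cases m <;> interval_cases i <;> interval_cases j <;>
      first | omega | norm_num [pE, w]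
  · rw [max_eq_left hm]
    have key : ∀ i j : ℕ, i + j ≤ m → i ≤ j → T m m i j (w m (i + j)) := by
      intro i j h hij
      apply T_left (by omega) (by omega)
      have hm' : (3:ℝ) ≤ m := by exact_mod_cast hm
      have hi' : (0:ℝ) ≤ i := by positivity
      have hij' : (i:ℝ) ≤ j := by exact_mod_cast hij
      unfold pE w
      split_ifs with h1 h2 h3 h4 h5 h6 h7 h8 h9 <;> push_cast <;> try omega
      all_goals try (rename_i hh; have hh' : (m:ℝ) ≤ 2 * (i + j) := by exact_mod_cast (by omega : m ≤ 2 * (i + j)))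
      all_goals try linarith
      all_goals
        have h7 : (m:ℝ) = 2 * i + 2 := by exact_mod_cast (by omega : m = 2 * i + 2)
        have h8 : (1:ℝ) ≤ j := by exact_mod_cast (by omega : 1 ≤ j)
        linarith
    rcases le_total i j with hij | hij
    · exact key i j h hij
    · rw [add_comm]; exact T_symm (key j i (by omega) hij)

lemma T_zero : T 1 1 0 0 (w 0 0) := by
  apply T_left (by omega) (by omega)
  norm_num [pE, w]

lemma T_one_l : T 2 2 1 0 (w 1 1) := by
  apply T_left (by omega) (by omega)
  norm_num [pE, w]

lemma T_one_r : T 2 2 0 1 (w 1 1) := T_symm T_one_l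

lemma T_one_z : T 2 2 0 0 (w 1 0) := by
  obtain ⟨C, hC⟩ := pY (m := 2) (i := 0) (by omega)
  refine ⟨C * C * 2, fun u v hu hv => ?_⟩
  have e : pE 2 0 = 1/8 := by norm_num [pE]
  rw [e] at hC
  have hp : ∀ s ∈ Set.Ioo (0:ℝ) 1, ENNReal.ofReal (s ^ (2 * w 1 0) *
      ‖iteratedDeriv 0 u s * iteratedDeriv 0 v s‖ ^ 2) ≤
      (C * YnormSq 2 u) * (C * YnormSq 2 v) * ENNReal.ofReal (s ^ (-(1/2:ℝ))) := by
    intro s hs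
    have hs0 := hs.1
    have h2 := mul_le_mul' (hC u hu s hs) (hC v hv s hs)
    refine le_trans ?_ (mul_le_mul_left h2 _)
    rw [← ENNReal.ofReal_mul (by positivity), ← ENNReal.ofReal_mul (by positivity)]
    apply ENNReal.ofReal_le_ofReal
    apply le_of_eq
    have e3 : s ^ (2 * (1/8:ℝ)) * s ^ (2 * (1/8:ℝ)) * s ^ (-(1/2:ℝ)) = 1 := by
      rw [← Real.rpow_add hs0, ← Real.rpow_add hs0]; norm_num
    have e4 : w 1 0 = 0 := by norm_num [w]
    rw [e4, mul_zero, Real.rpow_zero, norm_mul, mul_pow]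
    linear_combination (-(‖iteratedDeriv 0 u s‖ ^ 2 * ‖iteratedDeriv 0 v s‖ ^ 2)) * e3
  have hintg : IntervalIntegrable (fun x : ℝ => x ^ (-(1/2:ℝ))) volume 0 1 :=
    intervalIntegral.intervalIntegrable_rpow' (by norm_num)
  have hI : ∫ x in (0:ℝ)..1, x ^ (-(1/2:ℝ)) = 2 := by
    rw [integral_rpow (Or.inl (by norm_num))]; norm_num
  rw [intervalIntegrable_iff_integrableOn_Ioo_of_le (by norm_num)] at hintg
  rw [intervalIntegral.integral_of_le (by norm_num), integral_Ioc_eq_integral_Ioo] at hI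
  have hL : ∫⁻ x in Set.Ioo (0:ℝ) 1, ENNReal.ofReal (x ^ (-(1/2:ℝ))) = 2 := by
    rw [← ofReal_integral_eq_lintegral_ofReal hintg, hI]
    · simp
    · refine (ae_restrict_iff' measurableSet_Ioo).2 (Filter.Eventually.of_forall fun x hx => ?_)
      exact Real.rpow_nonneg (by linarith [hx.1]) _
  refine (setLIntegral_mono' measurableSet_Ioo hp).trans ?_
  rw [lintegral_const_mul'' _ (by fun_prop), hL]
  push_cast
  apply le_of_eq; ring

lemma assemble {m m1 m2 : ℕ} (h : ∀ i j, i + j ≤ m → T m1 m2 i j (w m (i + j))) :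
    ∃ C : ℝ, 0 < C ∧ ∀ u v : ℝ → ℝ, ContDiffOn ℝ (⊤ : ℕ∞) u (Set.Ioi 0) →
      ContDiffOn ℝ (⊤ : ℕ∞) v (Set.Ioi 0) →
      Ynorm m (fun s => u s * v s) ≤ ENNReal.ofReal C * (Ynorm m1 u * Ynorm m2 v) := by
  have h' : ∀ i j, ∃ C : NNReal, i + j ≤ m → ∀ u v : ℝ → ℝ, ContDiffOn ℝ (⊤ : ℕ∞) u (Set.Ioi 0) →
      ContDiffOn ℝ (⊤ : ℕ∞) v (Set.Ioi 0) →
      q (w m (i + j)) (fun s => iteratedDeriv i u s * iteratedDeriv j v s) ≤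
        C * (YnormSq m1 u * YnormSq m2 v) := by
    intro i j
    by_cases hij : i + j ≤ m
    · obtain ⟨C, hC⟩ := h i j hij
      exact ⟨C, fun _ => hC⟩
    · exact ⟨0, fun h => absurd h hij⟩
  choose c hc using h'
  let D : NNReal := ∑ n ∈ Finset.range (m + 1), ((n + 1 : ℕ) : NNReal) *
    ∑ i ∈ Finset.range (n + 1), (((n.choose i : ℝ)) ^ 2).toNNReal * c i (n - i)
  refine ⟨Real.sqrt (D + 1), Real.sqrt_pos.2 (by positivity), fun u v hu hv => ?_⟩
  have main : YnormSq m (fun s => u s * v s) ≤ D * (YnormSq m1 u * YnormSq m2 v) := by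
    rw [YnormSq_eq]
    simp only [D]
    push_cast
    rw [Finset.sum_mul]
    refine Finset.sum_le_sum fun n hn => ?_
    rw [Finset.mem_range] at hn
    have hle := q_sum_le (w m n) (n + 1)
      (F := fun i s => (n.choose i : ℝ) * (iteratedDeriv i u s * iteratedDeriv (n - i) v s))
      (G := iteratedDeriv n (fun s => u s * v s))
      (fun i => continuousOn_const.mul ((cont_iter hu i).mul (cont_iter hv (n - i)))) (by
        intro s hs
        have hs' : Set.Ioi (0:ℝ) ∈ nhds s := isOpen_Ioi.mem_nhds hs.1
        rw [iteratedDeriv_fun_mul ((hu.contDiffAt hs').of_le (by exact_mod_cast le_top))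
          ((hv.contDiffAt hs').of_le (by exact_mod_cast le_top))]
        simp only [mul_assoc])
    refine hle.trans ?_
    push_cast
    rw [mul_assoc, Finset.sum_mul]
    refine mul_le_mul_right (Finset.sum_le_sum fun i hi => ?_) _
    rw [Finset.mem_range] at hi
    rw [q_const_mul, mul_assoc]
    refine mul_le_mul_right ?_ _
    have := hc i (n - i) (by omega) u v hu hv
    rwa [show i + (n - i) = n by omega] at this
  unfold Ynorm
  have e : ENNReal.ofReal (Real.sqrt (D + 1)) = ((D:ℝ≥0∞) + 1) ^ ((1:ℝ)/2) := by
    rw [Real.sqrt_eq_rpow, ← ENNReal.ofReal_rpow_of_nonneg (by positivity) (by norm_num),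
      ENNReal.ofReal_add (by positivity) (by norm_num)]
    simp
  rw [e, ← ENNReal.mul_rpow_of_nonneg _ _ (by norm_num), ← ENNReal.mul_rpow_of_nonneg _ _ (by norm_num)]
  refine ENNReal.rpow_le_rpow (main.trans ?_) (by norm_num)
  exact mul_le_mul_left le_self_add _

end YProd

/-- product estimates in the `Y^m` norms. -/
theorem stmt8 (m : ℕ) :
    ∃ C : ℝ, 0 < C ∧ ∀ u v : ℝ → ℝ,
      ContDiffOn ℝ (⊤ : ℕ∞) u (Set.Ioi 0) → ContDiffOn ℝ (⊤ : ℕ∞) v (Set.Ioi 0) →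
      ((m = 0 ∨ m = 1) →
        Ynorm m (fun s => u s * v s) ≤ ENNReal.ofReal C * (Ynorm (m + 1) u * Ynorm (m + 1) v)) ∧
      Ynorm m (fun s => u s * v s) ≤ ENNReal.ofReal C * (Ynorm (max m 3) u * Ynorm m v) := by
  obtain ⟨C1, hC1, h1⟩ := YProd.assemble (m := m) (fun i j h => YProd.T_main h)
  have h2 : ∃ C : ℝ, 0 < C ∧ ((m = 0 ∨ m = 1) → ∀ u v : ℝ → ℝ,
      ContDiffOn ℝ (⊤ : ℕ∞) u (Set.Ioi 0) → ContDiffOn ℝ (⊤ : ℕ∞) v (Set.Ioi 0) →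
        Ynorm m (fun s => u s * v s) ≤
          ENNReal.ofReal C * (Ynorm (m + 1) u * Ynorm (m + 1) v)) := by
    by_cases hm : m = 0 ∨ m = 1
    · have : ∃ C : ℝ, 0 < C ∧ ∀ u v : ℝ → ℝ, ContDiffOn ℝ (⊤ : ℕ∞) u (Set.Ioi 0) →
          ContDiffOn ℝ (⊤ : ℕ∞) v (Set.Ioi 0) →
          Ynorm m (fun s => u s * v s) ≤
            ENNReal.ofReal C * (Ynorm (m + 1) u * Ynorm (m + 1) v) := by
        apply YProd.assemble
        intro i j hij
        rcases hm with rfl | rfl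
        · obtain ⟨rfl, rfl⟩ : i = 0 ∧ j = 0 := by omega
          exact YProd.T_zero
        · have hi : i ≤ 1 := by omega
          have hj : j ≤ 1 := by omega
          interval_cases i <;> interval_cases j
          · exact YProd.T_one_z
          · exact YProd.T_one_r
          · exact YProd.T_one_l
          · omega
      obtain ⟨C, hC, h⟩ := this
      exact ⟨C, hC, fun _ => h⟩
    · exact ⟨1, one_pos, fun h => absurd h hm⟩
  obtain ⟨C2, hC2, h2⟩ := h2
  refine ⟨max C1 C2, lt_max_of_lt_left hC1, fun u v hu hv => ⟨fun hm => ?_, ?_⟩⟩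
  · refine (h2 hm u v hu hv).trans (mul_le_mul_left (ENNReal.ofReal_le_ofReal ?_) _)
    exact le_max_right _ _
  · refine (h1 u v hu hv).trans (mul_le_mul_left (ENNReal.ofReal_le_ofReal ?_) _)
    exact le_max_left _ _
end
end

section
/- Let τ be a sufficiently smooth function on [0,1] with τ(0) = 0, and let u, v be sufficiently smooth functions on (0,1]. Then there exist constants C (depending only on the order m) such that: ‖τ u' v'‖_{Y^0} ≤ C ‖τ'‖_{L²(0,1)} ‖u‖_{Y³} ‖v‖_{Y²}; ‖τ u' v'‖_{Y^0} ≤ C ‖τ'‖_{L^∞(0,1)} ‖u‖_{Y²} ‖v‖_{Y²}; ‖τ u' v'‖_{Y^1} ≤ C ‖τ'‖_{L^∞(0,1)} ‖u‖_{Y³} ‖v‖_{Y²}; and for every integer m ≥ 2, ‖τ u' v'‖_{Y^m} ≤ C ( ‖τ'‖_{L^∞(0,1)} + ‖τ'‖_{X^{m-1}} ) ‖u‖_{Y^{m+1}} ‖v‖_{Y^{m+1}}. -/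
open MeasureTheory ENNReal RealInnerProductSpace

noncomputable section

def hz (n : ℤ) : ℤ := 4 * max 0 n
def lz (n : ℤ) : ℤ := if n = 0 then 1 else 4 * max 0 n
/-- weights in eighths -/
def W2 (z : ℤ) (f : ℝ → ℝ) : ℝ≥0∞ := wL2 ((z : ℝ) / 8) f
def Wi (z : ℤ) (f : ℝ → ℝ) : ℝ≥0∞ := wLinf ((z : ℝ) / 8) f

lemma wL2_eq (α : ℝ) (v : ℝ → ℝ) :
    wL2 α v = (∫⁻ s in Set.Ioo (0:ℝ) 1, (ENNReal.ofReal (s ^ α) * ‖v s‖ₑ) ^ 2) ^ ((1:ℝ) / 2) := by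
  unfold wL2
  congr 1
  apply setLIntegral_congr_fun measurableSet_Ioo
  intro s hs
  have hs0 : 0 < s := hs.1
  simp only
  rw [← ofReal_norm, ← ENNReal.ofReal_mul (by positivity), ← ENNReal.ofReal_pow (by positivity),
    mul_pow, ← Real.rpow_natCast (s ^ α) 2, ← Real.rpow_mul hs0.le]
  congr 3
  push_cast
  ring

lemma le_wLinf (γ : ℝ) (f : ℝ → ℝ) {s : ℝ} (hs : s ∈ Set.Ioo (0:ℝ) 1) :
    ENNReal.ofReal (s ^ γ) * ‖f s‖ₑ ≤ wLinf γ f := by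
  have hs0 : 0 < s := hs.1
  rw [← ofReal_norm, ← ENNReal.ofReal_mul (by positivity)]
  exact le_iSup (fun s : Set.Ioo (0:ℝ) 1 => ENNReal.ofReal ((s : ℝ) ^ γ * ‖f (s : ℝ)‖)) ⟨s, hs⟩

lemma wLinf_le (γ : ℝ) (f : ℝ → ℝ) (c : ℝ≥0∞)
    (h : ∀ s ∈ Set.Ioo (0:ℝ) 1, ENNReal.ofReal (s ^ γ) * ‖f s‖ₑ ≤ c) : wLinf γ f ≤ c := by
  refine iSup_le fun s => ?_
  have hs0 : 0 < (s : ℝ) := s.2.1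
  have := h s s.2
  rwa [← ofReal_norm, ← ENNReal.ofReal_mul (by positivity)] at this

lemma ofReal_rpow_anti {α β s : ℝ} (hs : s ∈ Set.Ioo (0:ℝ) 1) (h : α ≤ β) :
    ENNReal.ofReal (s ^ β) ≤ ENNReal.ofReal (s ^ α) :=
  ENNReal.ofReal_le_ofReal (Real.rpow_le_rpow_of_exponent_ge hs.1 hs.2.le h)

lemma ofReal_rpow_add {α β s : ℝ} (hs : s ∈ Set.Ioo (0:ℝ) 1) :
    ENNReal.ofReal (s ^ (α + β)) = ENNReal.ofReal (s ^ α) * ENNReal.ofReal (s ^ β) := by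
  have hs0 : 0 < s := hs.1
  rw [Real.rpow_add hs0, ENNReal.ofReal_mul (by positivity)]

lemma aemeas (α : ℝ) (f : ℝ → ℝ) (hf : ContinuousOn f (Set.Ioi 0)) :
    AEMeasurable (fun s => ENNReal.ofReal (s ^ α) * ‖f s‖ₑ)
      (volume.restrict (Set.Ioo (0:ℝ) 1)) := by
  have h1 : AEMeasurable f (volume.restrict (Set.Ioo (0:ℝ) 1)) :=
    (hf.mono Set.Ioo_subset_Ioi_self).aemeasurable measurableSet_Ioo
  have h2 : Measurable (fun s : ℝ => ENNReal.ofReal (s ^ α)) := by fun_prop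
  exact h2.aemeasurable.mul h1.enorm

lemma wL2_le_of_pt {w α : ℝ} {F f : ℝ → ℝ} (c : ℝ≥0∞) (hf : ContinuousOn f (Set.Ioi 0))
    (h : ∀ s ∈ Set.Ioo (0:ℝ) 1, ENNReal.ofReal (s ^ w) * ‖F s‖ₑ ≤
      c * (ENNReal.ofReal (s ^ α) * ‖f s‖ₑ)) : wL2 w F ≤ c * wL2 α f := by
  rw [wL2_eq, wL2_eq]
  have h1 : (∫⁻ s in Set.Ioo (0:ℝ) 1, (ENNReal.ofReal (s ^ w) * ‖F s‖ₑ) ^ 2) ≤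
      c ^ 2 * ∫⁻ s in Set.Ioo (0:ℝ) 1, (ENNReal.ofReal (s ^ α) * ‖f s‖ₑ) ^ 2 := by
    rw [← lintegral_const_mul'' _ ((aemeas α f hf).pow_const 2)]
    apply setLIntegral_mono' measurableSet_Ioo
    intro s hs
    rw [← mul_pow]
    exact pow_le_pow_left₀ zero_le (h s hs) 2
  refine (ENNReal.rpow_le_rpow h1 (by norm_num)).trans ?_
  rw [ENNReal.mul_rpow_of_nonneg _ _ (by norm_num), ← ENNReal.rpow_natCast, ← ENNReal.rpow_mul]
  norm_num

lemma wL2_mono {α β : ℝ} (f : ℝ → ℝ) (h : α ≤ β) : wL2 β f ≤ wL2 α f := by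
  rw [wL2_eq, wL2_eq]
  refine ENNReal.rpow_le_rpow (setLIntegral_mono' measurableSet_Ioo fun s hs => ?_) (by norm_num)
  have := ofReal_rpow_anti hs h
  gcongr

lemma W2_mono {α β : ℤ} (f : ℝ → ℝ) (h : α ≤ β) : W2 β f ≤ W2 α f := by
  apply wL2_mono
  have : (α : ℝ) ≤ β := by exact_mod_cast h
  linarith

lemma wL2_one : wL2 (-1/4) (fun _ => (1:ℝ)) ≤ 2 := by
  unfold wL2
  have h : (∫⁻ s in Set.Ioo (0:ℝ) 1, ENNReal.ofReal (s ^ (2 * (-1/4:ℝ)) * ‖(1:ℝ)‖ ^ 2)) = 2 := by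
    simp only [norm_one, one_pow, mul_one]
    rw [show (2 * (-1/4:ℝ)) = -1/2 by norm_num]
    have hi : IntervalIntegrable (fun s : ℝ => s ^ (-1/2 : ℝ)) volume 0 1 :=
      intervalIntegral.intervalIntegrable_rpow' (by norm_num)
    rw [← ofReal_integral_eq_lintegral_ofReal]
    · rw [← integral_Ioc_eq_integral_Ioo, ← intervalIntegral.integral_of_le (by norm_num),
        integral_rpow (Or.inl (by norm_num))]
      norm_num
    · exact ((intervalIntegrable_iff_integrableOn_Ioc_of_le (by norm_num)).1 hi).mono_set
        Set.Ioo_subset_Ioc_self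
    · filter_upwards [ae_restrict_mem measurableSet_Ioo] with s hs
      have : 0 < s := hs.1
      positivity
  rw [h]
  calc (2:ℝ≥0∞) ^ ((1:ℝ)/2) ≤ 2 ^ (1:ℝ) :=
        ENNReal.rpow_le_rpow_of_exponent_le (by norm_num) (by norm_num)
    _ = 2 := by simp

lemma tri_aux {α β γ w : ℝ} (F f g h : ℝ → ℝ) (hw : α + β + γ ≤ w) {s : ℝ}
    (hs : s ∈ Set.Ioo (0:ℝ) 1) (hF : F s = f s * g s * h s) :
    ENNReal.ofReal (s ^ w) * ‖F s‖ₑ ≤ (ENNReal.ofReal (s ^ α) * ‖f s‖ₑ) *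
      ((ENNReal.ofReal (s ^ β) * ‖g s‖ₑ) * (ENNReal.ofReal (s ^ γ) * ‖h s‖ₑ)) := by
  rw [hF, enorm_mul, enorm_mul]
  calc _ ≤ ENNReal.ofReal (s ^ (α + β + γ)) * (‖f s‖ₑ * ‖g s‖ₑ * ‖h s‖ₑ) := by
        exact mul_le_mul_left (ofReal_rpow_anti hs hw) _
    _ = _ := by
        rw [ofReal_rpow_add hs, ofReal_rpow_add hs]; ring

/-- L² times L∞ times L∞ -/
lemma triA {α β γ w : ℤ} (F f g h : ℝ → ℝ) (hw : α + β + γ ≤ w) (hf : ContinuousOn f (Set.Ioi 0))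
    (hF : ∀ s, F s = f s * g s * h s) : W2 w F ≤ W2 α f * (Wi β g * Wi γ h) := by
  rw [mul_comm]
  apply wL2_le_of_pt _ hf
  intro s hs
  have hw' : (α : ℝ) / 8 + β / 8 + γ / 8 ≤ w / 8 := by
    have : (α : ℝ) + β + γ ≤ w := by exact_mod_cast hw
    linarith
  refine (tri_aux F f g h hw' hs (hF s)).trans ?_
  rw [mul_comm]
  gcongr
  · exact le_wLinf _ _ hs
  · exact le_wLinf _ _ hs

/-- L∞ times L∞ times L∞ -/
lemma triB {α β γ w : ℤ} (F f g h : ℝ → ℝ) (hw : α + β + γ ≤ w + 2)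
    (hF : ∀ s, F s = f s * g s * h s) : W2 w F ≤ 2 * (Wi α f * (Wi β g * Wi γ h)) := by
  have key : W2 w F ≤ (Wi α f * (Wi β g * Wi γ h)) * wL2 (-1/4) (fun _ => (1:ℝ)) := by
    apply wL2_le_of_pt _ continuousOn_const
    intro s hs
    have hw' : (α : ℝ) / 8 + β / 8 + γ / 8 ≤ w / 8 + 1 / 4 := by
      have : (α : ℝ) + β + γ ≤ w + 2 := by exact_mod_cast hw
      linarith
    have h1 := tri_aux F f g h hw' hs (hF s)
    have h2 : ENNReal.ofReal (s ^ ((w:ℝ) / 8)) = ENNReal.ofReal (s ^ ((w:ℝ) / 8 + 1 / 4)) *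
        ENNReal.ofReal (s ^ (-1/4:ℝ)) := by
      rw [← ofReal_rpow_add hs]; congr 2; ring
    rw [h2, enorm_one, mul_one, mul_right_comm]
    refine mul_le_mul_left (h1.trans ?_) _
    gcongr
    · exact le_wLinf _ _ hs
    · exact le_wLinf _ _ hs
    · exact le_wLinf _ _ hs
  refine key.trans ?_
  rw [mul_comm]
  gcongr
  exact wL2_one

lemma wL2_eq_eLpNorm (α : ℝ) (f : ℝ → ℝ) :
    wL2 α f = eLpNorm (fun s => s ^ α * f s) 2 (volume.restrict (Set.Ioo (0:ℝ) 1)) := by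
  rw [wL2_eq, eLpNorm_eq_lintegral_rpow_enorm_toReal (by norm_num) (by norm_num)]
  simp only [ENNReal.toReal_ofNat]
  congr 1
  apply setLIntegral_congr_fun measurableSet_Ioo
  intro s hs
  have hs0 : 0 < s := hs.1
  simp only
  rw [enorm_mul, ENNReal.rpow_two, Real.enorm_of_nonneg (by positivity : 0 ≤ s ^ α)]

lemma wL2_sum {ι : Type*} (S : Finset ι) (w : ℝ) (F : ℝ → ℝ) (f : ι → ℝ → ℝ) (k : ι → ℕ)
    (hf : ∀ i ∈ S, ContinuousOn (f i) (Set.Ioi 0))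
    (hF : ∀ s ∈ Set.Ioo (0:ℝ) 1, F s = ∑ i ∈ S, (k i : ℝ) * f i s) :
    wL2 w F ≤ ∑ i ∈ S, (k i : ℝ≥0∞) * wL2 w (f i) := by
  have hF' : wL2 w F = wL2 w (fun s => ∑ i ∈ S, (k i : ℝ) * f i s) := by
    rw [wL2_eq, wL2_eq]
    congr 1
    apply setLIntegral_congr_fun measurableSet_Ioo
    intro s hs
    simp only
    rw [hF s hs]
  have hm : Measurable (fun s : ℝ => s ^ w) := by fun_prop
  have e : (fun s : ℝ => s ^ w * ∑ i ∈ S, (k i : ℝ) * f i s) =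
      ∑ i ∈ S, fun s => s ^ w * ((k i : ℝ) * f i s) := by
    ext s; simp [Finset.mul_sum]
  rw [hF', wL2_eq_eLpNorm, e]
  refine (eLpNorm_sum_le ?_ (by norm_num)).trans (Finset.sum_le_sum fun i hi => ?_)
  · intro i hi
    have h1 : AEMeasurable (f i) (volume.restrict (Set.Ioo (0:ℝ) 1)) :=
      ((hf i hi).mono Set.Ioo_subset_Ioi_self).aemeasurable measurableSet_Ioo
    exact (hm.aemeasurable.mul (h1.const_mul _)).aestronglyMeasurable
  · rw [← wL2_eq_eLpNorm w (fun s => (k i : ℝ) * f i s)]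
    apply wL2_le_of_pt _ (hf i hi)
    intro s hs
    rw [enorm_mul]
    have hk : ‖(k i : ℝ)‖ₑ = (k i : ℝ≥0∞) := by
      rw [Real.enorm_of_nonneg (by positivity)]; simp
    rw [hk]
    apply le_of_eq; ring

lemma diff_le (f : ℝ → ℝ) (hf : ContDiffOn ℝ (⊤ : ℕ∞) f (Set.Ioi 0)) {s t : ℝ} (hs : 0 < s)
    (hst : s ≤ t) : ‖f t - f s‖ₑ ≤ ∫⁻ r in Set.Ioo s t, ‖deriv f r‖ₑ := by
  have hd : ∀ x ∈ Set.uIcc s t, DifferentiableAt ℝ f x := by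
    intro x hx
    rw [Set.uIcc_of_le hst] at hx
    exact (hf.contDiffAt (Ioi_mem_nhds (hs.trans_le hx.1))).differentiableAt (by simp)
  have hc : ContinuousOn (deriv f) (Set.Ioi 0) := hf.continuousOn_deriv_of_isOpen isOpen_Ioi (by simp)
  have hi : IntervalIntegrable (deriv f) volume s t := by
    apply ContinuousOn.intervalIntegrable
    apply hc.mono
    intro x hx
    rw [Set.uIcc_of_le hst] at hx
    exact hs.trans_le hx.1
  rw [← intervalIntegral.integral_deriv_eq_sub hd hi, intervalIntegral.integral_of_le hst,
    integral_Ioc_eq_integral_Ioo]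
  exact enorm_integral_le_lintegral_enorm _

lemma cs_le (g : ℝ → ℝ) (hg : ContinuousOn g (Set.Ioi 0)) (α : ℝ) {σ b : ℝ} (hσ : 0 ≤ σ)
    (hb : b ≤ 1) :
    ∫⁻ r in Set.Ioo σ b, ‖g r‖ₑ ≤
      (∫⁻ r in Set.Ioo σ b, ENNReal.ofReal (r ^ (-(2 * α)))) ^ ((1:ℝ)/2) * wL2 α g := by
  have hsub : Set.Ioo σ b ⊆ Set.Ioo (0:ℝ) 1 := Set.Ioo_subset_Ioo hσ hb
  have h2 : Measurable (fun s : ℝ => ENNReal.ofReal (s ^ (-α))) := by fun_prop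
  have H := ENNReal.lintegral_mul_le_Lp_mul_Lq (volume.restrict (Set.Ioo σ b))
    Real.HolderConjugate.two_two h2.aemeasurable
    ((aemeas α g hg).mono_measure (Measure.restrict_mono hsub le_rfl))
  have e1 : ∫⁻ r in Set.Ioo σ b, ‖g r‖ₑ = ∫⁻ r in Set.Ioo σ b,
      ((fun s : ℝ => ENNReal.ofReal (s ^ (-α))) * (fun s => ENNReal.ofReal (s ^ α) * ‖g s‖ₑ)) r := by
    apply setLIntegral_congr_fun measurableSet_Ioo
    intro r hr
    simp only [Pi.mul_apply]
    rw [← mul_assoc, ← ofReal_rpow_add (hsub hr)]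
    simp
  rw [e1]
  refine H.trans ?_
  gcongr ?_ * ?_
  · apply ENNReal.rpow_le_rpow _ (by norm_num)
    apply setLIntegral_mono' measurableSet_Ioo
    intro r hr
    rw [ENNReal.rpow_two, sq, ← ofReal_rpow_add (hsub hr)]
    apply le_of_eq; congr 2; ring
  · rw [wL2_eq]
    apply ENNReal.rpow_le_rpow _ (by norm_num)
    simp only [ENNReal.rpow_two]
    exact lintegral_mono_set hsub

lemma kernel_le {n : ℤ} {σ : ℝ} (hσ : 0 < σ) (hσ1 : σ < 1) :
    (∫⁻ r in Set.Ioo σ 1, ENNReal.ofReal (r ^ (-(2 * ((hz (n+1) : ℝ) / 8))))) ^ ((1:ℝ)/2) ≤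
      2 * ENNReal.ofReal (σ ^ (-((lz n : ℝ) / 8))) := by
  have hsub : Set.Ioo σ 1 ⊆ Set.Ioo (0:ℝ) 1 := Set.Ioo_subset_Ioo hσ.le le_rfl
  have main : (∫⁻ r in Set.Ioo σ 1, ENNReal.ofReal (r ^ (-(2 * ((hz (n+1) : ℝ) / 8))))) ≤
      ENNReal.ofReal (4 * (σ ^ (-((lz n : ℝ) / 8)))^2) := by
    by_cases hn : n < 0
    · have h1 : hz (n+1) = 0 := by unfold hz; omega
      have h2 : lz n = 0 := by unfold lz; split_ifs <;> omega
      rw [h1, h2]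
      simp
      linarith
    · have h1 : hz (n+1) ≤ lz n + 4 := by unfold hz lz; split_ifs <;> omega
      have h2 : 1 ≤ lz n := by unfold lz; split_ifs <;> omega
      have h1' : (hz (n+1) : ℝ) ≤ lz n + 4 := by exact_mod_cast h1
      have h2' : (1:ℝ) ≤ lz n := by exact_mod_cast h2
      set z : ℝ := (lz n : ℝ) with hzdef
      calc _ ≤ ∫⁻ r in Set.Ioo σ 1, ENNReal.ofReal (r ^ (-(z / 4 + 1))) := by
            apply setLIntegral_mono' measurableSet_Ioo
            intro r hr
            apply ofReal_rpow_anti (hsub hr)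
            linarith
        _ = ENNReal.ofReal (∫ r in σ..1, r ^ (-(z / 4 + 1))) := by
            have hi : IntervalIntegrable (fun s : ℝ => s ^ (-(z / 4 + 1))) volume σ 1 := by
              apply intervalIntegral.intervalIntegrable_rpow
              right
              rw [Set.uIcc_of_le hσ1.le]
              intro h; exact absurd h.1 (not_le.2 hσ)
            rw [intervalIntegral.integral_of_le hσ1.le, integral_Ioc_eq_integral_Ioo,
              ofReal_integral_eq_lintegral_ofReal]
            · exact ((intervalIntegrable_iff_integrableOn_Ioc_of_le hσ1.le).1 hi).mono_set
                Set.Ioo_subset_Ioc_self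
            · filter_upwards [ae_restrict_mem measurableSet_Ioo] with s hs
              have : 0 < s := (hsub hs).1
              positivity
        _ ≤ _ := by
            apply ENNReal.ofReal_le_ofReal
            rw [integral_rpow]
            · rw [← Real.rpow_natCast (σ ^ _) 2, ← Real.rpow_mul hσ.le, Real.one_rpow]
              have e1 : -(z / 4 + 1) + 1 = -(z/4) := by ring
              have e2 : -(z / 8) * ((2:ℕ):ℝ) = -(z/4) := by push_cast; ring
              rw [e1, e2, div_neg, ← neg_div, neg_sub, div_le_iff₀ (by linarith)]
              have : 0 < σ ^ (-(z/4)) := by positivity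
              nlinarith
            · right
              constructor
              · intro h; linarith
              · rw [Set.uIcc_of_le hσ1.le]
                intro h; exact absurd h.1 (not_le.2 hσ)
  refine (ENNReal.rpow_le_rpow main (by norm_num)).trans ?_
  rw [show (4 * (σ ^ (-((lz n : ℝ) / 8)))^2) = (2 * (σ ^ (-((lz n : ℝ) / 8))))^2 by ring,
    ENNReal.ofReal_pow (by positivity), ← ENNReal.rpow_natCast, ← ENNReal.rpow_mul,
    ENNReal.ofReal_mul (by norm_num)]
  norm_num

lemma avg_le (f : ℝ → ℝ) (M : ℕ) (β : ℝ) (hβ : β ≤ M) (c : ℝ≥0∞)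
    (h : ∀ t ∈ Set.Ioo (1/2:ℝ) 1, c ≤ ‖f t‖ₑ) : c ≤ 2 ^ (M + 1) * wL2 β f := by
  refine le_trans ?_ (mul_le_mul_right (wL2_mono f hβ) _)
  rw [wL2_eq]
  have h1 : (ENNReal.ofReal ((1/2)^M) * c) ^ 2 * ENNReal.ofReal (1/2) ≤
      ∫⁻ s in Set.Ioo (0:ℝ) 1, (ENNReal.ofReal (s ^ (M:ℝ)) * ‖f s‖ₑ) ^ 2 := by
    calc _ = ∫⁻ s in Set.Ioo (1/2:ℝ) 1, (ENNReal.ofReal ((1/2)^M) * c) ^ 2 := by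
          rw [setLIntegral_const, Real.volume_Ioo]; norm_num
      _ ≤ ∫⁻ s in Set.Ioo (1/2:ℝ) 1, (ENNReal.ofReal (s ^ (M:ℝ)) * ‖f s‖ₑ) ^ 2 := by
          apply setLIntegral_mono' measurableSet_Ioo
          intro s hs
          have hs1 : (1/2:ℝ) < s := hs.1
          have := h s hs
          rw [Real.rpow_natCast]
          gcongr
      _ ≤ _ := lintegral_mono_set (Set.Ioo_subset_Ioo (by norm_num) le_rfl)
  have h2 := ENNReal.rpow_le_rpow h1 (by norm_num : (0:ℝ) ≤ 1/2)
  have h3 : ENNReal.ofReal ((1/2)^(M+1)) * c ≤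
      ((ENNReal.ofReal ((1/2)^M) * c) ^ 2 * ENNReal.ofReal (1/2)) ^ ((1:ℝ)/2) := by
    rw [ENNReal.mul_rpow_of_nonneg _ _ (by norm_num), ← ENNReal.rpow_natCast, ← ENNReal.rpow_mul]
    have : ENNReal.ofReal (1/2) ≤ ENNReal.ofReal (1/2) ^ ((1:ℝ)/2) := by
      conv_lhs => rw [← ENNReal.rpow_one (ENNReal.ofReal (1/2))]
      apply ENNReal.rpow_le_rpow_of_exponent_ge
      · rw [ENNReal.ofReal_le_one]; norm_num
      · norm_num
    rw [pow_succ, ENNReal.ofReal_mul (by positivity), mul_right_comm]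
    norm_num at this ⊢
    gcongr
  have h4 := h3.trans h2
  calc c = 2 ^ (M+1) * (ENNReal.ofReal ((1/2)^(M+1)) * c) := by
        rw [← mul_assoc]
        have : (2:ℝ≥0∞) ^ (M+1) = ENNReal.ofReal (2^(M+1)) := by
          rw [ENNReal.ofReal_pow (by norm_num)]; norm_num
        rw [this, ← ENNReal.ofReal_mul (by positivity), ← mul_pow]
        norm_num
    _ ≤ _ := by gcongr

lemma sobolev (f : ℝ → ℝ) (hf : ContDiffOn ℝ (⊤ : ℕ∞) f (Set.Ioi 0)) (n : ℤ) (M : ℕ) (hM : 1 ≤ M)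
    (hn : n ≤ 2 * M) :
    Wi (lz n) f ≤ 2 ^ (M + 1) * (W2 (hz (n+1)) (deriv f) + W2 (hz (n-1)) f) := by
  have hc : ContinuousOn (deriv f) (Set.Ioi 0) := hf.continuousOn_deriv_of_isOpen isOpen_Ioi (by simp)
  apply wLinf_le
  intro s hs
  have hs0 : 0 < s := hs.1
  have hlz0 : 0 ≤ lz n := by unfold lz; split_ifs <;> omega
  have hlz0' : (0:ℝ) ≤ lz n := by exact_mod_cast hlz0
  have hlzM : lz n ≤ 8 * M := by unfold lz; split_ifs <;> omega
  have hlzM' : (lz n : ℝ) ≤ 8 * M := by exact_mod_cast hlzM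
  have hhM : hz (n-1) ≤ 8 * M := by unfold hz; omega
  have hhM' : (hz (n-1) : ℝ) ≤ 8 * M := by exact_mod_cast hhM
  set D : ℝ≥0∞ := ∫⁻ r in Set.Ioo (s/2) 1, ‖deriv f r‖ₑ with hD
  have hdiff : ∀ t ∈ Set.Ioo (1/2:ℝ) 1, ‖f s‖ₑ ≤ ‖f t‖ₑ + D := by
    intro t ht
    have ht1 : 1/2 < t := ht.1
    have hs1 : s < 1 := hs.2
    have h1 : ‖f s - f t‖ₑ ≤ D := by
      rcases le_total s t with h | h
      · rw [← enorm_neg, neg_sub]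
        refine (diff_le f hf hs0 h).trans (lintegral_mono_set (Set.Ioo_subset_Ioo ?_ ht.2.le))
        linarith
      · refine (diff_le f hf (by linarith) h).trans (lintegral_mono_set (Set.Ioo_subset_Ioo ?_ hs1.le))
        linarith
    calc ‖f s‖ₑ = ‖f t + (f s - f t)‖ₑ := by ring_nf
      _ ≤ ‖f t‖ₑ + ‖f s - f t‖ₑ := enorm_add_le _ _
      _ ≤ _ := by gcongr
  have hA : ‖f s‖ₑ ≤ 2 ^ (M+1) * W2 (hz (n-1)) f + D := by
    rw [← tsub_le_iff_right]
    apply avg_le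
    · linarith
    · intro t ht
      rw [tsub_le_iff_right]
      exact hdiff t ht
  have hDle : D ≤ 2 * ENNReal.ofReal ((s/2) ^ (-((lz n : ℝ) / 8))) * W2 (hz (n+1)) (deriv f) := by
    refine (cs_le (deriv f) hc ((hz (n+1) : ℝ) / 8) (by linarith) le_rfl).trans ?_
    exact mul_le_mul_left (kernel_le (by linarith) (by linarith [hs.2])) _
  have hk : ENNReal.ofReal (s ^ ((lz n : ℝ)/8)) * ENNReal.ofReal ((s/2) ^ (-((lz n : ℝ) / 8))) ≤ 2 ^ M := by
    rw [← ENNReal.ofReal_mul (by positivity), Real.div_rpow hs0.le (by norm_num), ← mul_div_assoc,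
      ← Real.rpow_add hs0, add_neg_cancel, Real.rpow_zero, Real.rpow_neg (by norm_num), one_div, inv_inv]
    have : (2:ℝ≥0∞) ^ M = ENNReal.ofReal (2^M) := by
      rw [ENNReal.ofReal_pow (by norm_num)]; norm_num
    rw [this, ← Real.rpow_natCast]
    apply ENNReal.ofReal_le_ofReal
    apply Real.rpow_le_rpow_of_exponent_le (by norm_num)
    linarith
  have hs1 : ENNReal.ofReal (s ^ ((lz n : ℝ)/8)) ≤ 1 := by
    rw [ENNReal.ofReal_le_one]
    exact Real.rpow_le_one hs0.le hs.2.le (by positivity)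
  calc _ ≤ ENNReal.ofReal (s ^ ((lz n : ℝ)/8)) * (2 ^ (M+1) * W2 (hz (n-1)) f +
        2 * ENNReal.ofReal ((s/2) ^ (-((lz n : ℝ) / 8))) * W2 (hz (n+1)) (deriv f)) := by
        exact mul_le_mul_right (hA.trans (add_le_add_right hDle _)) _
    _ = ENNReal.ofReal (s ^ ((lz n : ℝ)/8)) * (2 ^ (M+1) * W2 (hz (n-1)) f) +
        (ENNReal.ofReal (s ^ ((lz n : ℝ)/8)) * ENNReal.ofReal ((s/2) ^ (-((lz n : ℝ) / 8)))) * 2 *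
          W2 (hz (n+1)) (deriv f) := by ring
    _ ≤ 1 * (2 ^ (M+1) * W2 (hz (n-1)) f) + 2 ^ M * 2 * W2 (hz (n+1)) (deriv f) := by gcongr
    _ = _ := by ring

lemma tau_le (τ : ℝ → ℝ) (hτ : ContDiffOn ℝ (⊤ : ℕ∞) τ (Set.Ici 0)) (h0 : τ 0 = 0) {s : ℝ}
    (hs : 0 < s) : ‖τ s‖ₑ ≤ ∫⁻ r in Set.Ioo 0 s, ‖deriv τ r‖ₑ := by
  have hc : Filter.Tendsto τ (nhdsWithin 0 (Set.Ioi 0)) (nhds 0) := by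
    have := (hτ.continuousOn 0 (Set.self_mem_Ici)).mono Set.Ioi_subset_Ici_self
    rw [ContinuousWithinAt, h0] at this
    exact this
  have hl : Filter.Tendsto (fun t => ‖τ s - τ t‖ₑ) (nhdsWithin 0 (Set.Ioi 0)) (nhds ‖τ s - 0‖ₑ) :=
    (tendsto_const_nhds.sub hc).enorm
  rw [sub_zero] at hl
  refine le_of_tendsto hl ?_
  filter_upwards [Ioo_mem_nhdsGT hs] with t ht
  exact (diff_le τ (hτ.mono Set.Ioi_subset_Ici_self) ht.1 ht.2.le).trans
    (lintegral_mono_set (Set.Ioo_subset_Ioo ht.1.le le_rfl))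

lemma tau_inf (τ : ℝ → ℝ) (hτ : ContDiffOn ℝ (⊤ : ℕ∞) τ (Set.Ici 0)) (h0 : τ 0 = 0) :
    Wi (-8) τ ≤ Wi 0 (deriv τ) := by
  apply wLinf_le
  intro s hs
  have hs0 : 0 < s := hs.1
  have h1 : ‖τ s‖ₑ ≤ ENNReal.ofReal s * Wi 0 (deriv τ) := by
    refine (tau_le τ hτ h0 hs0).trans ?_
    calc _ ≤ ∫⁻ r in Set.Ioo 0 s, Wi 0 (deriv τ) := by
          apply setLIntegral_mono' measurableSet_Ioo
          intro r hr
          have := le_wLinf ((0:ℤ)/8) (deriv τ) (s := r) ⟨hr.1, hr.2.trans hs.2⟩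
          simpa [Wi] using this
      _ = _ := by rw [setLIntegral_const, Real.volume_Ioo, sub_zero, mul_comm]
  calc _ ≤ ENNReal.ofReal (s ^ (((-8:ℤ):ℝ)/8)) * (ENNReal.ofReal s * Wi 0 (deriv τ)) :=
        mul_le_mul_right h1 _
    _ = _ := by
        rw [← mul_assoc, ← ENNReal.ofReal_mul (by positivity)]
        norm_num
        rw [Real.rpow_neg_one, inv_mul_cancel₀ hs0.ne']
        simp

lemma tau_two (τ : ℝ → ℝ) (hτ : ContDiffOn ℝ (⊤ : ℕ∞) τ (Set.Ici 0)) (h0 : τ 0 = 0) :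
    Wi (-4) τ ≤ W2 0 (deriv τ) := by
  have hc : ContinuousOn (deriv τ) (Set.Ioi 0) :=
    (hτ.mono Set.Ioi_subset_Ici_self).continuousOn_deriv_of_isOpen isOpen_Ioi (by simp)
  apply wLinf_le
  intro s hs
  have hs0 : 0 < s := hs.1
  have h1 : ‖τ s‖ₑ ≤ ENNReal.ofReal (s ^ ((1:ℝ)/2)) * W2 0 (deriv τ) := by
    refine (tau_le τ hτ h0 hs0).trans ((cs_le _ hc 0 le_rfl hs.2.le).trans ?_)
    simp only [mul_zero, neg_zero, Real.rpow_zero, ENNReal.ofReal_one]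
    rw [setLIntegral_const, Real.volume_Ioo, sub_zero, one_mul,
      ENNReal.ofReal_rpow_of_nonneg hs0.le (by norm_num)]
    simp [W2]
  calc _ ≤ ENNReal.ofReal (s ^ (((-4:ℤ):ℝ)/8)) * (ENNReal.ofReal (s ^ ((1:ℝ)/2)) * W2 0 (deriv τ)) :=
        mul_le_mul_right h1 _
    _ = _ := by
        rw [← mul_assoc, ← ofReal_rpow_add hs]
        norm_num

lemma hz_nonneg_real (z : ℤ) (w : ℝ) (n : ℤ) (hn : 0 ≤ n) (hw : w = (n : ℝ) / 2) (hz' : z = n) :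
    wL2 w = W2 (hz z) := by
  funext f
  unfold W2
  congr 1
  have : hz z = 4 * n := by unfold hz; omega
  rw [this, hw]; push_cast; ring

lemma hz_zero (z : ℤ) (h : z ≤ 0) : wL2 (E := ℝ) 0 = W2 (hz z) := by
  funext f
  unfold W2
  congr 1
  have : hz z = 0 := by unfold hz; omega
  rw [this]; simp

lemma YnormSq_eq (m : ℕ) (u : ℝ → ℝ) :
    YnormSq m u = ∑ i ∈ Finset.range (m + 1), W2 (hz (2 * i - m + 1)) (iteratedDeriv i u) ^ 2 := by
  unfold YnormSq
  split_ifs with h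
  · have e : m + 1 = m / 2 + (m / 2 + 1) := by omega
    rw [e, Finset.sum_range_add (fun i : ℕ => W2 (hz (2 * i - m + 1)) (iteratedDeriv i u) ^ 2)]
    congr 1
    · refine Finset.sum_congr rfl fun i hi => ?_
      rw [Finset.mem_range] at hi
      rw [hz_zero]
      omega
    · refine Finset.sum_congr rfl fun i hi => ?_
      rw [hz_nonneg_real (2 * ((m / 2 + i : ℕ) : ℤ) - m + 1) _ (2 * i + 1) (by omega)
        (by push_cast; ring) (by omega)]
  · have e : m + 1 = (m / 2 + 1) + (m / 2 + 1) := by omega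
    rw [e, Finset.sum_range_add (fun i : ℕ => W2 (hz (2 * i - m + 1)) (iteratedDeriv i u) ^ 2)]
    congr 1
    · refine Finset.sum_congr rfl fun i hi => ?_
      rw [Finset.mem_range] at hi
      rw [hz_zero]
      omega
    · refine Finset.sum_congr rfl fun i hi => ?_
      rw [hz_nonneg_real (2 * ((m / 2 + 1 + i : ℕ) : ℤ) - m + 1) _ (2 * i + 2) (by omega)
        (by push_cast; ring) (by omega), show m / 2 + i + 1 = m / 2 + 1 + i by ring]

lemma XnormSq_eq (m : ℕ) (u : ℝ → ℝ) :
    XnormSq m u = ∑ i ∈ Finset.range (m + 1), W2 (hz (2 * i - m)) (iteratedDeriv i u) ^ 2 := by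
  unfold XnormSq
  split_ifs with h
  · have e : m + 1 = (m / 2 + 1) + (m / 2) := by omega
    rw [e, Finset.sum_range_add (fun i : ℕ => W2 (hz (2 * i - m)) (iteratedDeriv i u) ^ 2)]
    congr 1
    · refine Finset.sum_congr rfl fun i hi => ?_
      rw [Finset.mem_range] at hi
      rw [hz_zero]
      omega
    · refine Finset.sum_congr rfl fun i hi => ?_
      rw [hz_nonneg_real (2 * ((m / 2 + 1 + i : ℕ) : ℤ) - m) _ (2 * i + 2) (by omega)
        (by push_cast; ring) (by omega), show m / 2 + i + 1 = m / 2 + 1 + i by ring]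
  · have e : m + 1 = (m / 2 + 1) + (m / 2 + 1) := by omega
    rw [e, Finset.sum_range_add (fun i : ℕ => W2 (hz (2 * i - m)) (iteratedDeriv i u) ^ 2)]
    congr 1
    · refine Finset.sum_congr rfl fun i hi => ?_
      rw [Finset.mem_range] at hi
      rw [hz_zero]
      omega
    · refine Finset.sum_congr rfl fun i hi => ?_
      rw [hz_nonneg_real (2 * ((m / 2 + 1 + i : ℕ) : ℤ) - m) _ (2 * i + 1) (by omega)
        (by push_cast; ring) (by omega), show m / 2 + i + 1 = m / 2 + 1 + i by ring]

lemma sqrt_sq (x : ℝ≥0∞) : (x ^ 2) ^ ((1:ℝ)/2) = x := by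
  rw [← ENNReal.rpow_natCast, ← ENNReal.rpow_mul]; norm_num

lemma Y_lower (m i : ℕ) (u : ℝ → ℝ) (z : ℤ) (hi : i ≤ m) (h : hz (2 * i - m + 1) ≤ z) :
    W2 z (iteratedDeriv i u) ≤ Ynorm m u := by
  refine (W2_mono _ h).trans ?_
  unfold Ynorm
  rw [YnormSq_eq, ← sqrt_sq (W2 _ _)]
  apply ENNReal.rpow_le_rpow _ (by norm_num)
  exact Finset.single_le_sum (f := fun i : ℕ => W2 (hz (2 * i - m + 1)) (iteratedDeriv i u) ^ 2)
    (fun _ _ => zero_le) (Finset.mem_range.2 (by omega))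

lemma X_lower (m i : ℕ) (u : ℝ → ℝ) (z : ℤ) (hi : i ≤ m) (h : hz (2 * i - m) ≤ z) :
    W2 z (iteratedDeriv i u) ≤ Xnorm m u := by
  refine (W2_mono _ h).trans ?_
  unfold Xnorm
  rw [XnormSq_eq, ← sqrt_sq (W2 _ _)]
  apply ENNReal.rpow_le_rpow _ (by norm_num)
  exact Finset.single_le_sum (f := fun i : ℕ => W2 (hz (2 * i - m)) (iteratedDeriv i u) ^ 2)
    (fun _ _ => zero_le) (Finset.mem_range.2 (by omega))

lemma Y_upper (m : ℕ) (F : ℝ → ℝ) (R : ℝ≥0∞)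
    (h : ∀ i : ℕ, i ≤ m → W2 (hz (2 * i - m + 1)) (iteratedDeriv i F) ≤ R) :
    Ynorm m F ≤ (m + 1 : ℕ) * R := by
  unfold Ynorm
  rw [YnormSq_eq, ← sqrt_sq (_ * R)]
  apply ENNReal.rpow_le_rpow _ (by norm_num)
  calc _ ≤ ∑ i ∈ Finset.range (m + 1), R ^ 2 := by
        refine Finset.sum_le_sum fun i hi => ?_
        exact pow_le_pow_left₀ zero_le (h i (by rw [Finset.mem_range] at hi; omega)) 2
    _ = (m + 1 : ℕ) * R ^ 2 := by simp
    _ ≤ (m + 1 : ℕ) ^ 2 * R ^ 2 := by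
        gcongr
        norm_cast
        nlinarith
    _ = _ := by ring

lemma cd_iter (f : ℝ → ℝ) (hf : ContDiffOn ℝ (⊤ : ℕ∞) f (Set.Ioi 0)) (n : ℕ) :
    ContDiffOn ℝ (⊤ : ℕ∞) (iteratedDeriv n f) (Set.Ioi 0) := by
  induction n with
  | zero => simpa using hf
  | succ n ih =>
    rw [iteratedDeriv_succ]
    exact ih.deriv_of_isOpen isOpen_Ioi (by simp)

lemma leibniz (τ u v : ℝ → ℝ) (hτ : ContDiffOn ℝ (⊤ : ℕ∞) τ (Set.Ioi 0))
    (hu : ContDiffOn ℝ (⊤ : ℕ∞) u (Set.Ioi 0)) (hv : ContDiffOn ℝ (⊤ : ℕ∞) v (Set.Ioi 0))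
    (i : ℕ) (w : ℤ) (R : ℝ≥0∞)
    (h : ∀ a b c : ℕ, a + b + c = i → W2 w (fun s => iteratedDeriv a τ s *
      iteratedDeriv (b+1) u s * iteratedDeriv (c+1) v s) ≤ R) :
    W2 w (iteratedDeriv i (fun s => τ s * deriv u s * deriv v s)) ≤ 4 ^ i * R := by
  have hu' : ContDiffOn ℝ (⊤ : ℕ∞) (deriv u) (Set.Ioi 0) := by
    simpa [iteratedDeriv_one] using cd_iter u hu 1
  have hv' : ContDiffOn ℝ (⊤ : ℕ∞) (deriv v) (Set.Ioi 0) := by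
    simpa [iteratedDeriv_one] using cd_iter v hv 1
  have at' : ∀ {f : ℝ → ℝ}, ContDiffOn ℝ (⊤ : ℕ∞) f (Set.Ioi 0) → ∀ {s : ℝ},
      s ∈ Set.Ioo (0:ℝ) 1 → ∀ n : ℕ, ContDiffAt ℝ n f s := fun hf s hs n =>
    (hf.contDiffAt (Ioi_mem_nhds hs.1)).of_le (by exact_mod_cast le_top)
  set G : ℝ → ℝ := deriv u * deriv v with hG
  have hGc : ContDiffOn ℝ (⊤ : ℕ∞) G (Set.Ioi 0) := hu'.mul hv'
  have e : (fun s => τ s * deriv u s * deriv v s) = τ * G := by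
    ext s; simp [hG, mul_assoc]
  rw [e]
  have inner : ∀ a ∈ Finset.range (i+1), W2 w (fun s => iteratedDeriv a τ s * iteratedDeriv (i - a) G s)
      ≤ 2 ^ i * R := by
    intro a ha
    rw [Finset.mem_range] at ha
    have H := wL2_sum (Finset.range (i - a + 1)) ((w:ℝ)/8)
      (fun s => iteratedDeriv a τ s * iteratedDeriv (i - a) G s)
      (fun b s => iteratedDeriv a τ s * iteratedDeriv (b+1) u s * iteratedDeriv (i - a - b + 1) v s)
      (fun b => (i - a).choose b)
      (fun b _ => (((cd_iter τ hτ a).continuousOn.mul (cd_iter u hu _).continuousOn).mul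
        (cd_iter v hv _).continuousOn))
      (fun s hs => by
        rw [hG, iteratedDeriv_mul (at' hu' hs _) (at' hv' hs _), Finset.mul_sum]
        refine Finset.sum_congr rfl fun b _ => ?_
        rw [← iteratedDeriv_succ', ← iteratedDeriv_succ']
        ring)
    refine H.trans ?_
    calc _ ≤ ∑ b ∈ Finset.range (i - a + 1), ((i - a).choose b : ℝ≥0∞) * R := by
          refine Finset.sum_le_sum fun b hb => ?_
          rw [Finset.mem_range] at hb
          exact mul_le_mul_right (h a b (i - a - b) (by omega)) _
      _ = ((2 ^ (i - a) : ℕ) : ℝ≥0∞) * R := by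
          rw [← Finset.sum_mul, ← Nat.sum_range_choose (i - a)]
          push_cast; rfl
      _ ≤ _ := by
          push_cast
          gcongr
          · norm_num
          · omega
  have H := wL2_sum (Finset.range (i + 1)) ((w:ℝ)/8) (iteratedDeriv i (τ * G))
      (fun a s => iteratedDeriv a τ s * iteratedDeriv (i - a) G s)
      (fun b => i.choose b)
      (fun b _ => (cd_iter τ hτ b).continuousOn.mul (cd_iter G hGc _).continuousOn)
      (fun s hs => by
        rw [iteratedDeriv_mul (at' hτ hs _) (at' hGc hs _)]
        refine Finset.sum_congr rfl fun b _ => ?_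
        ring)
  refine H.trans ?_
  calc _ ≤ ∑ b ∈ Finset.range (i + 1), (i.choose b : ℝ≥0∞) * (2 ^ i * R) := by
        refine Finset.sum_le_sum fun b hb => ?_
        exact mul_le_mul_right (inner b hb) _
    _ = ((2 ^ i : ℕ) : ℝ≥0∞) * (2 ^ i * R) := by
        rw [← Finset.sum_mul, ← Nat.sum_range_choose i]
        push_cast; rfl
    _ = _ := by
        push_cast
        rw [← mul_assoc, ← mul_pow]; norm_num

lemma Linf_u (m j : ℕ) (u : ℝ → ℝ) (hu : ContDiffOn ℝ (⊤ : ℕ∞) u (Set.Ioi 0)) (hj : j ≤ m) :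
    Wi (lz (2 * j + 1 - m)) (iteratedDeriv j u) ≤ 2 ^ (m + 3) * Ynorm (m + 1) u := by
  have h1 := sobolev (iteratedDeriv j u) (cd_iter u hu j) (2 * j + 1 - m) (m + 1) (by omega)
    (by push_cast; omega)
  rw [← iteratedDeriv_succ] at h1
  refine h1.trans ?_
  have h2 := Y_lower (m+1) (j+1) u (hz (2 * j + 1 - m + 1)) (by omega)
    (by unfold hz; push_cast; omega)
  have h3 := Y_lower (m+1) j u (hz (2 * j + 1 - m - 1)) (by omega)
    (by unfold hz; push_cast; omega)
  calc _ ≤ 2 ^ (m + 1 + 1) * (Ynorm (m+1) u + Ynorm (m+1) u) :=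
        mul_le_mul_right (add_le_add h2 h3) _
    _ = _ := by ring

lemma Linf_tau (m a : ℕ) (τ : ℝ → ℝ) (hτ : ContDiffOn ℝ (⊤ : ℕ∞) τ (Set.Ioi 0)) (ha : 1 ≤ a)
    (ham : a + 1 ≤ m) :
    Wi (lz (2 * a - m)) (iteratedDeriv a τ) ≤ 2 ^ (m + 3) * Xnorm (m - 1) (deriv τ) := by
  have h1 := sobolev (iteratedDeriv a τ) (cd_iter τ hτ a) (2 * a - m) (m + 1) (by omega)
    (by push_cast; omega)
  rw [← iteratedDeriv_succ] at h1
  refine h1.trans ?_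
  have h2 := X_lower (m-1) a (deriv τ) (hz (2 * a - m + 1)) (by omega)
    (by unfold hz; omega)
  have h3 := X_lower (m-1) (a-1) (deriv τ) (hz (2 * a - m - 1)) (by omega)
    (by unfold hz; omega)
  rw [← iteratedDeriv_succ'] at h2 h3
  rw [show a - 1 + 1 = a by omega] at h3
  calc _ ≤ 2 ^ (m + 1 + 1) * (Xnorm (m-1) (deriv τ) + Xnorm (m-1) (deriv τ)) :=
        mul_le_mul_right (add_le_add h2 h3) _
    _ = _ := by ring

lemma sym_case (m a b c : ℕ) (hm : 2 ≤ m) (habc : a + b + c ≤ m) (z : ℤ) (f u v F : ℝ → ℝ)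
    (T : ℝ≥0∞) (hf : Wi z f ≤ T) (hcb : c ≤ b)
    (hz' : (a = 0 ∧ z = -8) ∨ (m = 2 ∧ a = 1 ∧ z = 0))
    (hu : ContDiffOn ℝ (⊤ : ℕ∞) u (Set.Ioi 0)) (hv : ContDiffOn ℝ (⊤ : ℕ∞) v (Set.Ioi 0))
    (hF : ∀ s, F s = f s * iteratedDeriv (b+1) u s * iteratedDeriv (c+1) v s) :
    W2 (hz (2 * (a + b + c : ℕ) - m + 1)) F ≤
      2 ^ (m + 3) * (T * (Ynorm (m+1) u * Ynorm (m+1) v)) := by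
  have h1 := Linf_u m (c+1) v hv (by omega)
  have h2 := Y_lower (m+1) (b+1) u (hz (2 * (b + 1) - m)) (by omega)
    (by unfold hz; push_cast; omega)
  have h3 := triA (α := hz (2 * (b + 1) - m)) (β := z) (γ := lz (2 * ((c + 1 : ℕ) : ℤ) + 1 - m))
    (w := hz (2 * (a + b + c : ℕ) - m + 1)) F (iteratedDeriv (b+1) u) f (iteratedDeriv (c+1) v)
    (by unfold hz lz; push_cast; split_ifs <;> omega) (cd_iter u hu _).continuousOn
    (fun s => by rw [hF s]; ring)
  refine h3.trans ?_
  calc _ ≤ Ynorm (m+1) u * (T * (2 ^ (m + 3) * Ynorm (m + 1) v)) := by gcongr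
    _ = _ := by ring

lemma tri_case (m a b c : ℕ) (hm : 2 ≤ m) (habc : a + b + c ≤ m) (τ u v : ℝ → ℝ)
    (hτ : ContDiffOn ℝ (⊤ : ℕ∞) τ (Set.Ici 0)) (h0 : τ 0 = 0)
    (hu : ContDiffOn ℝ (⊤ : ℕ∞) u (Set.Ioi 0)) (hv : ContDiffOn ℝ (⊤ : ℕ∞) v (Set.Ioi 0)) :
    W2 (hz (2 * (a + b + c : ℕ) - m + 1))
      (fun s => iteratedDeriv a τ s * iteratedDeriv (b+1) u s * iteratedDeriv (c+1) v s) ≤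
      2 * (2 ^ (m + 3)) ^ 3 * ((Wi 0 (deriv τ) + Xnorm (m-1) (deriv τ)) *
        (Ynorm (m+1) u * Ynorm (m+1) v)) := by
  have hτ' : ContDiffOn ℝ (⊤ : ℕ∞) τ (Set.Ioi 0) := hτ.mono Set.Ioi_subset_Ici_self
  have hK : (1:ℝ≥0∞) ≤ 2 ^ (m+3) := one_le_pow₀ (by norm_num)
  generalize hKd : (2:ℝ≥0∞) ^ (m+3) = K at hK
  set T := Wi 0 (deriv τ) + Xnorm (m-1) (deriv τ) with hT
  have hT1 : Wi 0 (deriv τ) ≤ T := le_self_add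
  have hT2 : Xnorm (m-1) (deriv τ) ≤ T := le_add_self
  set U := Ynorm (m+1) u
  set V := Ynorm (m+1) v
  have k1 : K * (T * (U * V)) ≤ 2 * K ^ 3 * (T * (U * V)) := by
    gcongr
    calc K = 1 * K ^ 1 := by simp
      _ ≤ 2 * K ^ 3 := by
        gcongr
        · norm_num
        · norm_num
  have sym : ∀ (f : ℝ → ℝ) (z : ℤ), Wi z f ≤ T → (a = 0 ∧ z = -8) ∨ (m = 2 ∧ a = 1 ∧ z = 0) →
      W2 (hz (2 * (a + b + c : ℕ) - m + 1))
        (fun s => f s * iteratedDeriv (b+1) u s * iteratedDeriv (c+1) v s) ≤ 2 * K ^ 3 * (T * (U * V)) := by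
    intro f z hf hz'
    refine le_trans ?_ k1
    rcases le_total c b with h | h
    · rw [← hKd]
      exact sym_case m a b c hm habc z f u v _ T hf h hz' hu hv (fun s => rfl)
    · rw [← hKd, mul_comm U V, show a + b + c = a + c + b by ring]
      exact sym_case m a c b hm (by omega) z f v u _ T hf h hz' hv hu (fun s => by ring)
  by_cases ha0 : a = 0
  · subst ha0
    have := sym τ (-8) ((tau_inf τ hτ h0).trans hT1) (Or.inl ⟨rfl, rfl⟩)
    simpa using this
  by_cases ha1 : m = 2 ∧ a = 1
  · have := sym (deriv τ) 0 hT1 (Or.inr ⟨ha1.1, ha1.2, rfl⟩)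
    rw [ha1.2] at this ⊢
    rw [iteratedDeriv_one]
    exact this
  have hUi := Linf_u m (b+1) u hu (by omega)
  have hVi := Linf_u m (c+1) v hv (by omega)
  rw [hKd] at hUi hVi
  by_cases ham : a = m
  · have h2 := X_lower (m-1) (a-1) (deriv τ) (hz (2 * a - m - 1)) (by omega)
      (by unfold hz; omega)
    rw [← iteratedDeriv_succ', show a - 1 + 1 = a by omega] at h2
    refine (triA (α := hz (2 * a - m - 1)) (β := lz (2 * ((b + 1 : ℕ) : ℤ) + 1 - m))
      (γ := lz (2 * ((c + 1 : ℕ) : ℤ) + 1 - m)) _ _ _ _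
      (by unfold hz lz; push_cast; split_ifs <;> omega) (cd_iter τ hτ' a).continuousOn
      (fun s => rfl)).trans ?_
    calc _ ≤ T * ((K * U) * (K * V)) := by
          gcongr
          exact h2.trans hT2
      _ = 1 * K ^ 2 * (T * (U * V)) := by ring
      _ ≤ _ := by
          gcongr
          · norm_num
          · norm_num
  have fin : ∀ (z : ℤ), Wi z (iteratedDeriv a τ) ≤ K * T →
      (z + lz (2 * ((b + 1 : ℕ) : ℤ) + 1 - m) + lz (2 * ((c + 1 : ℕ) : ℤ) + 1 - m) ≤
        hz (2 * (a + b + c : ℕ) - m + 1) + 2) →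
      W2 (hz (2 * (a + b + c : ℕ) - m + 1))
      (fun s => iteratedDeriv a τ s * iteratedDeriv (b+1) u s * iteratedDeriv (c+1) v s) ≤
      2 * K ^ 3 * (T * (U * V)) := by
    intro z hz1 hz2
    refine (triB _ _ _ _ hz2 (fun s => rfl)).trans ?_
    calc _ ≤ 2 * ((K * T) * ((K * U) * (K * V))) := by gcongr
      _ = _ := by ring
  by_cases ha : a = 1
  · apply fin 0
    · rw [ha, iteratedDeriv_one]
      calc _ ≤ 1 * T := by rw [one_mul]; exact hT1
        _ ≤ _ := by gcongr
    · unfold hz lz; push_cast; split_ifs <;> omega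
  · apply fin (lz (2 * a - m))
    · have := Linf_tau m a τ hτ' (by omega) (by omega)
      rw [hKd] at this
      exact this.trans (mul_le_mul_right hT2 _)
    · unfold hz lz; push_cast; split_ifs <;> omega

lemma exists_real_const (K : ℝ≥0∞) (hK : K ≠ ⊤) : ∃ C : ℝ, 0 < C ∧ K ≤ ENNReal.ofReal C := by
  refine ⟨K.toReal + 1, by positivity, ?_⟩
  rw [ENNReal.le_ofReal_iff_toReal_le hK (by positivity)]
  linarith

lemma wL2_zero (f : ℝ → ℝ) : wL2 0 f = W2 0 f := by simp [W2]
lemma wLinf_zero (f : ℝ → ℝ) : wLinf 0 f = Wi 0 f := by simp [Wi]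

lemma low1 (τ u v : ℝ → ℝ) (hτ : ContDiffOn ℝ (⊤ : ℕ∞) τ (Set.Ici 0)) (h0 : τ 0 = 0)
    (hu : ContDiffOn ℝ (⊤ : ℕ∞) u (Set.Ioi 0)) (hv : ContDiffOn ℝ (⊤ : ℕ∞) v (Set.Ioi 0)) :
    Ynorm 0 (fun s => τ s * deriv u s * deriv v s) ≤
      2 ^ 10 * (W2 0 (deriv τ) * (Ynorm 3 u * Ynorm 2 v)) := by
  refine (Y_upper 0 _ (2 ^ 10 * (W2 0 (deriv τ) * (Ynorm 3 u * Ynorm 2 v))) ?_).trans (by simp)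
  intro i hi
  obtain rfl : i = 0 := by omega
  have h1 := Linf_u 2 1 u hu (by norm_num)
  have h2 := Y_lower 2 1 v 4 (by norm_num) (by unfold hz; norm_num)
  have h3 := tau_two τ hτ h0
  rw [iteratedDeriv_one] at h1 h2
  rw [iteratedDeriv_zero]
  refine (triA _ (deriv v) τ (deriv u) (α := 4) (β := -4) (γ := lz (2 * ((1:ℕ):ℤ) + 1 - ((2:ℕ):ℤ)))
    (by unfold hz lz; norm_num) ?_ (fun s => by ring)).trans ?_
  · simpa [iteratedDeriv_one] using (cd_iter v hv 1).continuousOn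
  calc _ ≤ Ynorm 2 v * (W2 0 (deriv τ) * (2 ^ (2 + 3) * Ynorm 3 u)) := by gcongr
    _ = 2 ^ 5 * (W2 0 (deriv τ) * (Ynorm 3 u * Ynorm 2 v)) := by ring
    _ ≤ _ := by
      gcongr
      · norm_num
      · norm_num

lemma low2 (τ u v : ℝ → ℝ) (hτ : ContDiffOn ℝ (⊤ : ℕ∞) τ (Set.Ici 0)) (h0 : τ 0 = 0)
    (hu : ContDiffOn ℝ (⊤ : ℕ∞) u (Set.Ioi 0)) (hv : ContDiffOn ℝ (⊤ : ℕ∞) v (Set.Ioi 0)) :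
    Ynorm 0 (fun s => τ s * deriv u s * deriv v s) ≤
      2 ^ 10 * (Wi 0 (deriv τ) * (Ynorm 2 u * Ynorm 2 v)) := by
  refine (Y_upper 0 _ (2 ^ 10 * (Wi 0 (deriv τ) * (Ynorm 2 u * Ynorm 2 v))) ?_).trans (by simp)
  intro i hi
  obtain rfl : i = 0 := by omega
  have h1 := Linf_u 1 1 u hu (by norm_num)
  have h2 := Y_lower 2 1 v 4 (by norm_num) (by unfold hz; norm_num)
  have h3 := tau_inf τ hτ h0
  rw [iteratedDeriv_one] at h1 h2
  rw [iteratedDeriv_zero]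
  refine (triA _ (deriv v) τ (deriv u) (α := 4) (β := -8) (γ := lz (2 * ((1:ℕ):ℤ) + 1 - ((1:ℕ):ℤ)))
    (by unfold hz lz; norm_num) ?_ (fun s => by ring)).trans ?_
  · simpa [iteratedDeriv_one] using (cd_iter v hv 1).continuousOn
  calc _ ≤ Ynorm 2 v * (Wi 0 (deriv τ) * (2 ^ (1 + 3) * Ynorm 2 u)) := by gcongr
    _ = 2 ^ 4 * (Wi 0 (deriv τ) * (Ynorm 2 u * Ynorm 2 v)) := by ring
    _ ≤ _ := by
      gcongr
      · norm_num
      · norm_num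

lemma low3 (τ u v : ℝ → ℝ) (hτ : ContDiffOn ℝ (⊤ : ℕ∞) τ (Set.Ici 0)) (h0 : τ 0 = 0)
    (hu : ContDiffOn ℝ (⊤ : ℕ∞) u (Set.Ioi 0)) (hv : ContDiffOn ℝ (⊤ : ℕ∞) v (Set.Ioi 0)) :
    Ynorm 1 (fun s => τ s * deriv u s * deriv v s) ≤
      2 ^ 10 * (Wi 0 (deriv τ) * (Ynorm 3 u * Ynorm 2 v)) := by
  have hτ' : ContDiffOn ℝ (⊤ : ℕ∞) τ (Set.Ioi 0) := hτ.mono Set.Ioi_subset_Ici_self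
  set P := Wi 0 (deriv τ) * (Ynorm 3 u * Ynorm 2 v) with hP
  have hu1 := Linf_u 2 1 u hu (by norm_num)
  have hv1 := Linf_u 1 1 v hv (by norm_num)
  have hu2 := Y_lower 3 2 u 8 (by norm_num) (by unfold hz; norm_num)
  have hv2 := Y_lower 2 1 v 4 (by norm_num) (by unfold hz; norm_num)
  have hv3 := Y_lower 2 2 v 12 (by norm_num) (by unfold hz; norm_num)
  have hT0 : Wi (-8) (iteratedDeriv 0 τ) ≤ Wi 0 (deriv τ) := by
    rw [iteratedDeriv_zero]; exact tau_inf τ hτ h0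
  have hT1 : Wi 0 (iteratedDeriv 1 τ) ≤ Wi 0 (deriv τ) := by rw [iteratedDeriv_one]
  have key : ∀ a b c : ℕ, a + b + c ≤ 1 → W2 (hz (2 * (a + b + c : ℕ) - (1:ℕ) + 1))
      (fun s => iteratedDeriv a τ s * iteratedDeriv (b+1) u s * iteratedDeriv (c+1) v s) ≤
      2 ^ 5 * P := by
    intro a b c h
    have cases : (a = 0 ∧ b = 0 ∧ c = 0) ∨ (a = 1 ∧ b = 0 ∧ c = 0) ∨ (a = 0 ∧ b = 1 ∧ c = 0) ∨
      (a = 0 ∧ b = 0 ∧ c = 1) := by omega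
    rcases cases with ⟨rfl, rfl, rfl⟩ | ⟨rfl, rfl, rfl⟩ | ⟨rfl, rfl, rfl⟩ | ⟨rfl, rfl, rfl⟩
    · refine (triA _ (iteratedDeriv 1 v) (iteratedDeriv 0 τ) (iteratedDeriv 1 u)
        (α := 4) (β := -8) (γ := lz (2 * ((1:ℕ):ℤ) + 1 - ((2:ℕ):ℤ)))
        (by unfold hz lz; norm_num) (cd_iter v hv 1).continuousOn (fun s => by ring)).trans ?_
      calc _ ≤ Ynorm 2 v * (Wi 0 (deriv τ) * (2 ^ (2 + 3) * Ynorm 3 u)) := by gcongr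
        _ = _ := by rw [hP]; ring
    · refine (triA _ (iteratedDeriv 1 v) (iteratedDeriv 1 τ) (iteratedDeriv 1 u)
        (α := 4) (β := 0) (γ := lz (2 * ((1:ℕ):ℤ) + 1 - ((2:ℕ):ℤ)))
        (by unfold hz lz; norm_num) (cd_iter v hv 1).continuousOn (fun s => by ring)).trans ?_
      calc _ ≤ Ynorm 2 v * (Wi 0 (deriv τ) * (2 ^ (2 + 3) * Ynorm 3 u)) := by gcongr
        _ = _ := by rw [hP]; ring
    · refine (triA _ (iteratedDeriv 2 u) (iteratedDeriv 0 τ) (iteratedDeriv 1 v)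
        (α := 8) (β := -8) (γ := lz (2 * ((1:ℕ):ℤ) + 1 - ((1:ℕ):ℤ)))
        (by unfold hz lz; norm_num) (cd_iter u hu 2).continuousOn (fun s => by ring)).trans ?_
      calc _ ≤ Ynorm 3 u * (Wi 0 (deriv τ) * (2 ^ (1 + 3) * Ynorm 2 v)) := by gcongr
        _ = 2 ^ 4 * P := by rw [hP]; ring
        _ ≤ _ := by
          gcongr
          · norm_num
          · norm_num
    · refine (triA _ (iteratedDeriv 2 v) (iteratedDeriv 0 τ) (iteratedDeriv 1 u)
        (α := 12) (β := -8) (γ := lz (2 * ((1:ℕ):ℤ) + 1 - ((2:ℕ):ℤ)))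
        (by unfold hz lz; norm_num) (cd_iter v hv 2).continuousOn (fun s => by ring)).trans ?_
      calc _ ≤ Ynorm 2 v * (Wi 0 (deriv τ) * (2 ^ (2 + 3) * Ynorm 3 u)) := by gcongr
        _ = _ := by rw [hP]; ring
  refine (Y_upper 1 _ (4 * (2 ^ 5 * P)) ?_).trans ?_
  · intro i hi
    refine (leibniz τ u v hτ' hu hv i _ (2 ^ 5 * P) ?_).trans ?_
    · rintro a b c rfl
      exact key a b c hi
    · gcongr
      calc (4:ℝ≥0∞) ^ i ≤ 4 ^ 1 := by
            gcongr
            norm_num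
        _ = 4 := by norm_num
  · calc _ = 2 ^ 8 * P := by push_cast; ring
      _ ≤ _ := by
        gcongr
        · norm_num
        · norm_num

/-- estimates for `‖τ u' v'‖_{Y^m}` when `τ(0) = 0`. -/
theorem stmt9 :
    (∃ C : ℝ, 0 < C ∧ ∀ τ u v : ℝ → ℝ,
      ContDiffOn ℝ (⊤ : ℕ∞) τ (Set.Ici 0) → τ 0 = 0 →
      ContDiffOn ℝ (⊤ : ℕ∞) u (Set.Ioi 0) → ContDiffOn ℝ (⊤ : ℕ∞) v (Set.Ioi 0) →
      (Ynorm 0 (fun s => τ s * deriv u s * deriv v s) ≤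
          ENNReal.ofReal C * (wL2 0 (deriv τ) * (Ynorm 3 u * Ynorm 2 v)) ∧
       Ynorm 0 (fun s => τ s * deriv u s * deriv v s) ≤
          ENNReal.ofReal C * (wLinf 0 (deriv τ) * (Ynorm 2 u * Ynorm 2 v)) ∧
       Ynorm 1 (fun s => τ s * deriv u s * deriv v s) ≤
          ENNReal.ofReal C * (wLinf 0 (deriv τ) * (Ynorm 3 u * Ynorm 2 v)))) ∧
    (∀ m : ℕ, 2 ≤ m → ∃ C : ℝ, 0 < C ∧ ∀ τ u v : ℝ → ℝ,
      ContDiffOn ℝ (⊤ : ℕ∞) τ (Set.Ici 0) → τ 0 = 0 →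
      ContDiffOn ℝ (⊤ : ℕ∞) u (Set.Ioi 0) → ContDiffOn ℝ (⊤ : ℕ∞) v (Set.Ioi 0) →
      Ynorm m (fun s => τ s * deriv u s * deriv v s) ≤
        ENNReal.ofReal C *
          ((wLinf 0 (deriv τ) + Xnorm (m - 1) (deriv τ)) * (Ynorm (m + 1) u * Ynorm (m + 1) v))) := by
  constructor
  · obtain ⟨C, hC, hKC⟩ := exists_real_const (2 ^ 10) (by norm_num)
    refine ⟨C, hC, fun τ u v hτ h0 hu hv => ⟨?_, ?_, ?_⟩⟩
    · rw [wL2_zero]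
      exact (low1 τ u v hτ h0 hu hv).trans (mul_le_mul_left hKC _)
    · rw [wLinf_zero]
      exact (low2 τ u v hτ h0 hu hv).trans (mul_le_mul_left hKC _)
    · rw [wLinf_zero]
      exact (low3 τ u v hτ h0 hu hv).trans (mul_le_mul_left hKC _)
  · intro m hm
    obtain ⟨C, hC, hKC⟩ := exists_real_const (((m + 1 : ℕ) : ℝ≥0∞) * (4 ^ m * (2 * (2 ^ (m + 3)) ^ 3)))
      (by finiteness)
    refine ⟨C, hC, fun τ u v hτ h0 hu hv => ?_⟩
    rw [wLinf_zero]
    refine le_trans ?_ (mul_le_mul_left hKC _)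
    rw [mul_assoc, mul_assoc (4 ^ m)]
    apply Y_upper
    intro i hi
    refine (leibniz τ u v (hτ.mono Set.Ioi_subset_Ici_self) hu hv i _ _ (fun a b c habc => ?_)).trans
      (mul_le_mul_left (pow_le_pow_right₀ (by norm_num) hi) _)
    subst habc
    exact tri_case m a b c hm hi τ u v hτ h0 hu hv
end
end
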